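/- arXiv:1906.05822 — 3 statements merged into one kernel-verified Lean document; each statement's English description precedes it below -/
import Mathlib

section
/- Let φ ∈ 𝓢(ℝ²) be real-valued and nonzero, and suppose the sharp Gagliardo–Nirenberg inequality holds with constant determined by φ: for all f ∈ 𝓢(ℝ²), ∫_{ℝ²} f⁴ ≤ (2/‖φ‖²_{L²(ℝ²)}) · (∫_{ℝ²} f²) · (∫_{ℝ²} |∇f|²). Let T > 0 and suppose t ↦ v(t) is a continuously differentiable curve from [0, T] into 𝓢(ℝ²) satisfying the focusing mZK equation ∂_t v + ∂_x(∂_x² v + ∂_y² v) + ∂_x(v³) = 0 (as an identity in 𝓢(ℝ²)) for all t ∈ [0, T], and suppose ‖v(0)‖_{L²(ℝ²)} < ‖φ‖_{L²(ℝ²)}. Then for every t ∈ [0, T], ∫_{ℝ²} |∇v(x,y,t)|² dx dy ≤ (2/(1 − ‖v(0)‖²_{L²(ℝ²)}/‖φ‖²_{L²(ℝ²)})) · 𝓔[v(0)], where 𝓔[v] = (1/2)∫_{ℝ²}|∇v|² dx dy − (1/4)∫_{ℝ²} v⁴ dx dy. -/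
open MeasureTheory

/-- Partial derivative in the first variable of a function on ℝ². -/
noncomputable def pdX (f : ℝ × ℝ → ℝ) (p : ℝ × ℝ) : ℝ := fderiv ℝ f p (1, 0)

/-- Partial derivative in the second variable of a function on ℝ². -/
noncomputable def pdY (f : ℝ × ℝ → ℝ) (p : ℝ × ℝ) : ℝ := fderiv ℝ f p (0, 1)

open LineDeriv

/-- A family of functions on the plane, differentiable in time with derivative `u'`,
such that `u` and `u'` decay uniformly in time. -/
structure IsDecayingFamily (T : ℝ) (u u' : ℝ → ℝ × ℝ → ℝ) : Prop where
  hasDeriv : ∀ p, ∀ t ∈ Set.Icc (0 : ℝ) T,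
    HasDerivWithinAt (fun s => u s p) (u' t p) (Set.Icc (0 : ℝ) T) t
  continuous : ∀ t ∈ Set.Icc (0 : ℝ) T, Continuous (u t)
  continuous_deriv : ∀ t ∈ Set.Icc (0 : ℝ) T, Continuous (u' t)
  bound : ∃ C, ∀ t ∈ Set.Icc (0 : ℝ) T, ∀ p,
    |u t p| ≤ C * (1 + ‖p‖) ^ (-3 : ℝ) ∧ |u' t p| ≤ C * (1 + ‖p‖) ^ (-3 : ℝ)

lemma integrable_one_add_norm_rpow_neg_three :
    Integrable (fun p : ℝ × ℝ => (1 + ‖p‖) ^ (-3 : ℝ)) := by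
  apply integrable_one_add_norm
  simp
  norm_num

lemma IsDecayingFamily.mul {T : ℝ} {u u' w w' : ℝ → ℝ × ℝ → ℝ}
    (hu : IsDecayingFamily T u u') (hw : IsDecayingFamily T w w') :
    IsDecayingFamily T (fun t p => u t p * w t p)
      (fun t p => u' t p * w t p + u t p * w' t p) where
  hasDeriv p t ht := (hu.hasDeriv p t ht).mul (hw.hasDeriv p t ht)
  continuous t ht := (hu.continuous t ht).mul (hw.continuous t ht)
  continuous_deriv t ht :=
    ((hu.continuous_deriv t ht).mul (hw.continuous t ht)).add
      ((hu.continuous t ht).mul (hw.continuous_deriv t ht))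
  bound := by
    obtain ⟨C, hC⟩ := hu.bound
    obtain ⟨D, hD⟩ := hw.bound
    refine ⟨2 * (|C| * |D|), fun t ht p => ?_⟩
    set g := (1 + ‖p‖) ^ (-3 : ℝ) with hg
    have hp : 1 ≤ 1 + ‖p‖ := by linarith [norm_nonneg p]
    have hg0 : 0 ≤ g := by positivity
    have hg1 : g ≤ 1 := Real.rpow_le_one_of_one_le_of_nonpos hp (by norm_num)
    have hCg : C * g ≤ |C| * g := mul_le_mul_of_nonneg_right (le_abs_self C) hg0
    have hDg : D * g ≤ |D| * g := mul_le_mul_of_nonneg_right (le_abs_self D) hg0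
    have key : ∀ a b : ℝ, |a| ≤ C * g → |b| ≤ D * g → |a * b| ≤ |C| * |D| * g := by
      intro a b ha hb
      calc |a * b| = |a| * |b| := abs_mul a b
        _ ≤ (|C| * g) * (|D| * g) :=
          mul_le_mul (ha.trans hCg) (hb.trans hDg) (abs_nonneg b) (by positivity)
        _ = (|C| * |D| * g) * g := by ring
        _ ≤ |C| * |D| * g := mul_le_of_le_one_right (by positivity) hg1
    obtain ⟨h1, h2⟩ := hC t ht p
    obtain ⟨h3, h4⟩ := hD t ht p
    have hnonneg : 0 ≤ |C| * |D| * g := by positivity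
    refine ⟨(key _ _ h1 h3).trans (by linarith), (abs_add_le _ _).trans ?_⟩
    linarith [key _ _ h2 h3, key _ _ h1 h4]

lemma IsDecayingFamily.integrable {T : ℝ} {u u' : ℝ → ℝ × ℝ → ℝ}
    (hu : IsDecayingFamily T u u') {t : ℝ} (ht : t ∈ Set.Icc (0 : ℝ) T) :
    Integrable (u t) := by
  obtain ⟨C, hC⟩ := hu.bound
  exact (integrable_one_add_norm_rpow_neg_three.const_mul C).mono'
    (hu.continuous t ht).aestronglyMeasurable (.of_forall fun p => (hC t ht p).1)

lemma IsDecayingFamily.continuousOn_integral {T : ℝ} {u u' : ℝ → ℝ × ℝ → ℝ}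
    (hu : IsDecayingFamily T u u') :
    ContinuousOn (fun t => ∫ p, u t p) (Set.Icc 0 T) := by
  obtain ⟨C, hC⟩ := hu.bound
  exact continuousOn_of_dominated
    (fun t ht => (hu.continuous t ht).aestronglyMeasurable)
    (fun t ht => .of_forall fun p => (hC t ht p).1)
    (integrable_one_add_norm_rpow_neg_three.const_mul C)
    (.of_forall fun p t ht => (hu.hasDeriv p t ht).continuousWithinAt)

lemma IsDecayingFamily.hasDerivAt_integral {T : ℝ} {u u' : ℝ → ℝ × ℝ → ℝ}
    (hu : IsDecayingFamily T u u') {t : ℝ} (ht : t ∈ Set.Ioo 0 T) :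
    HasDerivAt (fun s => ∫ p, u s p) (∫ p, u' t p) t := by
  obtain ⟨C, hC⟩ := hu.bound
  have hmem : Set.Ioo 0 T ∈ nhds t := isOpen_Ioo.mem_nhds ht
  have hsub : Set.Ioo 0 T ⊆ Set.Icc 0 T := Set.Ioo_subset_Icc_self
  refine (hasDerivAt_integral_of_dominated_loc_of_deriv_le (s := Set.Ioo 0 T) hmem
    ?_ (hu.integrable (hsub ht)) (hu.continuous_deriv t (hsub ht)).aestronglyMeasurable
    (.of_forall fun p s hs => (hC s (hsub hs) p).2)
    (integrable_one_add_norm_rpow_neg_three.const_mul C)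
    (.of_forall fun p s hs => (hu.hasDeriv p s (hsub hs)).hasDerivAt
      (Icc_mem_nhds hs.1 hs.2))).2
  filter_upwards [hmem] with s hs
  exact (hu.continuous s (hsub hs)).aestronglyMeasurable

/-- A continuous curve in Schwartz space which is the pointwise time derivative of `v`. -/
structure IsSchwartzC1Curve (T : ℝ) (v v' : ℝ → SchwartzMap (ℝ × ℝ) ℝ) : Prop where
  hasDeriv : ∀ p : ℝ × ℝ, ∀ t ∈ Set.Icc (0 : ℝ) T,
    HasDerivWithinAt (fun s => v s p) (v' t p) (Set.Icc (0 : ℝ) T) t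
  continuousOn_deriv : ContinuousOn (fun t => v' t) (Set.Icc (0 : ℝ) T)

lemma SchwartzMap.exists_decay_of_continuousOn {T : ℝ} {w : ℝ → SchwartzMap (ℝ × ℝ) ℝ}
    (hw : ContinuousOn w (Set.Icc 0 T)) :
    ∃ C, ∀ t ∈ Set.Icc (0 : ℝ) T, ∀ p, |w t p| ≤ C * (1 + ‖p‖) ^ (-3 : ℝ) := by
  set N : Seminorm ℝ (SchwartzMap (ℝ × ℝ) ℝ) :=
    (Finset.Iic (3, 0)).sup (fun m : ℕ × ℕ => SchwartzMap.seminorm ℝ m.1 m.2)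
  have hN : Continuous N := by
    have h : Continuous fun f => (Finset.Iic ((3, 0) : ℕ × ℕ)).sup fun m =>
        (⟨SchwartzMap.seminorm ℝ m.1 m.2 f, apply_nonneg _ f⟩ : NNReal) :=
      Continuous.finset_sup_apply (L := NNReal) fun m _ =>
        ((schwartz_withSeminorms ℝ (ℝ × ℝ) ℝ).continuous_seminorm m).subtype_mk _
    convert continuous_subtype_val.comp h using 1
    exact funext fun f => Seminorm.finset_sup_apply _ _ _
  obtain ⟨B, hB⟩ := isCompact_Icc.bddAbove_image (hN.comp_continuousOn hw)
  refine ⟨2 ^ 3 * B, fun t ht p => ?_⟩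
  have h1 := SchwartzMap.one_add_le_sup_seminorm_apply (𝕜 := ℝ) (m := (3, 0))
    (le_refl 3) (le_refl 0) (w t) p
  have h2 : N (w t) ≤ B := hB ⟨t, ht, rfl⟩
  rw [norm_iteratedFDeriv_zero, Real.norm_eq_abs] at h1
  have hpos : 0 < 1 + ‖p‖ := by positivity
  rw [Real.rpow_neg hpos.le, ← div_eq_mul_inv, le_div_iff₀ (by positivity)]
  norm_cast
  rw [mul_comm]
  have h3 : (2 : ℝ) ^ 3 * N (w t) ≤ 2 ^ 3 * B := by gcongr
  exact_mod_cast h1.trans h3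

lemma IsSchwartzC1Curve.isDecayingFamily {T : ℝ} {v v' : ℝ → SchwartzMap (ℝ × ℝ) ℝ}
    (hv : IsSchwartzC1Curve T v v') :
    IsDecayingFamily T (fun t p => v t p) (fun t p => v' t p) where
  hasDeriv := hv.hasDeriv
  continuous t _ := (v t).continuous
  continuous_deriv t _ := (v' t).continuous
  bound := by
    obtain ⟨C, hC⟩ := SchwartzMap.exists_decay_of_continuousOn hv.continuousOn_deriv
    obtain ⟨D, hD⟩ := SchwartzMap.exists_decay_of_continuousOn (T := T) (w := fun _ => v 0)
      continuousOn_const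
    refine ⟨|D| + |C| * T + |C|, fun t ht p => ?_⟩
    have hT : 0 ≤ T := ht.1.trans ht.2
    have h0 : (0 : ℝ) ∈ Set.Icc 0 T := ⟨le_rfl, hT⟩
    have hg : 0 ≤ (1 + ‖p‖) ^ (-3 : ℝ) := by positivity
    set g := (1 + ‖p‖) ^ (-3 : ℝ)
    have hCg : C * g ≤ |C| * g := mul_le_mul_of_nonneg_right (le_abs_self C) hg
    have hDg : D * g ≤ |D| * g := mul_le_mul_of_nonneg_right (le_abs_self D) hg
    have hmv := (convex_Icc (0 : ℝ) T).norm_image_sub_le_of_norm_hasDerivWithin_le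
      (hv.hasDeriv p) (fun s hs => (hC s hs p).trans hCg) h0 ht
    simp only [Real.norm_eq_abs, sub_zero, abs_of_nonneg ht.1] at hmv
    have hTt : |C| * g * t ≤ |C| * g * T := by gcongr; exact ht.2
    have h3 := hD t ht p
    have h4 := abs_sub_abs_le_abs_sub (v t p) (v 0 p)
    have h5 : 0 ≤ |C| * g * T := by positivity
    have h6 : 0 ≤ |C| * g := by positivity
    have h7 : 0 ≤ |D| * g := by positivity
    have h8 := hC t ht p
    constructor
    · linarith
    · linarith

lemma IsSchwartzC1Curve.lineDeriv {T : ℝ} (hT : 0 < T) {v v' : ℝ → SchwartzMap (ℝ × ℝ) ℝ}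
    (hv : IsSchwartzC1Curve T v v') (m : ℝ × ℝ) :
    IsSchwartzC1Curve T (fun t => ∂_{m} (v t)) (fun t => ∂_{m} (v' t)) where
  continuousOn_deriv :=
    (lineDerivOpCLM ℝ (SchwartzMap (ℝ × ℝ) ℝ) m).continuous.comp_continuousOn
      hv.continuousOn_deriv
  hasDeriv := by
    set w : ℝ → SchwartzMap (ℝ × ℝ) ℝ := Set.IccExtend hT.le ((Set.Icc 0 T).domRestrict v')
      with hw_def
    have hw : Continuous w := hv.continuousOn_deriv.domRestrict.Icc_extend'
    have hwv : ∀ t ∈ Set.Icc 0 T, w t = v' t := fun t ht => by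
      rw [hw_def, Set.IccExtend_of_mem hT.le _ ht]; rfl
    have heval (p : ℝ × ℝ) : Continuous fun f : SchwartzMap (ℝ × ℝ) ℝ => f p :=
      (BoundedContinuousFunction.lipschitz_eval_const p).continuous.comp
        (SchwartzMap.toBoundedContinuousFunctionCLM ℝ (ℝ × ℝ) ℝ).continuous
    have hdw : Continuous fun s => ∂_{m} (w s) :=
      (lineDerivOpCLM ℝ (SchwartzMap (ℝ × ℝ) ℝ) m).continuous.comp hw
    have hwp (p : ℝ × ℝ) : Continuous fun s => w s p := (heval p).comp hw
    have hdwp (p : ℝ × ℝ) : Continuous fun s => ∂_{m} (w s) p := (heval p).comp hdw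
    have hftc : ∀ t ∈ Set.Icc 0 T, ∀ p, v t p = v 0 p + ∫ s in (0 : ℝ)..t, w s p := by
      intro t ht p
      rw [intervalIntegral.integral_eq_sub_of_hasDerivAt_of_le ht.1 (f := fun s => v s p)
        _ _ ((hwp p).intervalIntegrable _ _)]
      · ring
      · exact fun s hs => ((hv.hasDeriv p s ⟨hs.1, hs.2.trans ht.2⟩).mono
          (Set.Icc_subset_Icc_right ht.2)).continuousWithinAt
      · intro s hs
        have hs' : s ∈ Set.Icc 0 T := ⟨hs.1.le, hs.2.le.trans ht.2⟩
        rw [hwv s hs']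
        exact (hv.hasDeriv p s hs').hasDerivAt (Icc_mem_nhds hs.1 (hs.2.trans_le ht.2))
    have hline (f : SchwartzMap (ℝ × ℝ) ℝ) (p : ℝ × ℝ) (r : ℝ) :
        HasDerivAt (fun h : ℝ => f (p + h • m)) (∂_{m} f (p + r • m)) r := by
      rw [SchwartzMap.lineDerivOp_apply_eq_fderiv]
      have h1 : HasDerivAt (fun h : ℝ => p + h • m) m r := by
        simpa using ((hasDerivAt_id r).smul_const m).const_add p
      exact (f.hasFDerivAt (p + r • m)).comp_hasDerivAt r h1
    obtain ⟨C, hC⟩ := SchwartzMap.exists_decay_of_continuousOn (T := T) hdw.continuousOn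
    have hbound : ∀ s ∈ Set.Icc 0 T, ∀ p, |∂_{m} (w s) p| ≤ |C| := fun s hs p => by
      have hg1 : (1 + ‖p‖) ^ (-3 : ℝ) ≤ 1 :=
        Real.rpow_le_one_of_one_le_of_nonpos (by linarith [norm_nonneg p]) (by norm_num)
      calc |∂_{m} (w s) p| ≤ C * (1 + ‖p‖) ^ (-3 : ℝ) := hC s hs p
        _ ≤ |C| * (1 + ‖p‖) ^ (-3 : ℝ) := by gcongr; exact le_abs_self C
        _ ≤ |C| := mul_le_of_le_one_right (abs_nonneg C) hg1
    have hformula : ∀ t ∈ Set.Icc 0 T, ∀ p,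
        ∂_{m} (v t) p = ∂_{m} (v 0) p + ∫ s in (0 : ℝ)..t, ∂_{m} (w s) p := by
      intro t ht p
      have h1 := (intervalIntegral.hasDerivAt_integral_of_dominated_loc_of_deriv_le
        (μ := volume) (a := 0) (b := t) (bound := fun _ => |C|) (x₀ := (0 : ℝ))
        (F := fun h s => w s (p + h • m)) (F' := fun h s => ∂_{m} (w s) (p + h • m))
        Filter.univ_mem (.of_forall fun h => (hwp _).aestronglyMeasurable)
        ((hwp _).intervalIntegrable _ _) (hdwp _).aestronglyMeasurable
        (.of_forall fun s hs h _ => hbound s (by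
          rw [Set.uIoc_of_le ht.1] at hs
          exact ⟨hs.1.le, hs.2.trans ht.2⟩) _)
        intervalIntegrable_const (.of_forall fun s _ h _ => hline (w s) p h)).2
      have h2 := (hline (v 0) p 0).add h1
      have h3 := hline (v t) p 0
      have heq : (fun h : ℝ => v t (p + h • m)) =
          (fun h : ℝ => v 0 (p + h • m)) + fun h => ∫ s in (0 : ℝ)..t, w s (p + h • m) :=
        funext fun h => hftc t ht _
      rw [heq] at h3
      simpa using h3.unique h2
    intro p t ht
    have h1 : HasDerivAt (fun u => ∂_{m} (v 0) p + ∫ s in (0 : ℝ)..u, ∂_{m} (w s) p)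
        (∂_{m} (w t) p) t :=
      ((hdwp p).integral_hasStrictDerivAt 0 t).hasDerivAt.const_add _
    rw [hwv t ht] at h1
    exact h1.hasDerivWithinAt.congr (fun s hs => hformula s hs p) (hformula t ht p)

namespace SchwartzMap

lemma integral_mul_lineDerivOp_self (f : SchwartzMap (ℝ × ℝ) ℝ) (m : ℝ × ℝ) :
    ∫ p, f p * ∂_{m} f p = 0 := by
  have h := integral_mul_lineDerivOp_right_eq_neg_left (μ := volume) f f m
  simp only [mul_comm (∂_{m} f _)] at h
  linarith

/-- The pointwise product of real Schwartz functions. -/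
noncomputable def pointwiseMul (f g : SchwartzMap (ℝ × ℝ) ℝ) : SchwartzMap (ℝ × ℝ) ℝ :=
  pairing (ContinuousLinearMap.mul ℝ ℝ) f g

@[simp]
lemma pointwiseMul_apply (f g : SchwartzMap (ℝ × ℝ) ℝ) (p : ℝ × ℝ) :
    pointwiseMul f g p = f p * g p := rfl

lemma integrable_mul (f g : SchwartzMap (ℝ × ℝ) ℝ) : Integrable (fun p => f p * g p) :=
  (pointwiseMul f g).integrable

/-- The negative `L²` gradient `Δf + f³` of the focusing energy. -/
noncomputable def focusingFlux (f : SchwartzMap (ℝ × ℝ) ℝ) : SchwartzMap (ℝ × ℝ) ℝ :=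
  (∂_{((1, 0) : ℝ × ℝ)} (∂_{((1, 0) : ℝ × ℝ)} f) + ∂_{((0, 1) : ℝ × ℝ)} (∂_{((0, 1) : ℝ × ℝ)} f))
    + pointwiseMul f (pointwiseMul f f)

lemma lineDerivOp_comm (f : SchwartzMap (ℝ × ℝ) ℝ) (a b : ℝ × ℝ) :
    ∂_{a} (∂_{b} f) = ∂_{b} (∂_{a} f) := by
  ext p
  have key (a b : ℝ × ℝ) : ∂_{a} (∂_{b} f) p = fderiv ℝ (fderiv ℝ f) p a b := by
    rw [lineDerivOp_apply_eq_fderiv]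
    have h : ⇑(∂_{b} f : SchwartzMap (ℝ × ℝ) ℝ) = fun q => fderiv ℝ f q b := rfl
    have hd : DifferentiableAt ℝ (fderiv ℝ f) p :=
      ((f.smooth 2).fderiv_right (m := 1) (by norm_num)).differentiable (by norm_num) p
    rw [h, fderiv_clm_apply hd (differentiableAt_const b)]
    simp
  rw [key, key]
  exact (f.contDiffAt 2).isSymmSndFDerivAt (by simp) a b

lemma integral_lineDerivOp_mul_focusingFlux (f : SchwartzMap (ℝ × ℝ) ℝ) :
    ∫ p, ∂_{((1, 0) : ℝ × ℝ)} f p * focusingFlux f p = 0 := by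
  set X : ℝ × ℝ := (1, 0)
  set Y : ℝ × ℝ := (0, 1)
  have hxx := integral_mul_lineDerivOp_self (∂_{X} f) X
  have hyy : ∫ p, ∂_{X} f p * ∂_{Y} (∂_{Y} f) p = 0 := by
    rw [integral_mul_lineDerivOp_right_eq_neg_left, lineDerivOp_comm]
    simp only [mul_comm (∂_{X} (∂_{Y} f) _)]
    rw [integral_mul_lineDerivOp_self, neg_zero]
  have hcube : ∫ p, ∂_{X} f p * pointwiseMul f (pointwiseMul f f) p = 0 := by
    have h := integral_mul_lineDerivOp_self (pointwiseMul f f) X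
    have hd (p) : ∂_{X} (pointwiseMul f f) p = 2 * (f p * ∂_{X} f p) := by
      have hf : ⇑(pointwiseMul f f) = fun q => f q * f q := rfl
      rw [lineDerivOp_apply_eq_fderiv, hf,
        fderiv_fun_mul f.differentiableAt f.differentiableAt]
      simp [lineDerivOp_apply_eq_fderiv]
      ring
    have h2 (p) : pointwiseMul f f p * ∂_{X} (pointwiseMul f f) p
        = 2 * (∂_{X} f p * pointwiseMul f (pointwiseMul f f) p) := by
      rw [hd]; simp; ring
    simp only [h2, integral_const_mul] at h
    linarith
  have hsum (p) : ∂_{X} f p * focusingFlux f p = (∂_{X} f p * ∂_{X} (∂_{X} f) p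
      + ∂_{X} f p * ∂_{Y} (∂_{Y} f) p)
      + ∂_{X} f p * pointwiseMul f (pointwiseMul f f) p := by
    simp only [focusingFlux, add_apply, X, Y]
    ring
  simp only [hsum]
  rw [integral_add (by exact (integrable_mul _ _).add (integrable_mul _ _)) (integrable_mul _ _),
    integral_add (integrable_mul _ _) (integrable_mul _ _), hxx, hyy, hcube]
  simp

end SchwartzMap

lemma eq_of_continuousOn_of_hasDerivAt_zero {T : ℝ} {f : ℝ → ℝ}
    (hf : ContinuousOn f (Set.Icc 0 T)) (hd : ∀ t ∈ Set.Ioo 0 T, HasDerivAt f 0 t)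
    {t : ℝ} (ht : t ∈ Set.Icc 0 T) : f t = f 0 := by
  rcases ht.1.eq_or_lt with rfl | hpos
  · rfl
  obtain ⟨c, -, hc⟩ := exists_hasDerivAt_eq_slope f (fun _ => 0) hpos
    (hf.mono (Set.Icc_subset_Icc_right ht.2))
    (fun s hs => hd s ⟨hs.1, hs.2.trans_le ht.2⟩)
  rw [eq_div_iff (by linarith)] at hc
  linarith

section Conservation

variable {T : ℝ} {v v' : ℝ → SchwartzMap (ℝ × ℝ) ℝ}

lemma mass_conservation (hv : IsSchwartzC1Curve T v v')
    (heq : ∀ t ∈ Set.Icc (0 : ℝ) T,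
      v' t = -∂_{((1, 0) : ℝ × ℝ)} (SchwartzMap.focusingFlux (v t)))
    {t : ℝ} (ht : t ∈ Set.Icc (0 : ℝ) T) :
    ∫ p, (v t p) ^ 2 = ∫ p, (v 0 p) ^ 2 := by
  have hfam := hv.isDecayingFamily.mul hv.isDecayingFamily
  simp only [pow_two]
  refine eq_of_continuousOn_of_hasDerivAt_zero (f := fun t => ∫ p, v t p * v t p)
    hfam.continuousOn_integral (fun s hs => ?_) ht
  convert hfam.hasDerivAt_integral hs using 1
  have h (p) : v' s p * v s p + v s p * v' s p
      = -2 * (v s p * ∂_{((1, 0) : ℝ × ℝ)} (SchwartzMap.focusingFlux (v s)) p) := by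
    rw [heq s (Set.Ioo_subset_Icc_self hs)]
    simp
    ring
  simp only [h, integral_const_mul]
  rw [SchwartzMap.integral_mul_lineDerivOp_right_eq_neg_left,
    SchwartzMap.integral_lineDerivOp_mul_focusingFlux]
  simp

lemma energy_conservation (hT : 0 < T) (hv : IsSchwartzC1Curve T v v')
    (heq : ∀ t ∈ Set.Icc (0 : ℝ) T,
      v' t = -∂_{((1, 0) : ℝ × ℝ)} (SchwartzMap.focusingFlux (v t)))
    {t : ℝ} (ht : t ∈ Set.Icc (0 : ℝ) T) :
    (1 / 2) * (∫ p, (pdX ⇑(v t) p ^ 2 + pdY ⇑(v t) p ^ 2)) - (1 / 4) * (∫ p, (v t p) ^ 4)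
      = (1 / 2) * (∫ p, (pdX ⇑(v 0) p ^ 2 + pdY ⇑(v 0) p ^ 2))
        - (1 / 4) * (∫ p, (v 0 p) ^ 4) := by
  set X : ℝ × ℝ := (1, 0) with hX
  set Y : ℝ × ℝ := (0, 1) with hY
  have hx := (hv.lineDeriv hT X).isDecayingFamily
  have hy := (hv.lineDeriv hT Y).isDecayingFamily
  have hxx := hx.mul hx
  have hyy := hy.mul hy
  have hv2 := hv.isDecayingFamily.mul hv.isDecayingFamily
  have hv4 := hv2.mul hv2
  have hgrad (s) : ∫ p, (pdX ⇑(v s) p ^ 2 + pdY ⇑(v s) p ^ 2)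
      = (∫ p, ∂_{X} (v s) p * ∂_{X} (v s) p) + ∫ p, ∂_{Y} (v s) p * ∂_{Y} (v s) p := by
    rw [← integral_add (SchwartzMap.integrable_mul _ _) (SchwartzMap.integrable_mul _ _)]
    simp only [pdX, pdY, SchwartzMap.lineDerivOp_apply_eq_fderiv, pow_two, hX, hY]
  have hquart (s) : ∫ p, (v s p) ^ 4 = ∫ p, (v s p * v s p) * (v s p * v s p) := by
    congr 1 with p
    ring
  simp only [hgrad, hquart]
  refine eq_of_continuousOn_of_hasDerivAt_zero
    (f := fun s => 1 / 2 * ((∫ p, ∂_{X} (v s) p * ∂_{X} (v s) p)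
      + ∫ p, ∂_{Y} (v s) p * ∂_{Y} (v s) p)
      - 1 / 4 * ∫ p, (v s p * v s p) * (v s p * v s p))
    (((hxx.continuousOn_integral.add hyy.continuousOn_integral).const_mul _).sub
      (hv4.continuousOn_integral.const_mul _)) (fun s hs => ?_) ht
  refine HasDerivAt.congr_deriv ((((hxx.hasDerivAt_integral hs).add
    (hyy.hasDerivAt_integral hs)).const_mul (1 / 2 : ℝ)).sub
      ((hv4.hasDerivAt_integral hs).const_mul (1 / 4 : ℝ))) ?_
  have h1 (m : ℝ × ℝ) (p) : ∂_{m} (v' s) p * ∂_{m} (v s) p + ∂_{m} (v s) p * ∂_{m} (v' s) p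
      = 2 * (∂_{m} (v s) p * ∂_{m} (v' s) p) := by ring
  have h2 (p) : (v' s p * v s p + v s p * v' s p) * (v s p * v s p)
        + (v s p * v s p) * (v' s p * v s p + v s p * v' s p)
      = 4 * (SchwartzMap.pointwiseMul (v s) (SchwartzMap.pointwiseMul (v s) (v s)) p * v' s p) := by
    simp only [SchwartzMap.pointwiseMul_apply]
    ring
  simp only [h1, h2, integral_const_mul]
  rw [SchwartzMap.integral_mul_lineDerivOp_right_eq_neg_left,
    SchwartzMap.integral_mul_lineDerivOp_right_eq_neg_left]
  have hflux : ∫ p, SchwartzMap.focusingFlux (v s) p * v' s p = 0 := by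
    rw [heq s (Set.Ioo_subset_Icc_self hs)]
    simp only [neg_apply, mul_neg, integral_neg,
      SchwartzMap.integral_mul_lineDerivOp_self, neg_zero]
  have hsplit (p) : SchwartzMap.focusingFlux (v s) p * v' s p
      = (∂_{X} (∂_{X} (v s)) p * v' s p + ∂_{Y} (∂_{Y} (v s)) p * v' s p)
        + SchwartzMap.pointwiseMul (v s) (SchwartzMap.pointwiseMul (v s) (v s)) p * v' s p := by
    simp only [SchwartzMap.focusingFlux, add_apply, X, Y]
    ring
  simp only [hsplit] at hflux
  rw [integral_add (by
      exact (SchwartzMap.integrable_mul _ _).add (SchwartzMap.integrable_mul _ _))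
    (SchwartzMap.integrable_mul _ _),
    integral_add (SchwartzMap.integrable_mul _ _) (SchwartzMap.integrable_mul _ _)] at hflux
  linarith

end Conservation

/-- for Schwartz-class solutions of the focusing mZK equation
`∂ₜ v + ∂ₓ(∂ₓ² v + ∂_y² v) + ∂ₓ(v³) = 0` on `[0, T]` with
`‖v(0)‖_{L²} < ‖φ‖_{L²}`, where `φ` satisfies the sharp Gagliardo–Nirenberg
inequality `∫f⁴ ≤ (2/‖φ‖²_{L²}) (∫f²)(∫|∇f|²)`, one has the uniform gradient bound
`∫ |∇v(t)|² ≤ (2/(1 − ‖v(0)‖²/‖φ‖²)) 𝓔[v(0)]`,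
where `𝓔[v] = (1/2)∫|∇v|² − (1/4)∫ v⁴`. -/
theorem focusing_mZK_gradient_bound
    (φ : SchwartzMap (ℝ × ℝ) ℝ) (hφ0 : φ ≠ 0)
    (hGN : ∀ f : SchwartzMap (ℝ × ℝ) ℝ,
      (∫ p : ℝ × ℝ, (f p) ^ 4)
        ≤ (2 / ∫ p : ℝ × ℝ, (φ p) ^ 2) * (∫ p : ℝ × ℝ, (f p) ^ 2)
            * (∫ p : ℝ × ℝ, (pdX ⇑f p ^ 2 + pdY ⇑f p ^ 2)))
    (T : ℝ) (hT : 0 < T)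
    (v v' : ℝ → SchwartzMap (ℝ × ℝ) ℝ)
    (hderiv : ∀ p : ℝ × ℝ, ∀ t ∈ Set.Icc (0 : ℝ) T,
      HasDerivWithinAt (fun s => v s p) (v' t p) (Set.Icc (0 : ℝ) T) t)
    (hcont : ContinuousOn (fun t => v' t) (Set.Icc (0 : ℝ) T))
    (heq : ∀ t ∈ Set.Icc (0 : ℝ) T, ∀ p : ℝ × ℝ,
      v' t p + pdX (fun q => pdX (pdX ⇑(v t)) q + pdY (pdY ⇑(v t)) q) p
        + pdX (fun q => (v t q) ^ 3) p = 0)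
    (hsmall : Real.sqrt (∫ p : ℝ × ℝ, (v 0 p) ^ 2)
        < Real.sqrt (∫ p : ℝ × ℝ, (φ p) ^ 2)) :
    ∀ t ∈ Set.Icc (0 : ℝ) T,
      (∫ p : ℝ × ℝ, (pdX ⇑(v t) p ^ 2 + pdY ⇑(v t) p ^ 2))
        ≤ (2 / (1 - (∫ p : ℝ × ℝ, (v 0 p) ^ 2) / (∫ p : ℝ × ℝ, (φ p) ^ 2))) *
            ((1 / 2) * (∫ p : ℝ × ℝ, (pdX ⇑(v 0) p ^ 2 + pdY ⇑(v 0) p ^ 2))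
              - (1 / 4) * (∫ p : ℝ × ℝ, (v 0 p) ^ 4)) := by
  have hv : IsSchwartzC1Curve T v v' := ⟨hderiv, hcont⟩
  have hflow : ∀ t ∈ Set.Icc (0 : ℝ) T,
      v' t = -∂_{((1, 0) : ℝ × ℝ)} (SchwartzMap.focusingFlux (v t)) := by
    intro t ht
    ext p
    have hcube : (fun q => (v t q) ^ 3) =
        ⇑(SchwartzMap.pointwiseMul (v t) (SchwartzMap.pointwiseMul (v t) (v t))) := by
      ext q
      simp only [SchwartzMap.pointwiseMul_apply]
      ring
    have h : v' t p + ∂_{((1, 0) : ℝ × ℝ)} (∂_{((1, 0) : ℝ × ℝ)} (∂_{((1, 0) : ℝ × ℝ)} (v t))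
          + ∂_{((0, 1) : ℝ × ℝ)} (∂_{((0, 1) : ℝ × ℝ)} (v t))) p
        + ∂_{((1, 0) : ℝ × ℝ)}
          (SchwartzMap.pointwiseMul (v t) (SchwartzMap.pointwiseMul (v t) (v t))) p = 0 := by
      have h0 := heq t ht p
      rw [hcube] at h0
      exact h0
    rw [SchwartzMap.focusingFlux, neg_apply, lineDerivOp_add,
      add_apply]
    linarith
  intro t ht
  have hmass := mass_conservation hv hflow ht
  have henergy := energy_conservation hT hv hflow ht
  have hGNt := hGN (v t)
  rw [hmass] at hGNt
  have hM0 : 0 ≤ ∫ p : ℝ × ℝ, (v 0 p) ^ 2 := integral_nonneg fun p => sq_nonneg _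
  have hlt := (Real.sqrt_lt_sqrt_iff hM0).mp hsmall
  rw [← henergy]
  set G := ∫ p : ℝ × ℝ, (pdX ⇑(v t) p ^ 2 + pdY ⇑(v t) p ^ 2)
  set M := ∫ p : ℝ × ℝ, (v 0 p) ^ 2
  set N := ∫ p : ℝ × ℝ, (φ p) ^ 2
  set Q := ∫ p : ℝ × ℝ, (v t p) ^ 4
  have hN : 0 < N := hM0.trans_lt hlt
  have hpos : 0 < 1 - M / N := by
    rw [sub_pos, div_lt_one hN]
    exact hlt
  have hGN' : Q ≤ 2 * (M / N) * G := by
    calc Q ≤ 2 / N * M * G := hGNt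
      _ = 2 * (M / N) * G := by ring
  rw [div_mul_eq_mul_div, le_div_iff₀ hpos]
  linarith
end

section
/- There exists a universal constant C > 0 with the following property. Let N₁, N₂ > 0 with 4N₁ ≤ N₂. Let f, g ∈ 𝓢(ℝ²) be such that f̂ is supported in the annulus {ζ ∈ ℝ² : N₁ ≤ |ζ| ≤ 2N₁} and ĝ is supported in {ζ ∈ ℝ² : N₂ ≤ |ζ| ≤ 2N₂}. Then ‖(U(t)f) · (U(t)g)‖_{L²(ℝ² × ℝ)} ≤ C (N₁^(1/2) / N₂) ‖f‖_{L²(ℝ²)} ‖g‖_{L²(ℝ²)}, where the L² norm on the left is taken over all of space-time (x, y, t) ∈ ℝ² × ℝ. -/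
open MeasureTheory

/-- Fourier transform on ℝ² with the convention `f̂(ξ,η) = ∫ f(x,y) e^{−i(xξ+yη)} dx dy`. -/
noncomputable def FT (f : ℝ × ℝ → ℂ) (ζ : ℝ × ℝ) : ℂ :=
  ∫ p : ℝ × ℝ, f p * Complex.exp (-Complex.I * ((p.1 * ζ.1 + p.2 * ζ.2 : ℝ) : ℂ))

/-- The free evolution of the linear symmetrized mZK equation:
`(U(t)f)(x,y) = (2π)^{-2} ∫ e^{i(xξ+yη+t(ξ³+η³))} f̂(ζ) dζ`. -/
noncomputable def freeU (f : ℝ × ℝ → ℂ) (x y t : ℝ) : ℂ :=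
  ((((2 * Real.pi) ^ 2)⁻¹ : ℝ) : ℂ) *
    ∫ ζ : ℝ × ℝ,
      Complex.exp (Complex.I * ((x * ζ.1 + y * ζ.2 + t * (ζ.1 ^ 3 + ζ.2 ^ 3) : ℝ) : ℂ)) *
      FT f ζ

open Filter Topology
open scoped ENNReal ComplexConjugate

/-- Schur's test for the Gram operator of a family of bounded functions, tested against a
weight. -/
theorem lintegral_weight_mul_enorm_integral_sq_le {Q X : Type*} [MeasurableSpace Q]
    [MeasurableSpace X] {ν : Measure Q} {μ : Measure X} [SFinite ν] [SFinite μ]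
    {w : Q → ℝ} (hw : Integrable w ν) (hw_meas : Measurable w) (hw0 : ∀ q, 0 ≤ w q)
    {e : Q → X → ℂ} (he : Measurable (Function.uncurry e)) (he1 : ∀ q z, ‖e q z‖ ≤ 1)
    {K : X → ℂ} (hK : Integrable K μ) (hK_meas : Measurable K) {B : ℝ≥0∞}
    (hB : ∀ z, ∫⁻ z', ‖∫ q, w q * (e q z * conj (e q z')) ∂ν‖ₑ ∂μ ≤ B) :
    ∫⁻ q, ENNReal.ofReal (w q) * ‖∫ z, e q z * K z ∂μ‖ₑ ^ 2 ∂ν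
      ≤ 2 * B * ∫⁻ z, ‖K z‖ₑ ^ 2 ∂μ := by
  set T : Q → ℂ := fun q => ∫ z, e q z * K z ∂μ with hT
  have hT_meas : StronglyMeasurable T := by
    apply StronglyMeasurable.integral_prod_right (f := fun q z => e q z * K z)
    exact (he.mul (hK_meas.comp measurable_snd)).stronglyMeasurable
  have hT_bound (q : Q) : ‖T q‖ ≤ ∫ z, ‖K z‖ ∂μ := by
    refine (norm_integral_le_integral_norm _).trans ?_
    refine integral_mono_of_nonneg (ae_of_all _ fun z => norm_nonneg _) hK.norm
      (ae_of_all _ fun z => ?_)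
    simpa using mul_le_mul_of_nonneg_right (he1 q z) (norm_nonneg (K z))
  have hwT : Integrable (fun q => w q * ‖T q‖ ^ 2) ν := by
    refine (hw.mul_const ((∫ z, ‖K z‖ ∂μ) ^ 2)).mono'
      (hw_meas.aestronglyMeasurable.mul (hT_meas.norm.pow 2).aestronglyMeasurable)
      (ae_of_all _ fun q => ?_)
    rw [Real.norm_of_nonneg (mul_nonneg (hw0 q) (sq_nonneg _))]
    have := hw0 q
    have := hT_bound q
    gcongr
  let k : X → X → ℂ := fun z z' => ∫ q, w q * (e q z * conj (e q z')) ∂ν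
  have he' : Measurable fun p : (X × X) × Q => w p.2 * (e p.2 p.1.1 * conj (e p.2 p.1.2)) := by
    have h1 : Measurable fun p : (X × X) × Q => e p.2 p.1.1 :=
      he.comp (measurable_snd.prodMk (measurable_fst.comp measurable_fst))
    have h2 : Measurable fun p : (X × X) × Q => e p.2 p.1.2 :=
      he.comp (measurable_snd.prodMk (measurable_snd.comp measurable_fst))
    have h3 : Measurable fun p : (X × X) × Q => ((w p.2 : ℝ) : ℂ) :=
      Complex.measurable_ofReal.comp (hw_meas.comp measurable_snd)
    exact h3.mul (h1.mul (Complex.continuous_conj.measurable.comp h2))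
  have hk_meas : Measurable fun p : X × X => k p.1 p.2 :=
    (StronglyMeasurable.integral_prod_right'
      (f := fun p : (X × X) × Q => w p.2 * (e p.2 p.1.1 * conj (e p.2 p.1.2)))
      he'.stronglyMeasurable).measurable
  have hk_symm (z z' : X) : ‖k z z'‖ₑ = ‖k z' z‖ₑ := by
    have : k z z' = conj (k z' z) := by
      simp only [k]
      rw [← integral_conj]
      congr with q
      simp [mul_comm]
    rw [this, ← ofReal_norm, ← ofReal_norm, RCLike.norm_conj]
  have hH : Integrable (fun p : (X × X) × Q => (K p.1.1 * conj (K p.1.2)) *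
      (w p.2 * (e p.2 p.1.1 * conj (e p.2 p.1.2)))) ((μ.prod μ).prod ν) := by
    have hdom := (hK.norm.mul_prod hK.norm).mul_prod hw
    refine hdom.mono' ?_ (ae_of_all _ fun p => ?_)
    · refine Measurable.aestronglyMeasurable (Measurable.mul ?_ he')
      exact (hK_meas.comp (measurable_fst.comp measurable_fst)).mul
        (Complex.continuous_conj.measurable.comp
          (hK_meas.comp (measurable_snd.comp measurable_fst)))
    · simp only [norm_mul, RCLike.norm_conj, Complex.norm_real, Real.norm_of_nonneg (hw0 p.2)]
      have h1 := he1 p.2 p.1.1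
      have h2 := he1 p.2 p.1.2
      have h3 : ‖e p.2 p.1.1‖ * ‖e p.2 p.1.2‖ ≤ 1 := by
        nlinarith [norm_nonneg (e p.2 p.1.1), norm_nonneg (e p.2 p.1.2)]
      have := hw0 p.2
      refine mul_le_mul_of_nonneg_left ?_ (by positivity)
      nlinarith
  have hid : ((∫ q, w q * ‖T q‖ ^ 2 ∂ν : ℝ) : ℂ)
      = ∫ p : X × X, (K p.1 * conj (K p.2)) * k p.1 p.2 ∂(μ.prod μ) := by
    rw [← integral_complex_ofReal]
    have h1 (q : Q) : ((w q * ‖T q‖ ^ 2 : ℝ) : ℂ) = ∫ p : X × X, (K p.1 * conj (K p.2)) *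
        (w q * (e q p.1 * conj (e q p.2))) ∂(μ.prod μ) := by
      have : ∀ p : X × X, (K p.1 * conj (K p.2)) * (w q * (e q p.1 * conj (e q p.2)))
          = w q * ((e q p.1 * K p.1) * conj (e q p.2 * K p.2)) := fun p => by
        rw [map_mul]; ring
      simp only [this]
      rw [integral_const_mul, integral_prod_mul (fun z => e q z * K z)
        (fun z => conj (e q z * K z)), integral_conj]
      push_cast
      rw [Complex.mul_conj']
    simp only [h1]
    rw [integral_integral_swap (f := fun q (p : X × X) => (K p.1 * conj (K p.2)) *
        (w q * (e q p.1 * conj (e q p.2))))]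
    · congr with p
      rw [integral_const_mul]
    · exact hH.swap
  have hmul (a b : ℝ≥0∞) : a * b ≤ a ^ 2 + b ^ 2 := by
    rcases le_total a b with h | h
    · calc a * b ≤ b ^ 2 := by rw [sq]; gcongr
        _ ≤ _ := le_add_self
    · calc a * b ≤ a ^ 2 := by rw [sq]; gcongr
        _ ≤ _ := le_self_add
  have hhalf : ∫⁻ p : X × X, ‖K p.1‖ₑ ^ 2 * ‖k p.1 p.2‖ₑ ∂(μ.prod μ)
      ≤ B * ∫⁻ z, ‖K z‖ₑ ^ 2 ∂μ := by
    rw [lintegral_prod _ (by fun_prop)]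
    rw [← lintegral_const_mul _ (by fun_prop)]
    refine lintegral_mono fun z => ?_
    have : Measurable fun z' => ‖k z z'‖ₑ := (hk_meas.comp measurable_prodMk_left).enorm
    dsimp only
    rw [lintegral_const_mul _ this, mul_comm]
    gcongr
    exact hB z
  have hhalf' : ∫⁻ p : X × X, ‖K p.2‖ₑ ^ 2 * ‖k p.1 p.2‖ₑ ∂(μ.prod μ)
      ≤ B * ∫⁻ z, ‖K z‖ₑ ^ 2 ∂μ := by
    rw [← lintegral_prod_swap]
    simpa only [Prod.fst_swap, Prod.snd_swap, fun p : X × X => hk_symm p.2 p.1] using hhalf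
  calc ∫⁻ q, ENNReal.ofReal (w q) * ‖T q‖ₑ ^ 2 ∂ν
      = ENNReal.ofReal (∫ q, w q * ‖T q‖ ^ 2 ∂ν) := by
        rw [ofReal_integral_eq_lintegral_ofReal hwT
          (ae_of_all _ fun q => mul_nonneg (hw0 q) (sq_nonneg _))]
        congr with q
        rw [ENNReal.ofReal_mul (hw0 q), ENNReal.ofReal_pow (norm_nonneg _), ofReal_norm]
    _ = ‖((∫ q, w q * ‖T q‖ ^ 2 ∂ν : ℝ) : ℂ)‖ₑ := by
        rw [← ofReal_norm, Complex.norm_real, Real.norm_of_nonneg]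
        exact integral_nonneg fun q => mul_nonneg (hw0 q) (sq_nonneg _)
    _ ≤ ∫⁻ p : X × X, ‖(K p.1 * conj (K p.2)) * k p.1 p.2‖ₑ ∂(μ.prod μ) := by
        rw [hid]
        exact enorm_integral_le_lintegral_enorm _
    _ ≤ ∫⁻ p : X × X, (‖K p.1‖ₑ ^ 2 * ‖k p.1 p.2‖ₑ + ‖K p.2‖ₑ ^ 2 * ‖k p.1 p.2‖ₑ)
          ∂(μ.prod μ) := by
        refine lintegral_mono fun p => ?_
        have : ‖conj (K p.2)‖ₑ = ‖K p.2‖ₑ := by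
          rw [← ofReal_norm, ← ofReal_norm, RCLike.norm_conj]
        rw [enorm_mul, enorm_mul, this, ← add_mul]
        gcongr
        exact hmul _ _
    _ ≤ 2 * B * ∫⁻ z, ‖K z‖ₑ ^ 2 ∂μ := by
        rw [lintegral_add_left (by fun_prop), mul_assoc, two_mul]
        gcongr

/-- Removing the weights from `lintegral_weight_mul_enorm_integral_sq_le` by Fatou's lemma. -/
theorem lintegral_enorm_integral_sq_le {Q X : Type*} [MeasurableSpace Q]
    [MeasurableSpace X] {ν : Measure Q} {μ : Measure X} [SFinite ν] [SFinite μ]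
    {w : ℕ → Q → ℝ} (hw : ∀ n, Integrable (w n) ν) (hw_meas : ∀ n, Measurable (w n))
    (hw0 : ∀ n q, 0 ≤ w n q) (hw1 : ∀ q, Tendsto (fun n => w n q) atTop (𝓝 1))
    {e : Q → X → ℂ} (he : Measurable (Function.uncurry e)) (he1 : ∀ q z, ‖e q z‖ ≤ 1)
    {K : X → ℂ} (hK : Integrable K μ) (hK_meas : Measurable K) {B : ℝ≥0∞}
    (hB : ∀ n z, ∫⁻ z', ‖∫ q, w n q * (e q z * conj (e q z')) ∂ν‖ₑ ∂μ ≤ B) :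
    ∫⁻ q, ‖∫ z, e q z * K z ∂μ‖ₑ ^ 2 ∂ν ≤ 2 * B * ∫⁻ z, ‖K z‖ₑ ^ 2 ∂μ := by
  have hT_meas : StronglyMeasurable fun q => ∫ z, e q z * K z ∂μ := by
    apply StronglyMeasurable.integral_prod_right (f := fun q z => e q z * K z)
    exact (he.mul (hK_meas.comp measurable_snd)).stronglyMeasurable
  have hlim (q : Q) : Tendsto (fun n => ENNReal.ofReal (w n q) * ‖∫ z, e q z * K z ∂μ‖ₑ ^ 2)
      atTop (𝓝 (‖∫ z, e q z * K z ∂μ‖ₑ ^ 2)) := by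
    have := ENNReal.Tendsto.mul_const (b := ‖∫ z, e q z * K z ∂μ‖ₑ ^ 2)
      (ENNReal.tendsto_ofReal (hw1 q)) (Or.inl (by simp))
    simpa using this
  calc ∫⁻ q, ‖∫ z, e q z * K z ∂μ‖ₑ ^ 2 ∂ν
      = ∫⁻ q, liminf (fun n => ENNReal.ofReal (w n q) * ‖∫ z, e q z * K z ∂μ‖ₑ ^ 2) atTop ∂ν := by
        congr with q
        exact (hlim q).liminf_eq.symm
    _ ≤ liminf (fun n => ∫⁻ q, ENNReal.ofReal (w n q) * ‖∫ z, e q z * K z ∂μ‖ₑ ^ 2 ∂ν) atTop :=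
        lintegral_liminf_le fun n =>
          (hw_meas n).ennreal_ofReal.mul (hT_meas.measurable.enorm.pow_const 2)
    _ ≤ liminf (fun _ : ℕ => 2 * B * ∫⁻ z, ‖K z‖ₑ ^ 2 ∂μ) atTop :=
        liminf_le_liminf (Eventually.of_forall fun n =>
          lintegral_weight_mul_enorm_integral_sq_le (hw n) (hw_meas n) (hw0 n) he he1 hK hK_meas
            (hB n))
    _ = _ := liminf_const _

/-- The Fourier transform of the Gaussian `exp (-b x²)`. -/
noncomputable def gaussFT (b s : ℝ) : ℝ := √(Real.pi / b) * Real.exp (-(1 / (4 * b)) * s ^ 2)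

theorem gaussFT_nonneg (b s : ℝ) : 0 ≤ gaussFT b s := by
  unfold gaussFT; positivity

theorem continuous_gaussFT (b : ℝ) : Continuous (gaussFT b) := by
  unfold gaussFT; fun_prop

theorem measurable_ofReal_gaussFT (b : ℝ) : Measurable fun s => ENNReal.ofReal (gaussFT b s) :=
  (continuous_gaussFT b).measurable.ennreal_ofReal

theorem integral_exp_neg_mul_sq_mul_cexp {b : ℝ} (hb : 0 < b) (s : ℝ) :
    ∫ x : ℝ, (Real.exp (-b * x ^ 2) : ℂ) * Complex.exp (Complex.I * ((x * s : ℝ) : ℂ))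
      = gaussFT b s := by
  have h := fourierIntegral_gaussian (b := (b : ℂ)) (by simpa using hb) s
  rw [gaussFT]
  push_cast
  rw [Real.sqrt_eq_rpow, Complex.ofReal_cpow (by positivity)]
  push_cast
  rw [show (-(1 / (4 * (b : ℂ))) * (s : ℂ) ^ 2) = -(s : ℂ) ^ 2 / (4 * b) by ring, ← h]
  congr with x
  rw [mul_comm]
  congr 2
  ring

theorem lintegral_gaussFT {b : ℝ} (hb : 0 < b) :
    ∫⁻ s, ENNReal.ofReal (gaussFT b s) = ENNReal.ofReal (2 * Real.pi) := by
  have hb' : 0 < 1 / (4 * b) := by positivity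
  rw [← ofReal_integral_eq_lintegral_ofReal _ (ae_of_all _ (gaussFT_nonneg b))]
  · congr 1
    unfold gaussFT
    rw [integral_const_mul, integral_gaussian, ← Real.sqrt_mul (by positivity)]
    rw [show Real.pi / b * (Real.pi / (1 / (4 * b))) = (2 * Real.pi) ^ 2 by field_simp; ring]
    exact Real.sqrt_sq (by positivity)
  · exact (integrable_exp_neg_mul_sq hb').const_mul _

theorem lintegral_gaussFT_sub {b : ℝ} (hb : 0 < b) (a : ℝ) :
    ∫⁻ s, ENNReal.ofReal (gaussFT b (a - s)) = ENNReal.ofReal (2 * Real.pi) := by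
  rw [lintegral_sub_left_eq_self (fun s => ENNReal.ofReal (gaussFT b s)) a, lintegral_gaussFT hb]

theorem cexp_I_mul_conj (s t : ℝ) :
    Complex.exp (Complex.I * s) * conj (Complex.exp (Complex.I * t))
      = Complex.exp (Complex.I * ((s - t : ℝ) : ℂ)) := by
  rw [← Complex.exp_conj, ← Complex.exp_add]
  congr 1
  simp
  ring

theorem tendsto_exp_neg_inv_mul (r : ℝ) :
    Tendsto (fun n : ℕ => Real.exp (-(1 / ((n : ℝ) + 1)) * r)) atTop (𝓝 1) := by
  have h := (tendsto_one_div_add_atTop_nhds_zero_nat (𝕜 := ℝ)).neg.mul_const r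
  simpa [Function.comp_def] using (Real.continuous_exp.tendsto _).comp h

/-- Change of variables in one dimension, as an upper bound. -/
theorem mul_lintegral_comp_le {S : Set ℝ} (hS : MeasurableSet S) {h h' : ℝ → ℝ}
    (hd : ∀ x ∈ S, HasDerivAt h (h' x) x) (hinj : Set.InjOn h S) {l : ℝ}
    (hl : ∀ x ∈ S, l ≤ |h' x|) (φ : ℝ → ℝ≥0∞) :
    ENNReal.ofReal l * ∫⁻ x in S, φ (h x) ≤ ∫⁻ y, φ y :=
  calc ENNReal.ofReal l * ∫⁻ x in S, φ (h x)
      ≤ ∫⁻ x in S, ENNReal.ofReal l * φ (h x) := lintegral_const_mul_le _ _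
    _ ≤ ∫⁻ x in S, ENNReal.ofReal |h' x| * φ (h x) := by
        refine setLIntegral_mono' hS fun x hx => ?_
        gcongr
        exact hl x hx
    _ = ∫⁻ y in h '' S, φ y :=
        (lintegral_image_eq_lintegral_abs_deriv_mul hS
          (fun x hx => (hd x hx).hasDerivWithinAt) hinj φ).symm
    _ ≤ ∫⁻ y, φ y := setLIntegral_le_lintegral _ _

theorem mul_lintegral_cubic_le {N₁ N₂ : ℝ} (hN₁ : 0 < N₁) (hN : 4 * N₁ ≤ N₂) (s c : ℝ)
    (φ : ℝ → ℝ≥0∞) :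
    ENNReal.ofReal (N₂ ^ 2) *
        ∫⁻ x in {x : ℝ | |x| ≤ 2 * N₁ ∧ N₂ ≤ |s - x|}, φ (x ^ 3 + (s - x) ^ 3 + c)
      ≤ 2 * ∫⁻ y, φ y := by
  set h : ℝ → ℝ := fun x => x ^ 3 + (s - x) ^ 3 + c
  have hd (x : ℝ) : HasDerivAt h (3 * x ^ 2 - 3 * (s - x) ^ 2) x := by
    have h1 := (((hasDerivAt_id x).pow 3).add (((hasDerivAt_id x).const_sub s).pow 3)).add_const c
    exact HasDerivAt.congr_deriv (f := h) h1 (by simp; ring)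
  have hmain (S : Set ℝ) (hS : MeasurableSet S) (hsub : ∀ x ∈ S, |x| ≤ 2 * N₁ ∧ N₂ ≤ |s - x|)
      (hne : ∀ x ∈ S, ∀ y ∈ S, s * (s - x - y) ≠ 0) :
      ENNReal.ofReal (N₂ ^ 2) * ∫⁻ x in S, φ (h x) ≤ ∫⁻ y, φ y := by
    refine mul_lintegral_comp_le hS (fun x _ => hd x) ?_ ?_ φ
    · intro x hx y hy hxy
      have : (s * (s - x - y)) * (x - y) = 0 := by
        simp only [h] at hxy
        linarith
      rcases mul_eq_zero.1 this with h0 | h0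
      · exact absurd h0 (hne x hx y hy)
      · linarith
    · intro x hx
      obtain ⟨h1, h2⟩ := hsub x hx
      have h3 : x ^ 2 ≤ (2 * N₁) ^ 2 := sq_le_sq.2 (by rwa [abs_of_pos (by linarith : 0 < 2 * N₁)])
      have h4 : N₂ ^ 2 ≤ (s - x) ^ 2 := sq_le_sq.2 (by rwa [abs_of_pos (by linarith : 0 < N₂)])
      rw [abs_sub_comm]
      refine le_trans ?_ (le_abs_self _)
      nlinarith
  have hunion : {x : ℝ | |x| ≤ 2 * N₁ ∧ N₂ ≤ |s - x|}
      ⊆ {x : ℝ | |x| ≤ 2 * N₁ ∧ N₂ ≤ s - x} ∪ {x : ℝ | |x| ≤ 2 * N₁ ∧ N₂ ≤ -(s - x)} := by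
    rintro x ⟨h1, h2⟩
    rcases le_abs.1 h2 with h3 | h3
    · exact Or.inl ⟨h1, h3⟩
    · exact Or.inr ⟨h1, h3⟩
  calc _ ≤ ENNReal.ofReal (N₂ ^ 2) * ((∫⁻ x in {x : ℝ | |x| ≤ 2 * N₁ ∧ N₂ ≤ s - x}, φ (h x))
        + ∫⁻ x in {x : ℝ | |x| ≤ 2 * N₁ ∧ N₂ ≤ -(s - x)}, φ (h x)) := by
        gcongr
        exact (lintegral_mono_set hunion).trans (lintegral_union_le _ _ _)
    _ ≤ _ := by
        rw [mul_add, two_mul (∫⁻ y, φ y)]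
        refine add_le_add (hmain _ ?_ ?_ ?_) (hmain _ ?_ ?_ ?_)
        · exact (measurableSet_le (f := fun x : ℝ => |x|) (by fun_prop) (by fun_prop)).inter
            (measurableSet_le (f := fun _ : ℝ => N₂) (by fun_prop) (by fun_prop))
        · exact fun x hx => ⟨hx.1, hx.2.trans (le_abs_self _)⟩
        · rintro x ⟨hx, hx'⟩ y ⟨hy, hy'⟩
          have := abs_le.1 hx
          have := abs_le.1 hy
          exact (mul_pos (by linarith) (by linarith)).ne'
        · exact (measurableSet_le (f := fun x : ℝ => |x|) (by fun_prop) (by fun_prop)).inter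
            (measurableSet_le (f := fun _ : ℝ => N₂) (by fun_prop) (by fun_prop))
        · exact fun x hx => ⟨hx.1, hx.2.trans (neg_le_abs _)⟩
        · rintro x ⟨hx, hx'⟩ y ⟨hy, hy'⟩
          have := abs_le.1 hx
          have := abs_le.1 hy
          exact (mul_pos_of_neg_of_neg (by linarith) (by linarith)).ne'

theorem mul_lintegral_region_le {N₁ N₂ : ℝ} (hN₁ : 0 < N₁) (hN : 4 * N₁ ≤ N₂)
    {φ₁ φ₂ φ₃ : ℝ → ℝ≥0∞} (h₁ : Measurable φ₁) (h₂ : Measurable φ₂) (h₃ : Measurable φ₃) :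
    ENNReal.ofReal (N₂ ^ 2) *
        ∫⁻ z : (ℝ × ℝ) × (ℝ × ℝ) in {z | |z.1.1| ≤ 2 * N₁ ∧ |z.1.2| ≤ 2 * N₁ ∧ N₂ ≤ |z.2.1|},
          φ₁ (z.1.1 + z.2.1) * φ₂ (z.1.2 + z.2.2) *
            φ₃ (z.1.1 ^ 3 + z.2.1 ^ 3 + (z.1.2 ^ 3 + z.2.2 ^ 3))
      ≤ ENNReal.ofReal (4 * N₁) * 2 * ((∫⁻ x, φ₁ x) * (∫⁻ x, φ₂ x) * ∫⁻ x, φ₃ x) := by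
  set S : Set ((ℝ × ℝ) × (ℝ × ℝ)) :=
    {z | |z.1.1| ≤ 2 * N₁ ∧ |z.1.2| ≤ 2 * N₁ ∧ N₂ ≤ |z.2.1|} with hS_def
  have hS : MeasurableSet S :=
    (measurableSet_le (f := fun z : (ℝ × ℝ) × (ℝ × ℝ) => |z.1.1|) (by fun_prop)
      (by fun_prop)).inter
    ((measurableSet_le (f := fun z : (ℝ × ℝ) × (ℝ × ℝ) => |z.1.2|) (by fun_prop)
      (by fun_prop)).inter
    (measurableSet_le (f := fun _ : (ℝ × ℝ) × (ℝ × ℝ) => N₂) (by fun_prop) (by fun_prop)))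
  set Ψ : (ℝ × ℝ) × (ℝ × ℝ) → ℝ≥0∞ := fun z => φ₁ (z.1.1 + z.2.1) * φ₂ (z.1.2 + z.2.2) *
    φ₃ (z.1.1 ^ 3 + z.2.1 ^ 3 + (z.1.2 ^ 3 + z.2.2 ^ 3)) with hΨ_def
  have hΨ : Measurable Ψ := by fun_prop
  have hF : Measurable (S.indicator Ψ) := hΨ.indicator hS
  have hshear : Measurable fun p : (ℝ × ℝ) × (ℝ × ℝ) => S.indicator Ψ (p.1, p.2 - p.1) :=
    hF.comp (by fun_prop)
  have hrw : ∫⁻ z in S, Ψ z = ∫⁻ σ : ℝ × ℝ, ∫⁻ ζ : ℝ × ℝ, S.indicator Ψ (ζ, σ - ζ) := by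
    rw [← lintegral_indicator hS, Measure.volume_eq_prod, lintegral_prod _ hF.aemeasurable]
    rw [← lintegral_lintegral_swap (f := fun ζ σ => S.indicator Ψ (ζ, σ - ζ)) hshear.aemeasurable]
    refine lintegral_congr fun ζ => ?_
    exact (lintegral_sub_right_eq_self (fun σ => S.indicator Ψ (ζ, σ)) ζ).symm
  have hfiber (σ : ℝ × ℝ) :
      ENNReal.ofReal (N₂ ^ 2) * ∫⁻ ζ : ℝ × ℝ, S.indicator Ψ (ζ, σ - ζ)
        ≤ φ₁ σ.1 * φ₂ σ.2 * (ENNReal.ofReal (4 * N₁) * 2 * ∫⁻ x, φ₃ x) := by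
    set A : Set ℝ := {x | |x| ≤ 2 * N₁ ∧ N₂ ≤ |σ.1 - x|}
    set E : Set ℝ := Set.Icc (-(2 * N₁)) (2 * N₁)
    have hA : MeasurableSet A :=
      (measurableSet_le (f := fun x : ℝ => |x|) (by fun_prop) (by fun_prop)).inter
        (measurableSet_le (f := fun _ : ℝ => N₂) (by fun_prop) (by fun_prop))
    have h3 : Measurable fun ζ : ℝ × ℝ =>
        φ₃ (ζ.1 ^ 3 + (σ.1 - ζ.1) ^ 3 + (ζ.2 ^ 3 + (σ.2 - ζ.2) ^ 3)) := by fun_prop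
    have hind (ζ : ℝ × ℝ) : S.indicator Ψ (ζ, σ - ζ) = φ₁ σ.1 * φ₂ σ.2 * (A ×ˢ E).indicator
        (fun ζ => φ₃ (ζ.1 ^ 3 + (σ.1 - ζ.1) ^ 3 + (ζ.2 ^ 3 + (σ.2 - ζ.2) ^ 3))) ζ := by
      have hmem : (ζ, σ - ζ) ∈ S ↔ ζ ∈ A ×ˢ E := by
        simp only [S, A, E, Set.mem_ofPred_eq, Set.mem_prod, Set.mem_Icc, Prod.fst_sub, ← abs_le]
        tauto
      by_cases h : ζ ∈ A ×ˢ E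
      · rw [Set.indicator_of_mem h, Set.indicator_of_mem (hmem.2 h)]
        simp [Ψ]
      · rw [Set.indicator_of_notMem h, Set.indicator_of_notMem (mt hmem.1 h), mul_zero]
    simp only [hind]
    rw [lintegral_const_mul _ (h3.indicator (hA.prod measurableSet_Icc)),
      lintegral_indicator (hA.prod measurableSet_Icc), Measure.volume_eq_prod,
      ← Measure.prod_restrict, lintegral_prod_symm _ h3.aemeasurable]
    rw [mul_left_comm]
    refine mul_le_mul_right ?_ _
    have hvol : volume E = ENNReal.ofReal (4 * N₁) := by
      rw [Real.volume_Icc]; congr 1; ring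
    calc _ ≤ ∫⁻ y in E, ENNReal.ofReal (N₂ ^ 2) * ∫⁻ x in A,
            φ₃ (x ^ 3 + (σ.1 - x) ^ 3 + (y ^ 3 + (σ.2 - y) ^ 3)) :=
          lintegral_const_mul_le _ _
      _ ≤ ∫⁻ y in E, 2 * ∫⁻ x, φ₃ x :=
          lintegral_mono fun y => mul_lintegral_cubic_le hN₁ hN σ.1 _ φ₃
      _ = _ := by
          rw [setLIntegral_const, hvol]
          ring
  rw [hrw]
  calc _ ≤ ∫⁻ σ : ℝ × ℝ, ENNReal.ofReal (N₂ ^ 2) * ∫⁻ ζ : ℝ × ℝ, S.indicator Ψ (ζ, σ - ζ) :=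
        lintegral_const_mul_le _ _
    _ ≤ ∫⁻ σ : ℝ × ℝ, φ₁ σ.1 * φ₂ σ.2 * (ENNReal.ofReal (4 * N₁) * 2 * ∫⁻ x, φ₃ x) :=
        lintegral_mono hfiber
    _ = _ := by
        rw [lintegral_mul_const _ (by fun_prop), Measure.volume_eq_prod,
          lintegral_prod_mul h₁.aemeasurable h₂.aemeasurable]
        ring

theorem mul_lintegral_annuli_le {N₁ N₂ : ℝ} (hN₁ : 0 < N₁) (hN : 4 * N₁ ≤ N₂)
    {φ₁ φ₂ φ₃ : ℝ → ℝ≥0∞} (h₁ : Measurable φ₁) (h₂ : Measurable φ₂) (h₃ : Measurable φ₃) :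
    ENNReal.ofReal (N₂ ^ 2) *
        ∫⁻ z : (ℝ × ℝ) × (ℝ × ℝ) in {z | ‖z.1‖ ≤ 2 * N₁ ∧ N₂ ≤ ‖z.2‖},
          φ₁ (z.1.1 + z.2.1) * φ₂ (z.1.2 + z.2.2) *
            φ₃ (z.1.1 ^ 3 + z.2.1 ^ 3 + (z.1.2 ^ 3 + z.2.2 ^ 3))
      ≤ ENNReal.ofReal (16 * N₁) * ((∫⁻ x, φ₁ x) * (∫⁻ x, φ₂ x) * ∫⁻ x, φ₃ x) := by
  set S : Set ((ℝ × ℝ) × (ℝ × ℝ)) :=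
    {z | |z.1.1| ≤ 2 * N₁ ∧ |z.1.2| ≤ 2 * N₁ ∧ N₂ ≤ |z.2.1|} with hS_def
  have hS : MeasurableSet S :=
    (measurableSet_le (f := fun z : (ℝ × ℝ) × (ℝ × ℝ) => |z.1.1|) (by fun_prop)
      (by fun_prop)).inter
    ((measurableSet_le (f := fun z : (ℝ × ℝ) × (ℝ × ℝ) => |z.1.2|) (by fun_prop)
      (by fun_prop)).inter
    (measurableSet_le (f := fun _ : (ℝ × ℝ) × (ℝ × ℝ) => N₂) (by fun_prop) (by fun_prop)))
  let sw : (ℝ × ℝ) × (ℝ × ℝ) → (ℝ × ℝ) × (ℝ × ℝ) := Prod.map Prod.swap Prod.swap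
  have hsw : MeasurePreserving sw volume volume :=
    Measure.measurePreserving_swap.prod Measure.measurePreserving_swap
  have hsub : {z : (ℝ × ℝ) × (ℝ × ℝ) | ‖z.1‖ ≤ 2 * N₁ ∧ N₂ ≤ ‖z.2‖} ⊆ S ∪ sw ⁻¹' S := by
    rintro ⟨⟨a, b⟩, ⟨c, d⟩⟩ ⟨h1, h2⟩
    simp only [Prod.norm_mk, sup_le_iff, le_sup_iff, Real.norm_eq_abs] at h1 h2
    rcases h2 with h2 | h2
    · exact Or.inl ⟨h1.1, h1.2, h2⟩
    · exact Or.inr ⟨h1.2, h1.1, h2⟩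
  have hswap := mul_lintegral_region_le hN₁ hN h₂ h₁ h₃
  rw [← hsw.setLIntegral_comp_preimage hS (by fun_prop)] at hswap
  calc _ ≤ ENNReal.ofReal (N₂ ^ 2) *
        ((∫⁻ z in S, φ₁ (z.1.1 + z.2.1) * φ₂ (z.1.2 + z.2.2) *
            φ₃ (z.1.1 ^ 3 + z.2.1 ^ 3 + (z.1.2 ^ 3 + z.2.2 ^ 3))) +
        ∫⁻ z in sw ⁻¹' S, φ₁ (z.1.1 + z.2.1) * φ₂ (z.1.2 + z.2.2) *
            φ₃ (z.1.1 ^ 3 + z.2.1 ^ 3 + (z.1.2 ^ 3 + z.2.2 ^ 3))) := by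
        gcongr
        exact (lintegral_mono_set hsub).trans (lintegral_union_le _ _ _)
    _ ≤ ENNReal.ofReal (4 * N₁) * 2 * ((∫⁻ x, φ₁ x) * (∫⁻ x, φ₂ x) * ∫⁻ x, φ₃ x) +
        ENNReal.ofReal (4 * N₁) * 2 * ((∫⁻ x, φ₂ x) * (∫⁻ x, φ₁ x) * ∫⁻ x, φ₃ x) := by
        rw [mul_add]
        refine add_le_add (mul_lintegral_region_le hN₁ hN h₁ h₂ h₃) (le_trans (le_of_eq ?_) hswap)
        congr 1
        refine lintegral_congr fun z => ?_
        simp only [sw, Prod.map_fst, Prod.map_snd, Prod.fst_swap, Prod.snd_swap]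
        rw [mul_comm (φ₁ _), add_comm (z.1.1 ^ 3 + z.2.1 ^ 3)]
    _ = _ := by
        rw [show 16 * N₁ = 4 * (4 * N₁) by ring,
          ENNReal.ofReal_mul (q := 4 * N₁) (by norm_num : (0 : ℝ) ≤ 4), ENNReal.ofReal_ofNat]
        ring

theorem integral_gaussian_mul_cexp_two {b : ℝ} (hb : 0 < b) (s r : ℝ) :
    ∫ q : ℝ × ℝ, (Real.exp (-b * (q.1 ^ 2 + q.2 ^ 2)) : ℂ) *
      Complex.exp (Complex.I * ((q.1 * s + q.2 * r : ℝ) : ℂ)) = gaussFT b s * gaussFT b r := by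
  rw [← integral_exp_neg_mul_sq_mul_cexp hb s, ← integral_exp_neg_mul_sq_mul_cexp hb r,
    ← integral_prod_mul, ← Measure.volume_eq_prod]
  congr with q
  rw [mul_add (-b), Real.exp_add, Complex.ofReal_add, mul_add Complex.I, Complex.exp_add]
  push_cast
  ring

theorem integral_gaussian_mul_cexp_three {b : ℝ} (hb : 0 < b) (s r u : ℝ) :
    ∫ q : ℝ × ℝ × ℝ, (Real.exp (-b * (q.1 ^ 2 + (q.2.1 ^ 2 + q.2.2 ^ 2))) : ℂ) *
      Complex.exp (Complex.I * ((q.1 * s + (q.2.1 * r + q.2.2 * u) : ℝ) : ℂ))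
      = gaussFT b s * (gaussFT b r * gaussFT b u) := by
  rw [← integral_exp_neg_mul_sq_mul_cexp hb s, ← integral_gaussian_mul_cexp_two hb r u,
    ← integral_prod_mul, ← Measure.volume_eq_prod]
  congr with q
  rw [mul_add (-b), Real.exp_add, Complex.ofReal_add, mul_add Complex.I, Complex.exp_add]
  push_cast
  ring

theorem integrable_gaussian_two {b : ℝ} (hb : 0 < b) :
    Integrable fun q : ℝ × ℝ => Real.exp (-b * (q.1 ^ 2 + q.2 ^ 2)) := by
  simp only [mul_add, Real.exp_add]
  exact (integrable_exp_neg_mul_sq hb).mul_prod (integrable_exp_neg_mul_sq hb)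

theorem integrable_gaussian_three {b : ℝ} (hb : 0 < b) :
    Integrable fun q : ℝ × ℝ × ℝ => Real.exp (-b * (q.1 ^ 2 + (q.2.1 ^ 2 + q.2.2 ^ 2))) := by
  have := (integrable_exp_neg_mul_sq hb).mul_prod (integrable_gaussian_two hb)
  simp only [← Real.exp_add, ← mul_add] at this
  exact this

theorem lintegral_enorm_FT_sq_le {f : ℝ × ℝ → ℂ} (hf : Continuous f) (hf' : Integrable f) :
    ∫⁻ ζ, ‖FT f ζ‖ₑ ^ 2 ≤ ENNReal.ofReal (8 * Real.pi ^ 2) * ∫⁻ p, ‖f p‖ₑ ^ 2 := by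
  let e : ℝ × ℝ → ℝ × ℝ → ℂ := fun ζ p =>
    Complex.exp (Complex.I * ((-(p.1 * ζ.1 + p.2 * ζ.2) : ℝ) : ℂ))
  have hFT (ζ : ℝ × ℝ) : FT f ζ = ∫ p, e ζ p * f p := by
    unfold FT
    congr with p
    rw [mul_comm]
    congr 2
    push_cast
    ring
  simp only [hFT]
  have hb (n : ℕ) : 0 < 1 / ((n : ℝ) + 1) := by positivity
  refine (lintegral_enorm_integral_sq_le (B := ENNReal.ofReal ((2 * Real.pi) ^ 2))
    (w := fun n q => Real.exp (-(1 / ((n : ℝ) + 1)) * (q.1 ^ 2 + q.2 ^ 2)))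
    (fun n => integrable_gaussian_two (hb n)) (fun n => by fun_prop)
    (fun n q => (Real.exp_pos _).le) (fun q => tendsto_exp_neg_inv_mul _) (e := e) ?_ ?_ hf'
    hf.measurable ?_).trans ?_
  · refine Continuous.measurable ?_
    simp only [e, Function.uncurry_def]
    fun_prop
  · intro q z
    simp only [e]
    rw [mul_comm, Complex.norm_exp_ofReal_mul_I]
  · intro n p
    have hk (p' : ℝ × ℝ) : ‖∫ q : ℝ × ℝ, (Real.exp (-(1 / ((n : ℝ) + 1)) *
          (q.1 ^ 2 + q.2 ^ 2)) : ℂ) * (e q p * conj (e q p'))‖ₑ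
        = ENNReal.ofReal (gaussFT (1 / ((n : ℝ) + 1)) (p'.1 - p.1)) *
          ENNReal.ofReal (gaussFT (1 / ((n : ℝ) + 1)) (p'.2 - p.2)) := by
      have h := integral_gaussian_mul_cexp_two (hb n) (p'.1 - p.1) (p'.2 - p.2)
      rw [← ENNReal.ofReal_mul (gaussFT_nonneg _ _),
        ← Real.norm_of_nonneg (mul_nonneg (gaussFT_nonneg _ _) (gaussFT_nonneg _ _)),
        ← Complex.norm_real, Complex.ofReal_mul, ← h, ofReal_norm]
      congr 2 with q
      simp only [e]
      rw [cexp_I_mul_conj]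
      congr 4
      ring
    simp only [hk]
    rw [Measure.volume_eq_prod, lintegral_prod_mul
      (f := fun x => ENNReal.ofReal (gaussFT (1 / ((n : ℝ) + 1)) (x - p.1)))
      (g := fun x => ENNReal.ofReal (gaussFT (1 / ((n : ℝ) + 1)) (x - p.2)))
      ((measurable_ofReal_gaussFT _).comp (by fun_prop)).aemeasurable
      ((measurable_ofReal_gaussFT _).comp (by fun_prop)).aemeasurable,
      lintegral_sub_right_eq_self (fun s => ENNReal.ofReal (gaussFT _ s)),
      lintegral_sub_right_eq_self (fun s => ENNReal.ofReal (gaussFT _ s)),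
      lintegral_gaussFT (hb n), ← ENNReal.ofReal_mul (by positivity), sq]
  · rw [show 8 * Real.pi ^ 2 = 2 * (2 * Real.pi) ^ 2 by ring,
      ENNReal.ofReal_mul (by norm_num : (0 : ℝ) ≤ 2), ENNReal.ofReal_ofNat]

theorem continuous_FT {f : ℝ × ℝ → ℂ} (hf : Continuous f) (hf' : Integrable f) :
    Continuous (FT f) := by
  unfold FT
  refine continuous_of_dominated (bound := fun p => ‖f p‖) (fun ζ => ?_)
    (fun ζ => ae_of_all _ fun p => ?_) hf'.norm (ae_of_all _ fun p => ?_)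
  · exact Continuous.aestronglyMeasurable (by fun_prop)
  · rw [norm_mul, ← mul_neg_one Complex.I, mul_assoc, mul_comm Complex.I]
    rw [show (-1 : ℂ) * ((p.1 * ζ.1 + p.2 * ζ.2 : ℝ) : ℂ)
      = ((-(p.1 * ζ.1 + p.2 * ζ.2) : ℝ) : ℂ) by push_cast; ring]
    rw [Complex.norm_exp_ofReal_mul_I, mul_one]
  · fun_prop

theorem integrable_FT_of_bounded_support {f : ℝ × ℝ → ℂ} (hf : Continuous f)
    (hf' : Integrable f) {R : ℝ} (hR : ∀ ζ, FT f ζ ≠ 0 → ‖ζ‖ ≤ R) : Integrable (FT f) := by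
  refine (continuous_FT hf hf').integrable_of_hasCompactSupport
    (HasCompactSupport.of_support_subset_isCompact (isCompact_closedBall 0 R) fun ζ hζ => ?_)
  simpa using hR ζ hζ

theorem enorm_integral_gaussian_mul_cexp_three {b : ℝ} (hb : 0 < b) (s r u s' r' u' : ℝ) :
    ‖∫ q : ℝ × ℝ × ℝ, (Real.exp (-b * (q.1 ^ 2 + (q.2.1 ^ 2 + q.2.2 ^ 2))) : ℂ) *
        (Complex.exp (Complex.I * ((q.1 * s + (q.2.1 * r + q.2.2 * u) : ℝ) : ℂ)) *
          conj (Complex.exp (Complex.I * ((q.1 * s' + (q.2.1 * r' + q.2.2 * u') : ℝ) : ℂ))))‖ₑ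
      = ENNReal.ofReal (gaussFT b (s - s')) * ENNReal.ofReal (gaussFT b (r - r')) *
        ENNReal.ofReal (gaussFT b (u - u')) := by
  rw [mul_assoc, ← ENNReal.ofReal_mul (gaussFT_nonneg _ _),
    ← ENNReal.ofReal_mul (gaussFT_nonneg _ _),
    ← Real.norm_of_nonneg (mul_nonneg (gaussFT_nonneg b (s - s'))
      (mul_nonneg (gaussFT_nonneg b (r - r')) (gaussFT_nonneg b (u - u')))),
    ← Complex.norm_real, Complex.ofReal_mul, Complex.ofReal_mul,
    ← integral_gaussian_mul_cexp_three hb, ofReal_norm]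
  congr 2 with q
  rw [cexp_I_mul_conj]
  congr 4
  ring

theorem lintegral_annuli_gaussFT_le {N₁ N₂ : ℝ} (hN₁ : 0 < N₁) (hN : 4 * N₁ ≤ N₂) {b : ℝ}
    (hb : 0 < b) (s r u : ℝ) :
    ∫⁻ z : (ℝ × ℝ) × (ℝ × ℝ) in {z | ‖z.1‖ ≤ 2 * N₁ ∧ N₂ ≤ ‖z.2‖},
        ENNReal.ofReal (gaussFT b (s - (z.1.1 + z.2.1))) *
          ENNReal.ofReal (gaussFT b (r - (z.1.2 + z.2.2))) *
          ENNReal.ofReal (gaussFT b (u - (z.1.1 ^ 3 + z.2.1 ^ 3 + (z.1.2 ^ 3 + z.2.2 ^ 3))))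
      ≤ ENNReal.ofReal (128 * Real.pi ^ 3 * N₁ / N₂ ^ 2) := by
  have hN₂ : 0 < N₂ := by linarith
  have hmeas (a : ℝ) : Measurable fun s => ENNReal.ofReal (gaussFT b (a - s)) :=
    (measurable_ofReal_gaussFT b).comp (measurable_const.sub measurable_id)
  have hmain := mul_lintegral_annuli_le hN₁ hN (hmeas s) (hmeas r) (hmeas u)
  simp only [lintegral_gaussFT_sub hb] at hmain
  have hpos : 0 < N₂ ^ 2 := by positivity
  have h0 : ENNReal.ofReal (N₂ ^ 2) ≠ 0 := by simpa using hN₂.ne'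
  rw [ENNReal.ofReal_div_of_pos hpos, ENNReal.le_div_iff_mul_le (Or.inl h0)
    (Or.inl ENNReal.ofReal_ne_top), mul_comm]
  refine hmain.trans (le_of_eq ?_)
  rw [← ENNReal.ofReal_mul (by positivity), ← ENNReal.ofReal_mul (by positivity),
    ← ENNReal.ofReal_mul (by positivity)]
  congr 1
  ring

/-- The product of two plane waves solving the linear equation, with frequencies `z.1`, `z.2`. -/
noncomputable def planeWaveProd (q : ℝ × ℝ × ℝ) (z : (ℝ × ℝ) × (ℝ × ℝ)) : ℂ :=
  Complex.exp (Complex.I * ((q.1 * (z.1.1 + z.2.1) + (q.2.1 * (z.1.2 + z.2.2) +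
    q.2.2 * (z.1.1 ^ 3 + z.2.1 ^ 3 + (z.1.2 ^ 3 + z.2.2 ^ 3))) : ℝ) : ℂ))

theorem norm_planeWaveProd_le (q : ℝ × ℝ × ℝ) (z : (ℝ × ℝ) × (ℝ × ℝ)) :
    ‖planeWaveProd q z‖ ≤ 1 := by
  rw [planeWaveProd, mul_comm, Complex.norm_exp_ofReal_mul_I]

theorem measurable_planeWaveProd : Measurable (Function.uncurry planeWaveProd) := by
  refine Continuous.measurable (Complex.continuous_exp.comp
    (continuous_const.mul (Complex.continuous_ofReal.comp ?_)))
  have h1 : Continuous fun p : (ℝ × ℝ × ℝ) × ((ℝ × ℝ) × (ℝ × ℝ)) => p.2.1.1 :=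
    continuous_fst.comp (continuous_fst.comp continuous_snd)
  have h2 : Continuous fun p : (ℝ × ℝ × ℝ) × ((ℝ × ℝ) × (ℝ × ℝ)) => p.2.1.2 :=
    continuous_snd.comp (continuous_fst.comp continuous_snd)
  have h3 : Continuous fun p : (ℝ × ℝ × ℝ) × ((ℝ × ℝ) × (ℝ × ℝ)) => p.2.2.1 :=
    continuous_fst.comp (continuous_snd.comp continuous_snd)
  have h4 : Continuous fun p : (ℝ × ℝ × ℝ) × ((ℝ × ℝ) × (ℝ × ℝ)) => p.2.2.2 :=
    continuous_snd.comp (continuous_snd.comp continuous_snd)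
  have h5 : Continuous fun p : (ℝ × ℝ × ℝ) × ((ℝ × ℝ) × (ℝ × ℝ)) => p.1.1 :=
    continuous_fst.comp continuous_fst
  have h6 : Continuous fun p : (ℝ × ℝ × ℝ) × ((ℝ × ℝ) × (ℝ × ℝ)) => p.1.2.1 :=
    continuous_fst.comp (continuous_snd.comp continuous_fst)
  have h7 : Continuous fun p : (ℝ × ℝ × ℝ) × ((ℝ × ℝ) × (ℝ × ℝ)) => p.1.2.2 :=
    continuous_snd.comp (continuous_snd.comp continuous_fst)
  exact (h5.mul (h1.add h3)).add ((h6.mul (h2.add h4)).add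
    (h7.mul (((h1.pow 3).add (h3.pow 3)).add ((h2.pow 3).add (h4.pow 3)))))

theorem integral_planeWave_mul_integral_planeWave {F G : ℝ × ℝ → ℂ} (q : ℝ × ℝ × ℝ) :
    (∫ ζ : ℝ × ℝ, Complex.exp (Complex.I *
        ((q.1 * ζ.1 + q.2.1 * ζ.2 + q.2.2 * (ζ.1 ^ 3 + ζ.2 ^ 3) : ℝ) : ℂ)) * F ζ) *
      (∫ ζ : ℝ × ℝ, Complex.exp (Complex.I *
        ((q.1 * ζ.1 + q.2.1 * ζ.2 + q.2.2 * (ζ.1 ^ 3 + ζ.2 ^ 3) : ℝ) : ℂ)) * G ζ)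
    = ∫ z : (ℝ × ℝ) × (ℝ × ℝ), planeWaveProd q z * (F z.1 * G z.2) := by
  rw [← integral_prod_mul, ← Measure.volume_eq_prod]
  congr with z
  rw [mul_mul_mul_comm, ← Complex.exp_add, ← mul_add, ← Complex.ofReal_add, planeWaveProd]
  congr 4
  ring

theorem lintegral_enorm_integral_planeWaveProd_sq_le {N₁ N₂ : ℝ} (hN₁ : 0 < N₁)
    (hN : 4 * N₁ ≤ N₂) {K : (ℝ × ℝ) × (ℝ × ℝ) → ℂ} (hK : Integrable K) (hK_meas : Measurable K)
    (hKS : ∀ z, K z ≠ 0 → ‖z.1‖ ≤ 2 * N₁ ∧ N₂ ≤ ‖z.2‖) :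
    ∫⁻ q, ‖∫ z, planeWaveProd q z * K z‖ₑ ^ 2
      ≤ ENNReal.ofReal (256 * Real.pi ^ 3 * N₁ / N₂ ^ 2) * ∫⁻ z, ‖K z‖ₑ ^ 2 := by
  set S : Set ((ℝ × ℝ) × (ℝ × ℝ)) := {z | ‖z.1‖ ≤ 2 * N₁ ∧ N₂ ≤ ‖z.2‖}
  have hrestrict (q : ℝ × ℝ × ℝ) :
      ∫ z, planeWaveProd q z * K z = ∫ z in S, planeWaveProd q z * K z := by
    refine (setIntegral_eq_integral_of_forall_compl_eq_zero fun z hz => ?_).symm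
    rw [not_imp_comm.1 (hKS z) hz, mul_zero]
  have hb (n : ℕ) : 0 < 1 / ((n : ℝ) + 1) := by positivity
  have hkernel (n : ℕ) (z : (ℝ × ℝ) × (ℝ × ℝ)) :
      ∫⁻ z' in S, ‖∫ q : ℝ × ℝ × ℝ, (Real.exp (-(1 / ((n : ℝ) + 1)) *
          (q.1 ^ 2 + (q.2.1 ^ 2 + q.2.2 ^ 2))) : ℂ) *
            (planeWaveProd q z * conj (planeWaveProd q z'))‖ₑ
        ≤ ENNReal.ofReal (128 * Real.pi ^ 3 * N₁ / N₂ ^ 2) := by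
    simp only [planeWaveProd, enorm_integral_gaussian_mul_cexp_three (hb n)]
    exact lintegral_annuli_gaussFT_le hN₁ hN (hb n) _ _ _
  have hw_meas (n : ℕ) : Measurable fun q : ℝ × ℝ × ℝ =>
      Real.exp (-(1 / ((n : ℝ) + 1)) * (q.1 ^ 2 + (q.2.1 ^ 2 + q.2.2 ^ 2))) := by
    fun_prop
  simp only [hrestrict]
  refine (lintegral_enorm_integral_sq_le (fun n => integrable_gaussian_three (hb n)) hw_meas
    (fun n q => (Real.exp_pos _).le) (fun q => tendsto_exp_neg_inv_mul _)
    measurable_planeWaveProd norm_planeWaveProd_le hK.integrableOn hK_meas hkernel).trans ?_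
  rw [show 256 * Real.pi ^ 3 * N₁ / N₂ ^ 2 = 2 * (128 * Real.pi ^ 3 * N₁ / N₂ ^ 2) by ring,
    ENNReal.ofReal_mul (by norm_num : (0 : ℝ) ≤ 2), ENNReal.ofReal_ofNat]
  exact mul_le_mul_right (setLIntegral_le_lintegral _ _) _

/-- The bilinear estimate on the frequency side, for continuous profiles. -/
theorem lintegral_enorm_bilinear_sq_le {N₁ N₂ : ℝ} (hN₁ : 0 < N₁) (hN : 4 * N₁ ≤ N₂)
    {F G : ℝ × ℝ → ℂ} (hF : Continuous F) (hF' : Integrable F) (hG : Continuous G)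
    (hG' : Integrable G) (hFs : ∀ ζ, F ζ ≠ 0 → ‖ζ‖ ≤ 2 * N₁) (hGs : ∀ ζ, G ζ ≠ 0 → N₂ ≤ ‖ζ‖) :
    ∫⁻ q : ℝ × ℝ × ℝ,
      ‖(∫ ζ : ℝ × ℝ, Complex.exp (Complex.I *
          ((q.1 * ζ.1 + q.2.1 * ζ.2 + q.2.2 * (ζ.1 ^ 3 + ζ.2 ^ 3) : ℝ) : ℂ)) * F ζ) *
        (∫ ζ : ℝ × ℝ, Complex.exp (Complex.I *
          ((q.1 * ζ.1 + q.2.1 * ζ.2 + q.2.2 * (ζ.1 ^ 3 + ζ.2 ^ 3) : ℝ) : ℂ)) * G ζ)‖ₑ ^ 2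
      ≤ ENNReal.ofReal (256 * Real.pi ^ 3 * N₁ / N₂ ^ 2) *
        ((∫⁻ ζ, ‖F ζ‖ₑ ^ 2) * ∫⁻ ζ, ‖G ζ‖ₑ ^ 2) := by
  simp only [integral_planeWave_mul_integral_planeWave]
  refine (lintegral_enorm_integral_planeWaveProd_sq_le hN₁ hN (hF'.mul_prod hG')
    ((hF.measurable.comp measurable_fst).mul (hG.measurable.comp measurable_snd))
    fun z hz => ⟨hFs _ (left_ne_zero_of_mul hz), hGs _ (right_ne_zero_of_mul hz)⟩).trans ?_
  rw [← lintegral_prod_mul (hF.measurable.enorm.pow_const 2).aemeasurable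
    (hG.measurable.enorm.pow_const 2).aemeasurable, ← Measure.volume_eq_prod]
  simp only [enorm_mul, mul_pow, le_refl]

theorem lintegral_enorm_freeU_mul_sq_le {N₁ N₂ : ℝ} (hN₁ : 0 < N₁) (hN : 4 * N₁ ≤ N₂)
    {f g : ℝ × ℝ → ℂ} (hf : Continuous f) (hf' : Integrable f) (hg : Continuous g)
    (hg' : Integrable g) (hfs : ∀ ζ, FT f ζ ≠ 0 → ‖ζ‖ ≤ 2 * N₁)
    (hgs : ∀ ζ, FT g ζ ≠ 0 → N₂ ≤ ‖ζ‖ ∧ ‖ζ‖ ≤ 2 * N₂) :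
    ∫⁻ q : ℝ × ℝ × ℝ, ‖freeU f q.1 q.2.1 q.2.2 * freeU g q.1 q.2.1 q.2.2‖ₑ ^ 2
      ≤ ENNReal.ofReal (64 / Real.pi * (N₁ / N₂ ^ 2)) *
        ((∫⁻ p, ‖f p‖ₑ ^ 2) * ∫⁻ p, ‖g p‖ₑ ^ 2) := by
  have hπ := Real.pi_pos
  have hN₂ : 0 < N₂ := by linarith
  have hmain := lintegral_enorm_bilinear_sq_le hN₁ hN (continuous_FT hf hf')
    (integrable_FT_of_bounded_support hf hf' hfs) (continuous_FT hg hg')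
    (integrable_FT_of_bounded_support hg hg' fun ζ hζ => (hgs ζ hζ).2) hfs
    (fun ζ hζ => (hgs ζ hζ).1)
  have hc : ‖(((((2 * Real.pi) ^ 2)⁻¹ : ℝ) : ℂ))‖ₑ = ENNReal.ofReal (((2 * Real.pi) ^ 2)⁻¹) := by
    rw [← ofReal_norm, Complex.norm_real, Real.norm_of_nonneg (by positivity)]
  have hmul (A B : ℂ) : ‖(((((2 * Real.pi) ^ 2)⁻¹ : ℝ) : ℂ)) * A *
        ((((((2 * Real.pi) ^ 2)⁻¹ : ℝ) : ℂ)) * B)‖ₑ ^ 2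
      = ENNReal.ofReal ((((2 * Real.pi) ^ 2)⁻¹ * ((2 * Real.pi) ^ 2)⁻¹) ^ 2) * ‖A * B‖ₑ ^ 2 := by
    rw [mul_mul_mul_comm, enorm_mul, enorm_mul, hc, ← ENNReal.ofReal_mul (by positivity), mul_pow,
      ← ENNReal.ofReal_pow (by positivity)]
  simp only [freeU, hmul]
  rw [lintegral_const_mul' _ _ ENNReal.ofReal_ne_top]
  calc _ ≤ ENNReal.ofReal ((((2 * Real.pi) ^ 2)⁻¹ * ((2 * Real.pi) ^ 2)⁻¹) ^ 2) *
        (ENNReal.ofReal (256 * Real.pi ^ 3 * N₁ / N₂ ^ 2) *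
          ((ENNReal.ofReal (8 * Real.pi ^ 2) * ∫⁻ p, ‖f p‖ₑ ^ 2) *
            (ENNReal.ofReal (8 * Real.pi ^ 2) * ∫⁻ p, ‖g p‖ₑ ^ 2))) := by
        refine mul_le_mul_right (hmain.trans ?_) _
        gcongr
        · exact lintegral_enorm_FT_sq_le hf hf'
        · exact lintegral_enorm_FT_sq_le hg hg'
    _ = _ := by
        have : 64 / Real.pi * (N₁ / N₂ ^ 2)
            = (((2 * Real.pi) ^ 2)⁻¹ * ((2 * Real.pi) ^ 2)⁻¹) ^ 2 *
              (256 * Real.pi ^ 3 * N₁ / N₂ ^ 2) * (8 * Real.pi ^ 2) * (8 * Real.pi ^ 2) := by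
          field_simp
          norm_num
        rw [this, ENNReal.ofReal_mul (q := 8 * Real.pi ^ 2) (by positivity),
          ENNReal.ofReal_mul (q := 8 * Real.pi ^ 2) (by positivity),
          ENNReal.ofReal_mul (q := 256 * Real.pi ^ 3 * N₁ / N₂ ^ 2) (by positivity)]
        ring

theorem SchwartzMap.lintegral_enorm_sq (f : SchwartzMap (ℝ × ℝ) ℂ) :
    ∫⁻ p, ‖f p‖ₑ ^ 2 = ENNReal.ofReal (∫ p, ‖f p‖ ^ 2) := by
  have h : Integrable fun p => ‖f p‖ ^ 2 :=
    MemLp.integrable_norm_pow (p := 2) (f.memLp 2 volume) two_ne_zero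
  rw [ofReal_integral_eq_lintegral_ofReal h (ae_of_all _ fun p => sq_nonneg _)]
  congr with p
  rw [ENNReal.ofReal_pow (norm_nonneg _), ofReal_norm]

/-- bilinear refinement of the Strichartz estimate (free-solution form):
if `f̂` is supported in `{N₁ ≤ |ζ| ≤ 2N₁}` and `ĝ` in `{N₂ ≤ |ζ| ≤ 2N₂}` with
`4N₁ ≤ N₂`, then `‖(U(t)f)(U(t)g)‖_{L²(ℝ²×ℝ)} ≤ C (N₁^{1/2}/N₂) ‖f‖_{L²} ‖g‖_{L²}`
for a universal constant `C`. -/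
theorem bilinear_refinement_strichartz :
    ∃ C : ℝ, 0 < C ∧
      ∀ (N₁ N₂ : ℝ), 0 < N₁ → 0 < N₂ → 4 * N₁ ≤ N₂ →
        ∀ (f g : SchwartzMap (ℝ × ℝ) ℂ),
          (∀ ζ : ℝ × ℝ, FT ⇑f ζ ≠ 0 → N₁ ≤ ‖ζ‖ ∧ ‖ζ‖ ≤ 2 * N₁) →
          (∀ ζ : ℝ × ℝ, FT ⇑g ζ ≠ 0 → N₂ ≤ ‖ζ‖ ∧ ‖ζ‖ ≤ 2 * N₂) →
          Real.sqrt (∫ q : ℝ × ℝ × ℝ,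
              ‖freeU ⇑f q.1 q.2.1 q.2.2 * freeU ⇑g q.1 q.2.1 q.2.2‖ ^ 2)
            ≤ C * (N₁ ^ ((1 : ℝ)/2) / N₂) * Real.sqrt (∫ p : ℝ × ℝ, ‖f p‖ ^ 2)
                * Real.sqrt (∫ p : ℝ × ℝ, ‖g p‖ ^ 2) := by
  refine ⟨√(64 / Real.pi), by positivity, ?_⟩
  intro N₁ N₂ hN₁ hN₂ hN f g hf hg
  have hmain := lintegral_enorm_freeU_mul_sq_le hN₁ hN f.continuous f.integrable g.continuous
    g.integrable (fun ζ hζ => (hf ζ hζ).2) hg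
  have hI : 0 ≤ ∫ p : ℝ × ℝ, ‖f p‖ ^ 2 := integral_nonneg fun p => sq_nonneg _
  have hJ : 0 ≤ ∫ p : ℝ × ℝ, ‖g p‖ ^ 2 := integral_nonneg fun p => sq_nonneg _
  rw [f.lintegral_enorm_sq, g.lintegral_enorm_sq, ← ENNReal.ofReal_mul hI,
    ← ENNReal.ofReal_mul (by positivity)] at hmain
  have hconst : √(64 / Real.pi) * (N₁ ^ ((1 : ℝ) / 2) / N₂) * √(∫ p : ℝ × ℝ, ‖f p‖ ^ 2)
      * √(∫ p : ℝ × ℝ, ‖g p‖ ^ 2) = √(64 / Real.pi * (N₁ / N₂ ^ 2) *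
        ((∫ p : ℝ × ℝ, ‖f p‖ ^ 2) * ∫ p : ℝ × ℝ, ‖g p‖ ^ 2)) := by
    rw [Real.sqrt_mul (by positivity), Real.sqrt_mul hI, Real.sqrt_mul (by positivity),
      Real.sqrt_div hN₁.le, Real.sqrt_sq hN₂.le, ← Real.sqrt_eq_rpow]
    ring
  rw [hconst]
  refine Real.sqrt_le_sqrt ?_
  have hnn : 0 ≤ 64 / Real.pi * (N₁ / N₂ ^ 2) *
      ((∫ p : ℝ × ℝ, ‖f p‖ ^ 2) * ∫ p : ℝ × ℝ, ‖g p‖ ^ 2) := by positivity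
  by_cases hint : Integrable fun q : ℝ × ℝ × ℝ =>
      ‖freeU ⇑f q.1 q.2.1 q.2.2 * freeU ⇑g q.1 q.2.1 q.2.2‖ ^ 2
  · rw [← ENNReal.ofReal_le_ofReal_iff hnn,
      ofReal_integral_eq_lintegral_ofReal hint (ae_of_all _ fun q => sq_nonneg _)]
    refine le_trans (le_of_eq (lintegral_congr fun q => ?_)) hmain
    rw [ENNReal.ofReal_pow (norm_nonneg _), ofReal_norm]
  · rw [integral_undef hint]
    exact hnn
end

section
/- There exists a constant C > 0 such that for every f ∈ 𝓢(ℝ²), ‖U(t)f‖_{L⁴_{x,y} L^∞_t} ≤ C ‖D^(1/2) f‖_{L²(ℝ²)}, where ‖F‖_{L⁴_{x,y} L^∞_t} = ( ∫_{ℝ²} ( sup_{t ∈ ℝ} |F(x, y, t)| )⁴ dx dy )^(1/4). -/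
open MeasureTheory

/-- The free evolution of the linear symmetrized mZK equation composed with the
Fourier multiplier `D^α` of symbol `|ζ|^α`:
`(D^α U(t)f)(x,y) = (2π)^{-2} ∫ |ζ|^α e^{i(xξ+yη+t(ξ³+η³))} f̂(ζ) dζ`. -/
noncomputable def UD (α : ℝ) (f : ℝ × ℝ → ℂ) (x y t : ℝ) : ℂ :=
  ((((2 * Real.pi) ^ 2)⁻¹ : ℝ) : ℂ) *
    ∫ ζ : ℝ × ℝ, ((‖ζ‖ ^ α : ℝ) : ℂ) *
      Complex.exp (Complex.I * ((x * ζ.1 + y * ζ.2 + t * (ζ.1 ^ 3 + ζ.2 ^ 3) : ℝ) : ℂ)) *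
      FT f ζ

section Plancherel

open FourierTransform SchwartzMap Real ContDiff

variable {V : Type*} [NormedAddCommGroup V] [InnerProductSpace ℝ V] [FiniteDimensional ℝ V]
  [MeasurableSpace V] [BorelSpace V]

theorem coeFn_fourier_toLp_ae_eq {g : V → ℂ} (h1 : Integrable g) (h2 : MemLp g 2) :
    (𝓕 (h2.toLp g) : Lp (α := V) ℂ 2) =ᵐ[volume] 𝓕 g := by
  have hcont : Continuous (𝓕 g) :=
    VectorFourier.fourierIntegral_continuous continuous_fourierChar
      continuous_inner h1
  refine ae_eq_of_integral_contDiff_smul_eq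
    ((Lp.memLp _).locallyIntegrable (by norm_num)) hcont.locallyIntegrable ?_
  intro φ φ_smooth φ_cpt
  have hg₁ : HasCompactSupport (Complex.ofRealCLM ∘ φ) := φ_cpt.comp_left rfl
  have hg₂ : ContDiff ℝ ∞ (Complex.ofRealCLM ∘ φ) := by fun_prop
  set ψ : 𝓢(V, ℂ) := hg₁.toSchwartzMap hg₂ with hψ
  have e1 := congrArg (fun T => T ψ) (Lp.fourier_toTemperedDistribution_eq (h2.toLp g))
  simp only [TemperedDistribution.fourier_apply, Lp.toTemperedDistribution_apply] at e1
  have e2 : ∫ x, (𝓕 ψ) x • (h2.toLp g) x = ∫ x, (𝓕 ψ) x • g x := by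
    apply integral_congr_ae
    filter_upwards [h2.coeFn_toLp] with x hx
    rw [hx]
  have e3 : ∫ x, (𝓕 ψ) x • g x = ∫ x, ψ x • (𝓕 g) x := by
    have := VectorFourier.integral_fourierIntegral_smul_eq_flip (L := innerₗ V) (μ := volume)
      (ν := volume) (f := ψ) (g := g) continuous_fourierChar
      continuous_inner ψ.integrable h1
    simpa [SchwartzMap.fourier_coe] using! this
  have e4 : ∀ F : V → ℂ, ∫ x, φ x • F x = ∫ x, ψ x • F x := by
    intro F
    refine integral_congr_ae (Filter.Eventually.of_forall fun x => ?_)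
    simp [hψ]
  rw [e4, e4, ← e1, e2, e3]

theorem memLp_two_fourier {g : V → ℂ} (h1 : Integrable g) (h2 : MemLp g 2) :
    MemLp (𝓕 g) 2 :=
  (memLp_congr_ae (coeFn_fourier_toLp_ae_eq h1 h2)).1 (Lp.memLp _)

theorem eLpNorm_two_fourier {g : V → ℂ} (h1 : Integrable g) (h2 : MemLp g 2) :
    eLpNorm (𝓕 g) 2 volume = eLpNorm g 2 volume := by
  rw [← eLpNorm_congr_ae (coeFn_fourier_toLp_ae_eq h1 h2), ← eLpNorm_congr_ae h2.coeFn_toLp,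
    ← Lp.enorm_def, ← Lp.enorm_def, ← ofReal_norm, ← ofReal_norm, Lp.norm_fourier_eq]

end Plancherel

section FourierProd

open FourierTransform SchwartzMap Real

theorem integral_withLp_prod (F : WithLp 2 (ℝ × ℝ) → ℂ) :
    ∫ v, F v = ∫ p : ℝ × ℝ, F (WithLp.toLp 2 p) :=
  ((WithLp.volume_preserving_toLp ℝ ℝ).integral_comp
    (MeasurableEquiv.toLp 2 (ℝ × ℝ)).measurableEmbedding F).symm

theorem integral_mul_exp_eq_fourier (w : ℝ × ℝ → ℂ) (c : ℝ) (q : ℝ × ℝ) :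
    ∫ p : ℝ × ℝ, w p * Complex.exp (Complex.I * ((c * (p.1 * q.1 + p.2 * q.2) : ℝ) : ℂ)) =
      𝓕 (fun v : WithLp 2 (ℝ × ℝ) => w (WithLp.ofLp v))
        ((-(c * (2 * π)⁻¹)) • WithLp.toLp 2 q) := by
  rw [fourier_eq', integral_withLp_prod]
  refine integral_congr_ae (Filter.Eventually.of_forall fun p => ?_)
  simp only [smul_eq_mul]
  rw [mul_comm]
  congr 2
  rw [inner_smul_right, WithLp.prod_inner_apply]
  simp only [RCLike.inner_apply, conj_trivial]
  push_cast
  have : (π : ℂ) ≠ 0 := by exact_mod_cast pi_ne_zero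
  field_simp

theorem exists_schwartz_eq_FT (f : SchwartzMap (ℝ × ℝ) ℂ) :
    ∃ Φ : SchwartzMap (ℝ × ℝ) ℂ, FT f = Φ := by
  let e : WithLp 2 (ℝ × ℝ) ≃L[ℝ] ℝ × ℝ := WithLp.prodContinuousLinearEquiv 2 ℝ ℝ ℝ
  let g : 𝓢(WithLp 2 (ℝ × ℝ), ℂ) := compCLMOfContinuousLinearEquiv ℂ e f
  have hc : (2 * π)⁻¹ ≠ 0 := by positivity
  let s : (ℝ × ℝ) ≃L[ℝ] ℝ × ℝ := ContinuousLinearEquiv.smulLeft (Units.mk0 ((2 * π)⁻¹) hc)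
  refine ⟨compCLMOfContinuousLinearEquiv ℂ (s.trans e.symm) (𝓕 g), ?_⟩
  funext ζ
  have := integral_mul_exp_eq_fourier f (-1) ζ
  simp only [FT]
  simp only [neg_mul, one_mul, neg_neg, Complex.ofReal_neg, mul_neg] at this ⊢
  rw [this]
  rfl

theorem integral_norm_sq_integral_mul_exp {w : ℝ × ℝ → ℂ} (h1 : Integrable w) (h2 : MemLp w 2) :
    ∫ q : ℝ × ℝ, ‖∫ p : ℝ × ℝ, w p *
        Complex.exp (Complex.I * ((p.1 * q.1 + p.2 * q.2 : ℝ) : ℂ))‖ ^ 2 =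
      (2 * π) ^ 2 * ∫ p, ‖w p‖ ^ 2 := by
  set g : WithLp 2 (ℝ × ℝ) → ℂ := fun v => w (WithLp.ofLp v) with hg
  have mp := WithLp.volume_preserving_ofLp ℝ ℝ
  have g1 : Integrable g := mp.integrable_comp_of_integrable h1
  have g2 : MemLp g 2 := h2.comp_measurePreserving mp
  have hF := memLp_two_fourier g1 g2
  have hE := eLpNorm_two_fourier g1 g2
  have key : ∀ {V : Type} [MeasurableSpace V] {μ : Measure V} {F : V → ℂ}, MemLp F 2 μ →
      ∫ v, ‖F v‖ ^ 2 ∂μ = (eLpNorm F 2 μ).toReal ^ 2 := by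
    intro V _ μ F hF
    have := hF.eLpNorm_eq_integral_rpow_norm (by norm_num) (by norm_num)
    rw [this, ENNReal.toReal_ofReal (by positivity)]
    simp only [ENNReal.toReal_ofNat, rpow_ofNat]
    rw [← rpow_natCast, ← rpow_mul (by positivity)]
    norm_num
  have e1 : ∫ v, ‖𝓕 g v‖ ^ 2 = ∫ v, ‖g v‖ ^ 2 := by rw [key hF, key g2, hE]
  have e2 : ∫ v, ‖g v‖ ^ 2 = ∫ p, ‖w p‖ ^ 2 :=
    mp.integral_comp (MeasurableEquiv.toLp 2 (ℝ × ℝ)).symm.measurableEmbedding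
      (fun p => ‖w p‖ ^ 2)
  have e3 : ∀ q : ℝ × ℝ, ∫ p : ℝ × ℝ, w p *
        Complex.exp (Complex.I * ((p.1 * q.1 + p.2 * q.2 : ℝ) : ℂ)) =
      𝓕 g (WithLp.toLp 2 ((-(2 * π)⁻¹) • q)) := by
    intro q
    have := integral_mul_exp_eq_fourier w 1 q
    simpa using this
  simp_rw [e3]
  rw [Measure.integral_comp_smul volume
    (fun q : ℝ × ℝ => ‖𝓕 g (WithLp.toLp 2 q)‖ ^ 2) (-(2 * π)⁻¹), ← e2, ← e1]
  have e4 : ∫ q : ℝ × ℝ, ‖𝓕 g (WithLp.toLp 2 q)‖ ^ 2 = ∫ v, ‖𝓕 g v‖ ^ 2 :=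
    (WithLp.volume_preserving_toLp ℝ ℝ).integral_comp
      (MeasurableEquiv.toLp 2 (ℝ × ℝ)).measurableEmbedding (fun v => ‖𝓕 g v‖ ^ 2)
  rw [e4]
  simp only [Module.finrank_prod, Module.finrank_self, smul_eq_mul]
  congr 1
  rw [show 1 + 1 = 2 from rfl, abs_of_nonneg (by positivity)]
  have := pi_pos
  field_simp

theorem integrable_norm_mul_norm_sq (Φ : SchwartzMap (ℝ × ℝ) ℂ) :
    Integrable (fun ζ => ‖ζ‖ * ‖Φ ζ‖ ^ 2) := by
  have hi1 : Integrable (fun ζ => ‖ζ‖ * ‖Φ ζ‖) := by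
    simpa using Φ.integrable_pow_mul volume 1
  obtain ⟨C, hC⟩ := Φ.decay 0 0
  refine (hi1.const_mul C).mono' (by fun_prop) (Filter.Eventually.of_forall fun ζ => ?_)
  have := hC.2 ζ
  simp only [pow_zero, norm_iteratedFDeriv_zero, one_mul] at this
  rw [norm_of_nonneg (by positivity)]
  nlinarith [mul_nonneg (norm_nonneg ζ) (norm_nonneg (Φ ζ))]

theorem sqrt_integral_UD_half {f : SchwartzMap (ℝ × ℝ) ℂ} {Φ : SchwartzMap (ℝ × ℝ) ℂ}
    (hΦ : FT f = Φ) :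
    √(∫ p : ℝ × ℝ, ‖UD ((1 : ℝ)/2) ⇑f p.1 p.2 0‖ ^ 2) =
      (2 * π)⁻¹ * √(∫ ζ : ℝ × ℝ, ‖ζ‖ * ‖Φ ζ‖ ^ 2) := by
  set w : ℝ × ℝ → ℂ := fun ζ => ((‖ζ‖ ^ ((1 : ℝ)/2) : ℝ) : ℂ) * Φ ζ with hw
  have hcw : Continuous w := by
    refine .mul (Complex.continuous_ofReal.comp ?_) Φ.continuous
    exact continuous_norm.rpow_const (fun _ => Or.inr (by norm_num))
  have hsq : ∀ ζ, ‖w ζ‖ ^ 2 = ‖ζ‖ * ‖Φ ζ‖ ^ 2 := by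
    intro ζ
    rw [hw, norm_mul, mul_pow, Complex.norm_real, norm_of_nonneg (by positivity),
      ← sqrt_eq_rpow, sq_sqrt (norm_nonneg _)]
  have hi0 : Integrable (fun ζ => ‖Φ ζ‖) := Φ.integrable.norm
  have hi1 : Integrable (fun ζ => ‖ζ‖ * ‖Φ ζ‖) := by
    simpa using Φ.integrable_pow_mul volume 1
  have h1 : Integrable w := by
    refine (hi0.add hi1).mono' hcw.aestronglyMeasurable (Filter.Eventually.of_forall fun ζ => ?_)
    rw [hw, norm_mul, Complex.norm_real, norm_of_nonneg (by positivity), ← sqrt_eq_rpow]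
    have : √‖ζ‖ ≤ 1 + ‖ζ‖ := by
      rw [sqrt_le_left (by positivity)]
      nlinarith [norm_nonneg ζ]
    calc _ ≤ (1 + ‖ζ‖) * ‖Φ ζ‖ := by gcongr
      _ = _ := by simp; ring
  have hi2 := integrable_norm_mul_norm_sq Φ
  have h2 : MemLp w 2 := by
    rw [memLp_two_iff_integrable_sq_norm hcw.aestronglyMeasurable]
    simpa only [hsq] using hi2
  have key := integral_norm_sq_integral_mul_exp h1 h2
  have e : ∀ p : ℝ × ℝ, ‖UD ((1 : ℝ)/2) ⇑f p.1 p.2 0‖ ^ 2 = (((2 * π) ^ 2)⁻¹) ^ 2 *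
      ‖∫ ζ : ℝ × ℝ, w ζ *
        Complex.exp (Complex.I * ((ζ.1 * p.1 + ζ.2 * p.2 : ℝ) : ℂ))‖ ^ 2 := by
    intro p
    rw [UD, norm_mul, mul_pow, Complex.norm_real, norm_of_nonneg (by positivity), hΦ]
    congr 3
    refine integral_congr_ae (Filter.Eventually.of_forall fun ζ => ?_)
    simp only [hw, zero_mul, add_zero]
    rw [mul_comm p.1, mul_comm p.2]
    ring
  simp_rw [e]
  rw [integral_const_mul, key]
  simp_rw [hsq]
  rw [← mul_assoc, sqrt_mul (by positivity)]
  congr 1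
  rw [sqrt_eq_iff_mul_self_eq (by positivity) (by positivity)]
  have := pi_pos
  field_simp

end FourierProd

section HardyLittlewoodSobolev

open Set
open scoped ENNReal

theorem lintegral_comp_abs (F : ℝ → ℝ≥0∞) :
    ∫⁻ z, F |z| = 2 * ∫⁻ z in Ioi 0, F z := by
  have h1 : ∫⁻ z in Iic 0, F |z| = ∫⁻ z in Ioi 0, F z := by
    rw [← restrict_Iio_eq_restrict_Iic]
    have mp := (Measure.measurePreserving_neg (volume : Measure ℝ)).restrict_preimage_emb
      (MeasurableEquiv.neg ℝ).measurableEmbedding (Ioi 0)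
    have := mp.lintegral_comp_emb (MeasurableEquiv.neg ℝ).measurableEmbedding F
    rw [← this]
    simp only [neg_preimage, neg_Ioi, neg_zero]
    refine setLIntegral_congr_fun measurableSet_Iio fun z hz => ?_
    rw [abs_of_neg (mem_Iio.1 hz)]
  have h2 : ∫⁻ z in Ioi 0, F |z| = ∫⁻ z in Ioi 0, F z :=
    setLIntegral_congr_fun measurableSet_Ioi fun z hz => by
      rw [abs_of_pos (mem_Ioi.1 hz)]
  rw [← lintegral_add_compl _ (measurableSet_Iic (a := (0 : ℝ))), compl_Iic, h1, h2, two_mul]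

theorem lintegral_ball_enorm_rpow_neg_half {r : ℝ} (hr : 0 < r) :
    ∫⁻ z in {z : ℝ | |z| ≤ r}, ‖z‖ₑ ^ (-(1 / 2) : ℝ) = ENNReal.ofReal (4 * r ^ (1 / 2 : ℝ)) := by
  have hm : MeasurableSet {z : ℝ | |z| ≤ r} := measurableSet_le (by fun_prop) (by fun_prop)
  have e := lintegral_comp_abs ((Iic r).indicator fun z => ‖z‖ₑ ^ (-(1 / 2) : ℝ))
  rw [← lintegral_indicator hm]
  have e1 : ∀ z : ℝ, {z : ℝ | |z| ≤ r}.indicator (fun z => ‖z‖ₑ ^ (-(1 / 2) : ℝ)) z =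
      (Iic r).indicator (fun z => ‖z‖ₑ ^ (-(1 / 2) : ℝ)) |z| := by
    intro z
    by_cases h : |z| ≤ r <;> simp [indicator, h]
  simp_rw [e1]
  rw [e, lintegral_indicator measurableSet_Iic, Measure.restrict_restrict measurableSet_Iic,
    inter_comm, Ioi_inter_Iic]
  have e2 : ∫⁻ z in Ioc 0 r, ‖z‖ₑ ^ (-(1 / 2) : ℝ) =
      ∫⁻ z in Ioc 0 r, ENNReal.ofReal (z ^ (-(1 / 2) : ℝ)) := by
    refine setLIntegral_congr_fun measurableSet_Ioc fun z hz => ?_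
    rw [Real.enorm_eq_ofReal hz.1.le, ENNReal.ofReal_rpow_of_pos hz.1]
  have hint : IntervalIntegrable (fun z : ℝ => z ^ (-(1 / 2) : ℝ)) volume 0 r :=
    intervalIntegral.intervalIntegrable_rpow' (by norm_num)
  rw [e2, ← ofReal_integral_eq_lintegral_ofReal
    ((intervalIntegrable_iff_integrableOn_Ioc_of_le hr.le).1 hint), 
    ← intervalIntegral.integral_of_le hr.le, integral_rpow (Or.inl (by norm_num)),
    show (2 : ℝ≥0∞) = ENNReal.ofReal 2 by simp, ← ENNReal.ofReal_mul (by norm_num)]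
  · congr 1
    norm_num
    ring
  · filter_upwards [ae_restrict_mem measurableSet_Ioc] with z hz
    have := hz.1
    positivity

theorem lintegral_compl_ball_enorm_rpow_neg_half {r : ℝ} (hr : 0 < r) :
    ∫⁻ z in {z : ℝ | r < |z|}, (‖z‖ₑ ^ (-(1 / 2) : ℝ)) ^ (4 : ℝ) = ENNReal.ofReal (2 / r) := by
  have hm : MeasurableSet {z : ℝ | r < |z|} := measurableSet_lt (by fun_prop) (by fun_prop)
  have e := lintegral_comp_abs ((Ioi r).indicator fun z => (‖z‖ₑ ^ (-(1 / 2) : ℝ)) ^ (4 : ℝ))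
  rw [← lintegral_indicator hm]
  have e1 : ∀ z : ℝ, {z : ℝ | r < |z|}.indicator (fun z => (‖z‖ₑ ^ (-(1 / 2) : ℝ)) ^ (4 : ℝ)) z =
      (Ioi r).indicator (fun z => (‖z‖ₑ ^ (-(1 / 2) : ℝ)) ^ (4 : ℝ)) |z| := by
    intro z
    by_cases h : r < |z| <;> simp [indicator, h]
  simp_rw [e1]
  rw [e, lintegral_indicator measurableSet_Ioi, Measure.restrict_restrict measurableSet_Ioi,
    Ioi_inter_Ioi, sup_of_le_left hr.le]
  have e2 : ∫⁻ z in Ioi r, (‖z‖ₑ ^ (-(1 / 2) : ℝ)) ^ (4 : ℝ) =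
      ∫⁻ z in Ioi r, ENNReal.ofReal (z ^ (-2 : ℝ)) := by
    refine setLIntegral_congr_fun measurableSet_Ioi fun z hz => ?_
    have hz' : 0 < z := hr.trans hz
    rw [Real.enorm_eq_ofReal hz'.le, ← ENNReal.rpow_mul, ENNReal.ofReal_rpow_of_pos hz']
    norm_num
  rw [e2, ← ofReal_integral_eq_lintegral_ofReal
    (integrableOn_Ioi_rpow_of_lt (by norm_num) hr), integral_Ioi_rpow_of_lt (by norm_num) hr,
    show (2 : ℝ≥0∞) = ENNReal.ofReal 2 by simp, ← ENNReal.ofReal_mul (by norm_num)]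
  · congr 1
    norm_num [Real.rpow_neg_one]
    ring
  · filter_upwards [ae_restrict_mem measurableSet_Ioi] with z hz
    have := hr.trans hz
    positivity


theorem lintegral_mul_kernel_le_of_le (a : ℝ≥0∞) {g : ℝ → ℝ≥0∞} (hg : Measurable g) (x : ℝ) :
    ∫⁻ y, {y | g y ≤ a}.indicator (fun y => a * g y * ‖x - y‖ₑ ^ (-(1 / 2) : ℝ)) y ≤
      a ^ (4 / 3 : ℝ) * (4 + 2 * (∫⁻ y, g y ^ (4 / 3 : ℝ)) ^ (3 / 4 : ℝ)) := by
  rcases eq_or_ne a 0 with rfl | ha0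
  · simp
  rcases eq_or_ne a ⊤ with rfl | hat
  · rw [ENNReal.top_rpow_of_pos (by norm_num), ENNReal.top_mul (by simp)]
    exact le_top
  set s := a.toReal with hs
  have has : a = ENNReal.ofReal s := (ENNReal.ofReal_toReal hat).symm
  have hs0 : 0 < s := ENNReal.toReal_pos ha0 hat
  set r : ℝ := s ^ (-(4 / 3) : ℝ) with hr
  have hr0 : 0 < r := by positivity
  set N : ℝ → ℝ≥0∞ := {z : ℝ | |z| ≤ r}.indicator (fun z => ‖z‖ₑ ^ (-(1 / 2) : ℝ)) with hN
  set K : ℝ → ℝ≥0∞ := {z : ℝ | r < |z|}.indicator (fun z => ‖z‖ₑ ^ (-(1 / 2) : ℝ)) with hK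
  have hmN : MeasurableSet {z : ℝ | |z| ≤ r} := measurableSet_le (by fun_prop) (by fun_prop)
  have hmK : MeasurableSet {z : ℝ | r < |z|} := measurableSet_lt (by fun_prop) (by fun_prop)
  have hNm : Measurable N := Measurable.indicator (by fun_prop) hmN
  have hKm : Measurable K := Measurable.indicator (by fun_prop) hmK
  have hpt : ∀ y, {y | g y ≤ a}.indicator (fun y => a * g y * ‖x - y‖ₑ ^ (-(1 / 2) : ℝ)) y ≤
      a * a * N (x - y) + a * (g y * K (x - y)) := by
    intro y
    refine indicator_le (s := {y | g y ≤ a}) (g := fun y => a * a * N (x - y) +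
      a * (g y * K (x - y))) (fun y (hy : g y ≤ a) => ?_) y
    rcases le_or_gt |x - y| r with h | h
    · have : N (x - y) = ‖x - y‖ₑ ^ (-(1 / 2) : ℝ) :=
        indicator_of_mem (s := {z : ℝ | |z| ≤ r}) h _
      rw [this]
      refine le_trans ?_ le_self_add
      gcongr
    · have : K (x - y) = ‖x - y‖ₑ ^ (-(1 / 2) : ℝ) :=
        indicator_of_mem (s := {z : ℝ | r < |z|}) h _
      rw [this, ← mul_assoc a]
      exact le_add_self
  have hNint : ∫⁻ y, N (x - y) = ENNReal.ofReal (4 * r ^ (1 / 2 : ℝ)) := by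
    rw [lintegral_sub_left_eq_self, hN, lintegral_indicator hmN,
      lintegral_ball_enorm_rpow_neg_half hr0]
  have hKint : ∫⁻ y, K (x - y) ^ (4 : ℝ) = ENNReal.ofReal (2 / r) := by
    rw [lintegral_sub_left_eq_self (fun z => K z ^ (4 : ℝ)),
      ← lintegral_compl_ball_enorm_rpow_neg_half hr0, ← lintegral_indicator hmK]
    refine lintegral_congr fun z => ?_
    by_cases h : r < |z| <;> simp [hK, indicator, h]
  have hold : ∫⁻ y, g y * K (x - y) ≤ (∫⁻ y, g y ^ (4 / 3 : ℝ)) ^ (3 / 4 : ℝ) *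
      ENNReal.ofReal (2 / r) ^ (1 / 4 : ℝ) := by
    have := ENNReal.lintegral_mul_le_Lp_mul_Lq volume (p := 4 / 3) (q := 4)
      (by rw [Real.holderConjugate_iff]; norm_num) hg.aemeasurable
      (hKm.comp (measurable_const.sub measurable_id : Measurable fun y => x - y)).aemeasurable
    simp only [Pi.mul_apply, Pi.sub_apply, Function.comp_apply] at this
    rw [hKint] at this
    norm_num at this ⊢
    exact this
  set G := (∫⁻ y, g y ^ (4 / 3 : ℝ)) ^ (3 / 4 : ℝ) with hG
  have c1 : a * a * ENNReal.ofReal (4 * r ^ (1 / 2 : ℝ)) = a ^ (4 / 3 : ℝ) * 4 := by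
    rw [has, ← ENNReal.ofReal_mul hs0.le, ← ENNReal.ofReal_mul (by positivity),
      ENNReal.ofReal_rpow_of_pos hs0, show (4 : ℝ≥0∞) = ENNReal.ofReal 4 by simp,
      ← ENNReal.ofReal_mul (by positivity)]
    congr 1
    rw [hr, ← Real.rpow_mul hs0.le]
    have : s * s = s ^ (2 : ℝ) := by rw [Real.rpow_two]; ring
    rw [this, mul_left_comm, ← Real.rpow_add hs0]
    norm_num
    ring
  have c2 : a * ENNReal.ofReal (2 / r) ^ (1 / 4 : ℝ) ≤ a ^ (4 / 3 : ℝ) * 2 := by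
    rw [has, ENNReal.ofReal_rpow_of_pos (by positivity), ← ENNReal.ofReal_mul hs0.le,
      ENNReal.ofReal_rpow_of_pos hs0, show (2 : ℝ≥0∞) = ENNReal.ofReal 2 by simp,
      ← ENNReal.ofReal_mul (by positivity)]
    apply ENNReal.ofReal_le_ofReal
    have h2 : (2 : ℝ) ^ (1 / 4 : ℝ) ≤ 2 := by
      calc (2 : ℝ) ^ (1 / 4 : ℝ) ≤ 2 ^ (1 : ℝ) :=
            Real.rpow_le_rpow_of_exponent_le (by norm_num) (by norm_num)
        _ = 2 := Real.rpow_one 2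
    have h3 : 2 / r = 2 * s ^ (4 / 3 : ℝ) := by
      rw [hr, Real.rpow_neg hs0.le, div_inv_eq_mul]
    rw [h3, Real.mul_rpow (by norm_num) (by positivity), ← Real.rpow_mul hs0.le]
    calc s * (2 ^ (1 / 4 : ℝ) * s ^ (4 / 3 * (1 / 4) : ℝ))
        = (s ^ (1 : ℝ) * s ^ (4 / 3 * (1 / 4) : ℝ)) * 2 ^ (1 / 4 : ℝ) := by
          rw [Real.rpow_one]; ring
      _ = s ^ (4 / 3 : ℝ) * 2 ^ (1 / 4 : ℝ) := by
          rw [← Real.rpow_add hs0]; norm_num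
      _ ≤ _ := by gcongr
  calc _ ≤ ∫⁻ y, (a * a * N (x - y) + a * (g y * K (x - y))) := lintegral_mono hpt
    _ = a * a * ENNReal.ofReal (4 * r ^ (1 / 2 : ℝ)) + a * ∫⁻ y, g y * K (x - y) := by
      rw [lintegral_add_left (by fun_prop), lintegral_const_mul _ (by fun_prop),
        lintegral_const_mul _ (by fun_prop), hNint]
    _ ≤ a ^ (4 / 3 : ℝ) * 4 + a * (G * ENNReal.ofReal (2 / r) ^ (1 / 4 : ℝ)) := by
      rw [c1]; gcongr
    _ = a ^ (4 / 3 : ℝ) * 4 + G * (a * ENNReal.ofReal (2 / r) ^ (1 / 4 : ℝ)) := by ring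
    _ ≤ a ^ (4 / 3 : ℝ) * 4 + G * (a ^ (4 / 3 : ℝ) * 2) := by gcongr
    _ = _ := by ring

theorem lintegral_lintegral_mul_kernel_le_add {f g : ℝ → ℝ≥0∞} (hf : Measurable f)
    (hg : Measurable g) :
    ∫⁻ x, ∫⁻ y, f x * g y * ‖x - y‖ₑ ^ (-(1 / 2) : ℝ) ≤
      (∫⁻ x, f x ^ (4 / 3 : ℝ)) * (4 + 2 * (∫⁻ y, g y ^ (4 / 3 : ℝ)) ^ (3 / 4 : ℝ)) +
      (∫⁻ y, g y ^ (4 / 3 : ℝ)) * (4 + 2 * (∫⁻ x, f x ^ (4 / 3 : ℝ)) ^ (3 / 4 : ℝ)) := by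
  set P : ℝ → ℝ → ℝ≥0∞ := fun x y => {y | g y ≤ f x}.indicator
    (fun y => f x * g y * ‖x - y‖ₑ ^ (-(1 / 2) : ℝ)) y with hP
  set Q : ℝ → ℝ → ℝ≥0∞ := fun y x => {x | f x ≤ g y}.indicator
    (fun x => g y * f x * ‖y - x‖ₑ ^ (-(1 / 2) : ℝ)) x with hQ
  have hPm : Measurable (fun p : ℝ × ℝ => P p.1 p.2) := by
    have : MeasurableSet {p : ℝ × ℝ | g p.2 ≤ f p.1} :=
      measurableSet_le (by fun_prop) (by fun_prop)
    exact Measurable.indicator (f := fun p : ℝ × ℝ => f p.1 * g p.2 *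
      ‖p.1 - p.2‖ₑ ^ (-(1 / 2) : ℝ)) (by fun_prop) this
  have hQm : Measurable (fun p : ℝ × ℝ => Q p.2 p.1) := by
    have : MeasurableSet {p : ℝ × ℝ | f p.1 ≤ g p.2} :=
      measurableSet_le (by fun_prop) (by fun_prop)
    exact Measurable.indicator (f := fun p : ℝ × ℝ => g p.2 * f p.1 *
      ‖p.2 - p.1‖ₑ ^ (-(1 / 2) : ℝ)) (by fun_prop) this
  have hpt : ∀ x y, f x * g y * ‖x - y‖ₑ ^ (-(1 / 2) : ℝ) ≤ P x y + Q y x := by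
    intro x y
    rcases le_total (g y) (f x) with h | h
    · have : P x y = f x * g y * ‖x - y‖ₑ ^ (-(1 / 2) : ℝ) :=
        indicator_of_mem (s := {y | g y ≤ f x}) h _
      rw [this]
      exact le_self_add
    · have : Q y x = g y * f x * ‖y - x‖ₑ ^ (-(1 / 2) : ℝ) :=
        indicator_of_mem (s := {x | f x ≤ g y}) h _
      rw [this, mul_comm (g y), ← enorm_neg (y - x), neg_sub]
      exact le_add_self
  calc _ ≤ ∫⁻ x, ∫⁻ y, (P x y + Q y x) := lintegral_mono fun x => lintegral_mono (hpt x)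
    _ = (∫⁻ x, ∫⁻ y, P x y) + ∫⁻ x, ∫⁻ y, Q y x := by
      have : ∀ x, Measurable (P x) := fun x =>
        hPm.comp (measurable_const.prodMk measurable_id : Measurable fun y => (x, y))
      rw [← lintegral_add_left hPm.lintegral_prod_right']
      exact lintegral_congr fun x => lintegral_add_left (this x) _
    _ = (∫⁻ x, ∫⁻ y, P x y) + ∫⁻ y, ∫⁻ x, Q y x := by
      rw [lintegral_lintegral_swap (f := fun x y => Q y x) hQm.aemeasurable]
    _ ≤ (∫⁻ x, f x ^ (4 / 3 : ℝ) * (4 + 2 * (∫⁻ y, g y ^ (4 / 3 : ℝ)) ^ (3 / 4 : ℝ))) +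
        ∫⁻ y, g y ^ (4 / 3 : ℝ) * (4 + 2 * (∫⁻ x, f x ^ (4 / 3 : ℝ)) ^ (3 / 4 : ℝ)) :=
      add_le_add (lintegral_mono fun x => lintegral_mul_kernel_le_of_le _ hg x)
        (lintegral_mono fun y => lintegral_mul_kernel_le_of_le _ hf y)
    _ = _ := by
      rw [lintegral_mul_const _ (by fun_prop), lintegral_mul_const _ (by fun_prop)]

/-- The Hardy-Littlewood-Sobolev inequality on `ℝ` with kernel `|x|^{-1/2}`, in its
self-dual `L^{4/3}` bilinear form. -/
theorem hardyLittlewoodSobolev_four_thirds {f g : ℝ → ℝ≥0∞} (hf : Measurable f)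
    (hg : Measurable g) :
    ∫⁻ x, ∫⁻ y, f x * g y * ‖x - y‖ₑ ^ (-(1 / 2) : ℝ) ≤
      12 * (∫⁻ x, f x ^ (4 / 3 : ℝ)) ^ (3 / 4 : ℝ) * (∫⁻ y, g y ^ (4 / 3 : ℝ)) ^ (3 / 4 : ℝ) := by
  set A := (∫⁻ x, f x ^ (4 / 3 : ℝ)) ^ (3 / 4 : ℝ) with hA
  set B := (∫⁻ y, g y ^ (4 / 3 : ℝ)) ^ (3 / 4 : ℝ) with hB
  have hzero : ∀ {h : ℝ → ℝ≥0∞}, Measurable h →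
      (∫⁻ x, h x ^ (4 / 3 : ℝ)) ^ (3 / 4 : ℝ) = 0 → ∀ᵐ x, h x = 0 := by
    intro h hm h0
    rw [ENNReal.rpow_eq_zero_iff_of_pos (by norm_num), lintegral_eq_zero_iff (by fun_prop)] at h0
    filter_upwards [h0] with x hx
    exact (ENNReal.rpow_eq_zero_iff_of_pos (by norm_num)).1 hx
  have hnorm : ∀ {h : ℝ → ℝ≥0∞} {D : ℝ≥0∞}, Measurable h → D ≠ 0 → D ≠ ⊤ →
      (∫⁻ x, h x ^ (4 / 3 : ℝ)) ^ (3 / 4 : ℝ) = D →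
      ∫⁻ x, (D⁻¹ * h x) ^ (4 / 3 : ℝ) = 1 := by
    intro h D hm h0 ht hD
    simp_rw [ENNReal.mul_rpow_of_nonneg _ _ (show (0 : ℝ) ≤ 4 / 3 by norm_num)]
    rw [lintegral_const_mul _ (by fun_prop)]
    have : ∫⁻ x, h x ^ (4 / 3 : ℝ) = D ^ (4 / 3 : ℝ) := by
      rw [← hD, ← ENNReal.rpow_mul]; norm_num
    rw [this, ← ENNReal.mul_rpow_of_nonneg _ _ (by norm_num), ENNReal.inv_mul_cancel h0 ht,
      ENNReal.one_rpow]
  rcases eq_or_ne A 0 with hA0 | hA0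
  · refine le_of_eq_of_le ?_ zero_le
    rw [lintegral_eq_zero_iff' (by fun_prop)]
    filter_upwards [hzero hf hA0] with x hx
    simp [hx]
  rcases eq_or_ne B 0 with hB0 | hB0
  · refine le_of_eq_of_le ?_ zero_le
    rw [← lintegral_zero (μ := (volume : Measure ℝ))]
    refine lintegral_congr fun x => ?_
    rw [lintegral_eq_zero_iff' (by fun_prop)]
    filter_upwards [hzero hg hB0] with y hy
    simp [hy]
  rcases eq_or_ne A ⊤ with hAt | hAt
  · rw [hAt, ENNReal.mul_top (by norm_num), ENNReal.top_mul hB0]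
    exact le_top
  rcases eq_or_ne B ⊤ with hBt | hBt
  · rw [hBt, ENNReal.mul_top (by simp [hA0])]
    exact le_top
  have key := lintegral_lintegral_mul_kernel_le_add (hf.const_mul A⁻¹) (hg.const_mul B⁻¹)
  rw [hnorm hf hA0 hAt hA.symm, hnorm hg hB0 hBt hB.symm] at key
  have e : ∀ x y, f x * g y * ‖x - y‖ₑ ^ (-(1 / 2) : ℝ) =
      (A * B) * (A⁻¹ * f x * (B⁻¹ * g y) * ‖x - y‖ₑ ^ (-(1 / 2) : ℝ)) := by
    intro x y
    calc _ = (A * A⁻¹) * (B * B⁻¹) * (f x * g y * ‖x - y‖ₑ ^ (-(1 / 2) : ℝ)) := by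
          rw [ENNReal.mul_inv_cancel hA0 hAt, ENNReal.mul_inv_cancel hB0 hBt, one_mul, one_mul]
      _ = _ := by ring
  simp_rw [e]
  have hAB : A * B ≠ ⊤ := ENNReal.mul_ne_top hAt hBt
  simp_rw [lintegral_const_mul' _ _ hAB]
  calc _ ≤ A * B * (1 * (4 + 2 * 1 ^ (3 / 4 : ℝ)) + 1 * (4 + 2 * 1 ^ (3 / 4 : ℝ))) := by gcongr
    _ = _ := by
      rw [ENNReal.one_rpow, mul_assoc 12, mul_comm 12]
      norm_num

end HardyLittlewoodSobolev

section HardyLittlewoodSobolevProd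

open scoped ENNReal

theorem hardyLittlewoodSobolev_prod {h : ℝ × ℝ → ℝ≥0∞} (hh : Measurable h) :
    ∫⁻ p : ℝ × ℝ, ∫⁻ q : ℝ × ℝ,
      h p * h q * (‖p.1 - q.1‖ₑ ^ (-(1 / 2) : ℝ) * ‖p.2 - q.2‖ₑ ^ (-(1 / 2) : ℝ)) ≤
      144 * (∫⁻ p, h p ^ (4 / 3 : ℝ)) ^ (3 / 2 : ℝ) := by
  set H : ℝ → ℝ≥0∞ := fun x => (∫⁻ y, h (x, y) ^ (4 / 3 : ℝ)) ^ (3 / 4 : ℝ) with hH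
  have hHm : Measurable H := by
    have : Measurable fun p : ℝ × ℝ => h p ^ (4 / 3 : ℝ) := by fun_prop
    exact (this.lintegral_prod_right').pow_const _
  have hHint : ∫⁻ x, H x ^ (4 / 3 : ℝ) = ∫⁻ p, h p ^ (4 / 3 : ℝ) := by
    rw [Measure.volume_eq_prod, lintegral_prod _ (by fun_prop)]
    refine lintegral_congr fun x => ?_
    rw [hH, ← ENNReal.rpow_mul]
    norm_num
  have e1 : ∀ p : ℝ × ℝ, ∫⁻ q : ℝ × ℝ,
      h p * h q * (‖p.1 - q.1‖ₑ ^ (-(1 / 2) : ℝ) * ‖p.2 - q.2‖ₑ ^ (-(1 / 2) : ℝ)) =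
      ∫⁻ x', ∫⁻ y', h p * h (x', y') *
        (‖p.1 - x'‖ₑ ^ (-(1 / 2) : ℝ) * ‖p.2 - y'‖ₑ ^ (-(1 / 2) : ℝ)) := by
    intro p
    rw [Measure.volume_eq_prod, lintegral_prod _ (by fun_prop)]
  simp_rw [e1]
  rw [Measure.volume_eq_prod, lintegral_prod _ (by
    have : Measurable fun z : (ℝ × ℝ) × ℝ × ℝ => h z.1 * h z.2 *
      (‖z.1.1 - z.2.1‖ₑ ^ (-(1 / 2) : ℝ) * ‖z.1.2 - z.2.2‖ₑ ^ (-(1 / 2) : ℝ)) := by fun_prop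
    have := this.lintegral_prod_right' (ν := volume)
    exact this.aemeasurable.congr (Filter.Eventually.of_forall e1))]
  calc _ = ∫⁻ x, ∫⁻ x', ∫⁻ y, ∫⁻ y', h (x, y) * h (x', y') *
        (‖x - x'‖ₑ ^ (-(1 / 2) : ℝ) * ‖y - y'‖ₑ ^ (-(1 / 2) : ℝ)) := by
        refine lintegral_congr fun x => ?_
        refine lintegral_lintegral_swap (f := fun y x' => ∫⁻ y', h (x, y) * h (x', y') *
          (‖x - x'‖ₑ ^ (-(1 / 2) : ℝ) * ‖y - y'‖ₑ ^ (-(1 / 2) : ℝ))) ?_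
        have : Measurable fun z : (ℝ × ℝ) × ℝ => h (x, z.1.1) * h (z.1.2, z.2) *
          (‖x - z.1.2‖ₑ ^ (-(1 / 2) : ℝ) * ‖z.1.1 - z.2‖ₑ ^ (-(1 / 2) : ℝ)) := by fun_prop
        exact (this.lintegral_prod_right').aemeasurable
    _ ≤ ∫⁻ x, ∫⁻ x', 12 * (H x * H x' * ‖x - x'‖ₑ ^ (-(1 / 2) : ℝ)) := by
        refine lintegral_mono fun x => lintegral_mono fun x' => ?_
        have m1 : Measurable fun y => h (x, y) := by fun_prop
        have m2 : Measurable fun y => h (x', y) := by fun_prop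
        have e2 : ∀ y y', h (x, y) * h (x', y') *
            (‖x - x'‖ₑ ^ (-(1 / 2) : ℝ) * ‖y - y'‖ₑ ^ (-(1 / 2) : ℝ)) =
            ‖x - x'‖ₑ ^ (-(1 / 2) : ℝ) *
              (h (x, y) * h (x', y') * ‖y - y'‖ₑ ^ (-(1 / 2) : ℝ)) := by
          intro y y'; ring
        simp_rw [e2]
        have m3 : ∀ y, Measurable fun y' =>
            h (x, y) * h (x', y') * ‖y - y'‖ₑ ^ (-(1 / 2) : ℝ) := by fun_prop
        rw [lintegral_congr fun y => lintegral_const_mul (‖x - x'‖ₑ ^ (-(1 / 2) : ℝ)) (m3 y)]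
        have m4 : Measurable fun z : ℝ × ℝ =>
            h (x, z.1) * h (x', z.2) * ‖z.1 - z.2‖ₑ ^ (-(1 / 2) : ℝ) := by fun_prop
        rw [lintegral_const_mul _ m4.lintegral_prod_right']
        calc _ ≤ ‖x - x'‖ₑ ^ (-(1 / 2) : ℝ) * (12 * H x * H x') := by
              gcongr
              exact hardyLittlewoodSobolev_four_thirds m1 m2
          _ = _ := by ring
    _ = 12 * ∫⁻ x, ∫⁻ x', H x * H x' * ‖x - x'‖ₑ ^ (-(1 / 2) : ℝ) := by
        simp_rw [lintegral_const_mul' (12 : ℝ≥0∞) _ (by norm_num)]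
    _ ≤ 12 * (12 * (∫⁻ x, H x ^ (4 / 3 : ℝ)) ^ (3 / 4 : ℝ) *
          (∫⁻ x, H x ^ (4 / 3 : ℝ)) ^ (3 / 4 : ℝ)) := by
        gcongr
        exact hardyLittlewoodSobolev_four_thirds hHm hHm
    _ = _ := by
        rw [hHint, mul_assoc, ← ENNReal.rpow_add_of_nonneg _ _ (by norm_num) (by norm_num),
          ← mul_assoc]
        norm_num
        rfl

end HardyLittlewoodSobolevProd

section Oscillatory

open Set Complex intervalIntegral
open scoped ENNReal Interval

/-- First derivative test of van der Corput. -/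
theorem norm_integral_exp_le_of_le_abs_deriv {φ φ' φ'' : ℝ → ℝ} {a b l : ℝ} (hab : a ≤ b)
    (hl : 0 < l) (h1 : ∀ s, HasDerivAt φ (φ' s) s) (h2 : ∀ s, HasDerivAt φ' (φ'' s) s)
    (hc : Continuous φ'') (hle : ∀ s ∈ Icc a b, l ≤ |φ' s|)
    (hsign : (∀ s ∈ Icc a b, 0 ≤ φ'' s) ∨ ∀ s ∈ Icc a b, φ'' s ≤ 0) :
    ‖∫ s in a..b, exp (I * φ s)‖ ≤ 4 / l := by
  have hne : ∀ s ∈ Icc a b, φ' s ≠ 0 := fun s hs h => by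
    have := hle s hs
    rw [h, abs_zero] at this
    linarith
  have hφc : Continuous φ := continuous_iff_continuousAt.2 fun s => (h1 s).continuousAt
  have hφ'c : Continuous φ' := continuous_iff_continuousAt.2 fun s => (h2 s).continuousAt
  have hu : ∀ s ∈ Icc a b, HasDerivAt (fun s => (φ' s)⁻¹) (-φ'' s / φ' s ^ 2) s :=
    fun s hs => (h2 s).inv (hne s hs)
  have huc : ContinuousOn (fun s => -φ'' s / φ' s ^ 2) (Icc a b) :=
    hc.neg.continuousOn.div (hφ'c.pow 2).continuousOn fun s hs => pow_ne_zero _ (hne s hs)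
  have hui : IntervalIntegrable (fun s => -φ'' s / φ' s ^ 2) volume a b :=
    ContinuousOn.intervalIntegrable (by rwa [uIcc_of_le hab])
  have hinv : ∀ s ∈ Icc a b, |(φ' s)⁻¹| ≤ 1 / l := by
    intro s hs
    rw [abs_inv, ← one_div]
    exact one_div_le_one_div_of_le hl (hle s hs)
  have ha := hinv a (left_mem_Icc.2 hab)
  have hb := hinv b (right_mem_Icc.2 hab)
  have htot : ∫ s in a..b, |-φ'' s / φ' s ^ 2| ≤ 2 / l := by
    have ftc : ∫ s in a..b, -φ'' s / φ' s ^ 2 = (φ' b)⁻¹ - (φ' a)⁻¹ :=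
      integral_eq_sub_of_hasDerivAt (fun s hs => hu s (by rwa [uIcc_of_le hab] at hs)) hui
    have h2l : 2 / l = 1 / l + 1 / l := by ring
    rw [abs_le] at ha hb
    rcases hsign with hs | hs
    · have : ∫ s in a..b, |-φ'' s / φ' s ^ 2| = ∫ s in a..b, -(-φ'' s / φ' s ^ 2) := by
        refine integral_congr fun s hs' => ?_
        rw [uIcc_of_le hab] at hs'
        have := hs s hs'
        exact abs_of_nonpos (div_nonpos_of_nonpos_of_nonneg (by linarith) (by positivity))
      rw [this, intervalIntegral.integral_neg, ftc, h2l]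
      linarith [ha.1, ha.2, hb.1, hb.2]
    · have : ∫ s in a..b, |-φ'' s / φ' s ^ 2| = ∫ s in a..b, -φ'' s / φ' s ^ 2 := by
        refine integral_congr fun s hs' => ?_
        rw [uIcc_of_le hab] at hs'
        have := hs s hs'
        exact abs_of_nonneg (div_nonneg (by linarith) (by positivity))
      rw [this, ftc, h2l]
      linarith [ha.1, ha.2, hb.1, hb.2]
  have hv : ∀ s, HasDerivAt (fun s => -I * exp (I * φ s)) (φ' s * exp (I * φ s)) s := by
    intro s
    have := (((h1 s).ofReal_comp.const_mul I).cexp).const_mul (-I)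
    convert! this using 1
    linear_combination (φ' s * exp (I * φ s)) * I_mul_I
  have parts := integral_mul_deriv_eq_deriv_mul
    (u := fun s => (((φ' s)⁻¹ : ℝ) : ℂ)) (u' := fun s => ((-φ'' s / φ' s ^ 2 : ℝ) : ℂ))
    (v := fun s => -I * exp (I * φ s)) (v' := fun s => φ' s * exp (I * φ s)) (a := a) (b := b)
    (fun s hs => (hu s (by rwa [uIcc_of_le hab] at hs)).ofReal_comp) (fun s _ => hv s)
    ⟨hui.1.ofReal, hui.2.ofReal⟩ (Continuous.intervalIntegrable (by fun_prop) _ _)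
  have e : ∫ s in a..b, exp (I * φ s) =
      ∫ s in a..b, (((φ' s)⁻¹ : ℝ) : ℂ) * (φ' s * exp (I * φ s)) := by
    refine integral_congr fun s hs => ?_
    rw [uIcc_of_le hab] at hs
    have : (φ' s : ℂ) ≠ 0 := by exact_mod_cast hne s hs
    simp only [ofReal_inv]
    field_simp
  have hnorm : ∀ s : ℝ, ‖-I * exp (I * φ s)‖ = 1 := by
    intro s
    rw [norm_mul, mul_comm I, norm_exp_ofReal_mul_I]
    simp
  have hrem : ‖∫ s in a..b, ((-φ'' s / φ' s ^ 2 : ℝ) : ℂ) * (-I * exp (I * φ s))‖ ≤ 2 / l := by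
    refine (intervalIntegral.norm_integral_le_integral_norm hab).trans (le_of_eq_of_le ?_ htot)
    refine integral_congr fun s _ => ?_
    rw [norm_mul, hnorm, mul_one, norm_real, Real.norm_eq_abs]
  rw [e, parts]
  have t1 : ‖(((φ' b)⁻¹ : ℝ) : ℂ) * (-I * exp (I * φ b))‖ ≤ 1 / l := by
    rw [norm_mul, hnorm, mul_one, norm_real, Real.norm_eq_abs]; exact hb
  have t2 : ‖(((φ' a)⁻¹ : ℝ) : ℂ) * (-I * exp (I * φ a))‖ ≤ 1 / l := by
    rw [norm_mul, hnorm, mul_one, norm_real, Real.norm_eq_abs]; exact ha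
  calc _ ≤ 1 / l + 1 / l + 2 / l :=
        (norm_sub_le _ _).trans (add_le_add ((norm_sub_le _ _).trans (add_le_add t1 t2)) hrem)
    _ = 4 / l := by ring

theorem norm_integral_rpow_neg_half_mul_le {e : ℝ → ℂ} (he : Continuous e) {a b M : ℝ}
    (ha : 0 < a) (hab : a ≤ b) (hM : ∀ v ∈ Icc a b, ‖∫ s in a..v, e s‖ ≤ M) :
    ‖∫ s in a..b, ((s ^ (-(1 / 2) : ℝ) : ℝ) : ℂ) * e s‖ ≤ a ^ (-(1 / 2) : ℝ) * M := by
  have hpos : ∀ s ∈ Icc a b, 0 < s := fun s hs => ha.trans_le hs.1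
  set u' : ℝ → ℝ := fun s => (-(1 / 2) : ℝ) * s ^ ((-(1 / 2) : ℝ) - 1) with hu'
  have hu : ∀ s ∈ Icc a b, HasDerivAt (fun s : ℝ => s ^ (-(1 / 2) : ℝ)) (u' s) s := fun s hs =>
    Real.hasDerivAt_rpow_const (Or.inl (hpos s hs).ne')
  have huc : ContinuousOn u' (Icc a b) := by
    refine continuousOn_const.mul ?_
    exact continuousOn_id.rpow_const fun s hs => Or.inl (hpos s hs).ne'
  have hui : IntervalIntegrable u' volume a b :=
    ContinuousOn.intervalIntegrable (by rwa [uIcc_of_le hab])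
  have hv : ∀ s, HasDerivAt (fun v => ∫ s in a..v, e s) (e s) s := fun s =>
    integral_hasDerivAt_right (he.intervalIntegrable _ _)
      (he.stronglyMeasurableAtFilter _ _) he.continuousAt
  have parts := integral_mul_deriv_eq_deriv_mul
    (u := fun s : ℝ => ((s ^ (-(1 / 2) : ℝ) : ℝ) : ℂ)) (u' := fun s => ((u' s : ℝ) : ℂ))
    (v := fun v => ∫ s in a..v, e s) (v' := e) (a := a) (b := b)
    (fun s hs => (hu s (by rwa [uIcc_of_le hab] at hs)).ofReal_comp) (fun s _ => hv s)
    ⟨hui.1.ofReal, hui.2.ofReal⟩ (he.intervalIntegrable _ _)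
  have ftc : ∫ s in a..b, u' s = b ^ (-(1 / 2) : ℝ) - a ^ (-(1 / 2) : ℝ) :=
    integral_eq_sub_of_hasDerivAt (fun s hs => hu s (by rwa [uIcc_of_le hab] at hs)) hui
  have hM0 : 0 ≤ M := (norm_nonneg _).trans (hM a (left_mem_Icc.2 hab))
  have hrem : ‖∫ s in a..b, ((u' s : ℝ) : ℂ) * ∫ s in a..s, e s‖ ≤
      ∫ s in a..b, -u' s * M := by
    refine norm_integral_le_of_norm_le hab ?_ (hui.neg.mul_const M)
    refine Filter.Eventually.of_forall fun s hs => ?_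
    have hs' : s ∈ Icc a b := Ioc_subset_Icc_self hs
    have hneg : u' s ≤ 0 := by
      have := hpos s hs'
      exact mul_nonpos_of_nonpos_of_nonneg (by norm_num) (by positivity)
    rw [norm_mul, norm_real, Real.norm_eq_abs, abs_of_nonpos hneg]
    exact mul_le_mul_of_nonneg_left (hM s hs') (by linarith)
  rw [intervalIntegral.integral_mul_const, intervalIntegral.integral_neg, ftc] at hrem
  rw [parts, integral_same, mul_zero, sub_zero]
  have hb : 0 < b := ha.trans_le hab
  have t1 : ‖((b ^ (-(1 / 2) : ℝ) : ℝ) : ℂ) * ∫ s in a..b, e s‖ ≤ b ^ (-(1 / 2) : ℝ) * M := by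
    rw [norm_mul, norm_real, Real.norm_eq_abs, abs_of_nonneg (by positivity)]
    have := hM b (right_mem_Icc.2 hab)
    gcongr
  calc _ ≤ _ := norm_sub_le _ _
    _ ≤ _ := add_le_add t1 hrem
    _ = _ := by ring

/-- The integrand of the Airy-type oscillatory integral, with phase `s + τ s³`. -/
noncomputable def airyIntegrand (τ s : ℝ) : ℂ :=
  ((s ^ (-(1 / 2) : ℝ) : ℝ) : ℂ) * exp (I * ((s + τ * s ^ 3 : ℝ) : ℂ))

theorem norm_airyIntegrand (τ : ℝ) {s : ℝ} (hs : 0 ≤ s) :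
    ‖airyIntegrand τ s‖ = s ^ (-(1 / 2) : ℝ) := by
  rw [airyIntegrand, norm_mul, mul_comm I, norm_exp_ofReal_mul_I, mul_one, norm_real,
    Real.norm_eq_abs, abs_of_nonneg (by positivity)]

theorem intervalIntegrable_airyIntegrand (τ a b : ℝ) :
    IntervalIntegrable (airyIntegrand τ) volume a b := by
  have h : IntervalIntegrable (fun s : ℝ => s ^ (-(1 / 2) : ℝ)) volume a b :=
    intervalIntegral.intervalIntegrable_rpow' (by norm_num)
  have h' : IntervalIntegrable (fun s : ℝ => ((s ^ (-(1 / 2) : ℝ) : ℝ) : ℂ)) volume a b :=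
    ⟨h.1.ofReal, h.2.ofReal⟩
  exact h'.mul_continuousOn (by fun_prop)

theorem norm_integral_airyIntegrand_le_of_le_deriv {τ a b l : ℝ} (ha : 0 < a) (hl : 0 < l)
    (hle : ∀ s ∈ Icc a b, l ≤ |1 + 3 * τ * s ^ 2|) {v : ℝ} (hv : v ∈ Icc a b) :
    ‖∫ s in a..v, airyIntegrand τ s‖ ≤ a ^ (-(1 / 2) : ℝ) * (4 / l) := by
  refine norm_integral_rpow_neg_half_mul_le (by fun_prop) ha hv.1 fun w hw => ?_
  refine norm_integral_exp_le_of_le_abs_deriv (φ := fun s => s + τ * s ^ 3)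
    (φ' := fun s => 1 + 3 * τ * s ^ 2) (φ'' := fun s => 6 * τ * s) hw.1 hl
    (fun s => ?_) (fun s => ?_) (by fun_prop)
    (fun s hs => hle s ⟨hs.1, hs.2.trans (hw.2.trans hv.2)⟩) ?_
  · have := (hasDerivAt_id s).add ((hasDerivAt_pow 3 s).const_mul τ)
    convert! this using 1
    push_cast; ring
  · have := ((hasDerivAt_pow 2 s).const_mul (3 * τ)).const_add 1
    convert! this using 1
    push_cast; ring
  · rcases le_total 0 τ with h | h
    · exact Or.inl fun s hs => by have := ha.trans_le hs.1; positivity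
    · exact Or.inr fun s hs => by nlinarith [ha.trans_le hs.1]

theorem norm_integral_airyIntegrand_le_trivial {τ b v : ℝ} (hv : v ∈ Icc 0 b) :
    ‖∫ s in (0 : ℝ)..v, airyIntegrand τ s‖ ≤ 2 * √b := by
  calc _ ≤ ∫ s in (0 : ℝ)..v, ‖airyIntegrand τ s‖ :=
        intervalIntegral.norm_integral_le_integral_norm hv.1
    _ = ∫ s in (0 : ℝ)..v, s ^ (-(1 / 2) : ℝ) := by
      refine integral_congr fun s hs => ?_
      rw [uIcc_of_le hv.1] at hs
      exact norm_airyIntegrand τ hs.1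
    _ = 2 * √v := by
      rw [integral_rpow (Or.inl (by norm_num)), Real.sqrt_eq_rpow]
      norm_num
      ring
    _ ≤ _ := by
      have := Real.sqrt_le_sqrt hv.2
      linarith

theorem norm_integral_airyIntegrand_le_length {τ a b v : ℝ} (ha : 0 < a) (hv : v ∈ Icc a b) :
    ‖∫ s in a..v, airyIntegrand τ s‖ ≤ a ^ (-(1 / 2) : ℝ) * (b - a) := by
  calc _ ≤ a ^ (-(1 / 2) : ℝ) * |v - a| := by
        refine norm_integral_le_of_norm_le_const fun s hs => ?_
        rw [uIoc_of_le hv.1] at hs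
        rw [norm_airyIntegrand τ (ha.trans hs.1).le]
        exact Real.rpow_le_rpow_of_nonpos ha hs.1.le (by norm_num)
    _ ≤ _ := by
        rw [abs_of_nonneg (by linarith [hv.1])]
        have := hv.2
        gcongr

theorem norm_integral_airyIntegrand_le_add {τ l m r C₁ C₂ : ℝ} (hmr : m ≤ r)
    (h₁ : ∀ v ∈ Icc l m, ‖∫ s in l..v, airyIntegrand τ s‖ ≤ C₁)
    (h₂ : ∀ v ∈ Icc m r, ‖∫ s in m..v, airyIntegrand τ s‖ ≤ C₂) (hlm : l ≤ m) :
    ∀ v ∈ Icc l r, ‖∫ s in l..v, airyIntegrand τ s‖ ≤ C₁ + C₂ := by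
  intro v hv
  have hC₂ : 0 ≤ C₂ := (norm_nonneg _).trans (h₂ m ⟨le_rfl, hmr⟩)
  rcases le_total v m with h | h
  · linarith [h₁ v ⟨hv.1, h⟩]
  · rw [← integral_add_adjacent_intervals (intervalIntegrable_airyIntegrand τ l m)
      (intervalIntegrable_airyIntegrand τ m v)]
    exact (norm_add_le _ _).trans (add_le_add (h₁ m ⟨hlm, le_rfl⟩) (h₂ v ⟨h, hv.2⟩))

theorem norm_integral_airyIntegrand_le_of_critical_large {d N : ℝ} (hd : 2 ≤ d) (hN : 0 ≤ N) :
    ‖∫ s in (0 : ℝ)..N, airyIntegrand (-(1 / (3 * d ^ 4))) s‖ ≤ 24 := by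
  set τ := -(1 / (3 * d ^ 4)) with hτ
  have hd0 : 0 < d := by linarith
  have hdd : 2 * d ≤ d ^ 2 := by nlinarith
  have hder : ∀ s, 1 + 3 * τ * s ^ 2 = (d ^ 4 - s ^ 2) / d ^ 4 := by
    intro s
    rw [hτ]
    field_simp
    ring
  have hroot : (d ^ 2 / 2) ^ (-(1 / 2) : ℝ) ≤ 3 / 2 / d := by
    rw [Real.rpow_neg (by positivity), ← Real.sqrt_eq_rpow, inv_le_comm₀ (by positivity)
      (by positivity)]
    apply Real.le_sqrt_of_sq_le
    field_simp
    norm_num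
  have b1 : ∀ v ∈ Icc 0 1, ‖∫ s in (0 : ℝ)..v, airyIntegrand τ s‖ ≤ 2 := fun v hv => by
    simpa using norm_integral_airyIntegrand_le_trivial (τ := τ) hv
  have b2 : ∀ v ∈ Icc 1 (d ^ 2 / 2), ‖∫ s in (1 : ℝ)..v, airyIntegrand τ s‖ ≤ 6 := fun v hv => by
    have := norm_integral_airyIntegrand_le_of_le_deriv (τ := τ) (a := 1) (b := d ^ 2 / 2)
      (l := 3 / 4) one_pos (by norm_num) (fun s hs => ?_) hv
    · refine this.trans ?_
      norm_num
    · rw [hder]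
      refine le_trans ?_ (le_abs_self _)
      rw [le_div_iff₀ (by positivity)]
      nlinarith [hs.1, hs.2]
  have b3 : ∀ v ∈ Icc (d ^ 2 / 2) (d ^ 2 - d),
      ‖∫ s in (d ^ 2 / 2)..v, airyIntegrand τ s‖ ≤ 6 := fun v hv => by
    have := norm_integral_airyIntegrand_le_of_le_deriv (τ := τ) (a := d ^ 2 / 2) (b := d ^ 2 - d)
      (l := 1 / d) (by positivity) (by positivity) (fun s hs => ?_) hv
    · refine this.trans ?_
      calc _ ≤ 3 / 2 / d * (4 / (1 / d)) := by gcongr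
        _ = 6 := by field_simp; norm_num
    · rw [hder]
      refine le_trans ?_ (le_abs_self _)
      rw [le_div_iff₀ (by positivity)]
      have h0 : 0 < s := lt_of_lt_of_le (by positivity) hs.1
      have h1 : s ^ 2 ≤ (d ^ 2 - d) ^ 2 := pow_le_pow_left₀ h0.le hs.2 2
      have h2 : 1 / d * d ^ 4 = d ^ 3 := by field_simp
      rw [h2]
      nlinarith [pow_pos hd0 2]
  have b4 : ∀ v ∈ Icc (d ^ 2 - d) (d ^ 2 + d),
      ‖∫ s in (d ^ 2 - d)..v, airyIntegrand τ s‖ ≤ 3 := fun v hv => by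
    refine (norm_integral_airyIntegrand_le_length (by nlinarith) hv).trans ?_
    calc _ ≤ (d ^ 2 / 2) ^ (-(1 / 2) : ℝ) * (d ^ 2 + d - (d ^ 2 - d)) := by
          refine mul_le_mul_of_nonneg_right ?_ (by linarith)
          exact Real.rpow_le_rpow_of_nonpos (by positivity) (by linarith) (by norm_num)
      _ ≤ 3 / 2 / d * (d ^ 2 + d - (d ^ 2 - d)) :=
          mul_le_mul_of_nonneg_right hroot (by linarith)
      _ = 3 := by field_simp; ring
  have b5 : ∀ v ∈ Icc (d ^ 2 + d) (max N (d ^ 2 + d)),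
      ‖∫ s in (d ^ 2 + d)..v, airyIntegrand τ s‖ ≤ 6 := fun v hv => by
    have := norm_integral_airyIntegrand_le_of_le_deriv (τ := τ) (a := d ^ 2 + d)
      (b := max N (d ^ 2 + d))
      (l := 1 / d) (by positivity) (by positivity) (fun s hs => ?_) hv
    · refine this.trans ?_
      calc _ ≤ (d ^ 2 / 2) ^ (-(1 / 2) : ℝ) * (4 / (1 / d)) := by
            refine mul_le_mul_of_nonneg_right ?_ (by positivity)
            exact Real.rpow_le_rpow_of_nonpos (by positivity) (by nlinarith) (by norm_num)
        _ ≤ 3 / 2 / d * (4 / (1 / d)) := by gcongr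
        _ = 6 := by field_simp; norm_num
    · rw [hder]
      refine le_trans ?_ (neg_le_abs _)
      rw [← neg_div, le_div_iff₀ (by positivity)]
      have h1 : (d ^ 2 + d) ^ 2 ≤ s ^ 2 := pow_le_pow_left₀ (by positivity) hs.1 2
      have h2 : 1 / d * d ^ 4 = d ^ 3 := by field_simp
      rw [h2]
      nlinarith [pow_pos hd0 2, pow_pos hd0 3]
  have c1 := norm_integral_airyIntegrand_le_add (by nlinarith) b1 b2 zero_le_one
  have c2 := norm_integral_airyIntegrand_le_add (by nlinarith) c1 b3 (by positivity)
  have c3 := norm_integral_airyIntegrand_le_add (by linarith) c2 b4 (by nlinarith)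
  have c4 := norm_integral_airyIntegrand_le_add (le_max_right _ _) c3 b5 (by positivity)
  exact (c4 N ⟨hN, le_max_left _ _⟩).trans (by norm_num)

theorem norm_integral_airyIntegrand_le (τ : ℝ) {N : ℝ} (hN : 0 ≤ N) :
    ‖∫ s in (0 : ℝ)..N, airyIntegrand τ s‖ ≤ 24 := by
  rcases le_or_gt 0 τ with h | h
  · have b1 : ∀ v ∈ Icc 0 1, ‖∫ s in (0 : ℝ)..v, airyIntegrand τ s‖ ≤ 2 := fun v hv => by
      simpa using norm_integral_airyIntegrand_le_trivial (τ := τ) hv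
    have b2 : ∀ v ∈ Icc 1 (max N 1), ‖∫ s in (1 : ℝ)..v, airyIntegrand τ s‖ ≤ 4 := fun v hv => by
      have := norm_integral_airyIntegrand_le_of_le_deriv (τ := τ) (a := 1) (b := max N 1)
        (l := 1) one_pos one_pos (fun s _ => ?_) hv
      · simpa using this
      · exact le_trans (by nlinarith [mul_nonneg h (sq_nonneg s)]) (le_abs_self _)
    have c1 := norm_integral_airyIntegrand_le_add (le_max_right _ _) b1 b2 zero_le_one
    exact (c1 N ⟨hN, le_max_left _ _⟩).trans (by norm_num)
  set d : ℝ := (1 / (-(3 * τ))) ^ (1 / 4 : ℝ) with hd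
  have hpos : 0 < 1 / (-(3 * τ)) := by
    have : 0 < -(3 * τ) := by linarith
    positivity
  have hd0 : 0 < d := by positivity
  have hd4 : d ^ 4 = 1 / (-(3 * τ)) := by
    rw [hd, ← Real.rpow_natCast, ← Real.rpow_mul hpos.le]
    norm_num
  have hτ : τ = -(1 / (3 * d ^ 4)) := by
    rw [hd4]
    field_simp
  rcases le_or_gt 2 d with h2 | h2
  · rw [hτ]
    exact norm_integral_airyIntegrand_le_of_critical_large h2 hN
  have b1 : ∀ v ∈ Icc 0 9, ‖∫ s in (0 : ℝ)..v, airyIntegrand τ s‖ ≤ 6 := fun v hv => by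
    have := norm_integral_airyIntegrand_le_trivial (τ := τ) hv
    rw [show (9 : ℝ) = 3 ^ 2 by norm_num, Real.sqrt_sq (by norm_num)] at this
    linarith
  have b2 : ∀ v ∈ Icc 9 (max N 9), ‖∫ s in (9 : ℝ)..v, airyIntegrand τ s‖ ≤ 4 := fun v hv => by
    have := norm_integral_airyIntegrand_le_of_le_deriv (τ := τ) (a := 9) (b := max N 9)
      (l := 1) (by norm_num) one_pos (fun s hs => ?_) hv
    · refine this.trans ?_
      have : (9 : ℝ) ^ (-(1 / 2) : ℝ) ≤ 1 :=
        Real.rpow_le_one_of_one_le_of_nonpos (by norm_num) (by norm_num)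
      linarith
    · refine le_trans ?_ (neg_le_abs _)
      have h4 : d ^ 4 ≤ 2 ^ 4 := pow_le_pow_left₀ hd0.le h2.le 4
      have h5 : -(3 * τ) * d ^ 4 = 1 := by
        rw [hd4]
        exact mul_one_div_cancel (by linarith)
      nlinarith [hs.1, mul_le_mul_of_nonneg_left h4 (show 0 ≤ -(3 * τ) by linarith),
        mul_nonneg (show 0 ≤ -(3 * τ) by linarith) (show 0 ≤ s ^ 2 - 81 by nlinarith [hs.1])]
  have c1 := norm_integral_airyIntegrand_le_add (le_max_right _ _) b1 b2 (by norm_num)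
  exact (c1 N ⟨hN, le_max_left _ _⟩).trans (by norm_num)

end Oscillatory

section AiryKernel

open Set Complex intervalIntegral
open scoped ENNReal Interval

/-- The integrand of the one-dimensional kernel with weight `|ξ|^(-1/2)` and phase `xξ + tξ³`. -/
noncomputable def airyKernel (x t ξ : ℝ) : ℂ :=
  ((|ξ| ^ (-(1 / 2) : ℝ) : ℝ) : ℂ) * exp (I * ((x * ξ + t * ξ ^ 3 : ℝ) : ℂ))

theorem airyKernel_neg (x t ξ : ℝ) : airyKernel x t (-ξ) = airyKernel (-x) (-t) ξ := by
  simp only [airyKernel, abs_neg]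
  congr 4
  ring

theorem airyKernel_neg_neg (x t ξ : ℝ) :
    airyKernel (-x) (-t) ξ = (starRingEnd ℂ) (airyKernel x t ξ) := by
  simp only [airyKernel, map_mul, conj_ofReal, ← exp_conj, conj_I]
  congr 2
  push_cast
  ring

theorem norm_airyKernel (x t ξ : ℝ) : ‖airyKernel x t ξ‖ = |ξ| ^ (-(1 / 2) : ℝ) := by
  rw [airyKernel, norm_mul, mul_comm I, norm_exp_ofReal_mul_I, mul_one, norm_real,
    Real.norm_eq_abs, abs_of_nonneg (by positivity)]

theorem intervalIntegrable_abs_rpow_neg_half (a b : ℝ) :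
    IntervalIntegrable (fun ξ : ℝ => |ξ| ^ (-(1 / 2) : ℝ)) volume a b := by
  have h : ∀ c : ℝ, 0 ≤ c →
      IntervalIntegrable (fun ξ : ℝ => |ξ| ^ (-(1 / 2) : ℝ)) volume 0 c := by
    intro c hc
    have := intervalIntegrable_rpow' (r := (-(1 / 2) : ℝ)) (a := 0) (b := c) (by norm_num)
    refine this.congr ?_
    intro s hs
    rw [uIoc_of_le hc] at hs
    simp only [abs_of_pos hs.1]
  have h' : ∀ c : ℝ, IntervalIntegrable (fun ξ : ℝ => |ξ| ^ (-(1 / 2) : ℝ)) volume 0 c := by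
    intro c
    rcases le_total 0 c with hc | hc
    · exact h c hc
    · have := (h (-c) (by linarith)).comp_mul_left (c := -1)
      simpa using this
  exact (h' a).symm.trans (h' b)

theorem intervalIntegrable_airyKernel (x t a b : ℝ) :
    IntervalIntegrable (airyKernel x t) volume a b := by
  have h := intervalIntegrable_abs_rpow_neg_half a b
  have h' : IntervalIntegrable (fun s : ℝ => ((|s| ^ (-(1 / 2) : ℝ) : ℝ) : ℂ)) volume a b :=
    ⟨h.1.ofReal, h.2.ofReal⟩
  exact h'.mul_continuousOn (by fun_prop)

theorem norm_integral_airyKernel_neg_neg (x t a b : ℝ) :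
    ‖∫ ξ in a..b, airyKernel (-x) (-t) ξ‖ = ‖∫ ξ in a..b, airyKernel x t ξ‖ := by
  simp only [airyKernel_neg_neg, norm_intervalIntegral_eq, integral_conj, norm_conj]

theorem norm_integral_airyKernel_le_of_pos {x : ℝ} (hx : 0 < x) (t : ℝ) {n : ℝ} (hn : 0 ≤ n) :
    ‖∫ ξ in (0 : ℝ)..n, airyKernel x t ξ‖ ≤ 24 * x ^ (-(1 / 2) : ℝ) := by
  have e : ∫ ξ in (0 : ℝ)..n, airyKernel x t ξ =
      ∫ ξ in (0 : ℝ)..n, ((x ^ (1 / 2 : ℝ) : ℝ) : ℂ) * airyIntegrand (t / x ^ 3) (x * ξ) := by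
    refine integral_congr fun ξ hξ => ?_
    rw [uIcc_of_le hn] at hξ
    simp only [airyKernel, airyIntegrand]
    rw [abs_of_nonneg hξ.1, Real.mul_rpow hx.le hξ.1, ← mul_assoc, ← ofReal_mul, ← mul_assoc,
      ← Real.rpow_add hx]
    congr 4
    · norm_num
    · field_simp
  rw [e, intervalIntegral.integral_const_mul, integral_comp_mul_left _ hx.ne', norm_mul,
    norm_smul, norm_real, Real.norm_of_nonneg (by positivity), Real.norm_of_nonneg (by positivity)]
  have h := norm_integral_airyIntegrand_le (t / x ^ 3) (mul_nonneg hx.le hn)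
  rw [mul_zero]
  calc _ ≤ x ^ (1 / 2 : ℝ) * (x⁻¹ * 24) := by gcongr
    _ = _ := by
      rw [← Real.rpow_neg_one x, ← mul_assoc, ← Real.rpow_add hx]
      norm_num
      ring

theorem norm_integral_airyKernel_le {x : ℝ} (hx : x ≠ 0) (t : ℝ) {n : ℝ} (hn : 0 ≤ n) :
    ‖∫ ξ in (-n)..n, airyKernel x t ξ‖ ≤ 48 * |x| ^ (-(1 / 2) : ℝ) := by
  have half : ‖∫ ξ in (0 : ℝ)..n, airyKernel x t ξ‖ ≤ 24 * |x| ^ (-(1 / 2) : ℝ) := by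
    rcases hx.lt_or_gt with h | h
    · rw [← norm_integral_airyKernel_neg_neg, abs_of_neg h]
      exact norm_integral_airyKernel_le_of_pos (by linarith) _ hn
    · rw [abs_of_pos h]
      exact norm_integral_airyKernel_le_of_pos h _ hn
  have left : ‖∫ ξ in (-n)..0, airyKernel x t ξ‖ = ‖∫ ξ in (0 : ℝ)..n, airyKernel x t ξ‖ := by
    rw [← norm_integral_airyKernel_neg_neg]
    simp only [← airyKernel_neg]
    rw [integral_comp_neg]
    simp
  rw [← integral_add_adjacent_intervals (intervalIntegrable_airyKernel x t (-n) 0)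
      (intervalIntegrable_airyKernel x t 0 n)]
  refine (norm_add_le _ _).trans ?_
  rw [left]
  linarith

theorem enorm_setIntegral_airyKernel_le (x t : ℝ) {n : ℝ} (hn : 0 ≤ n) :
    ‖∫ ξ in Ioc (-n) n, airyKernel x t ξ‖ₑ ≤ 48 * ‖x‖ₑ ^ (-(1 / 2) : ℝ) := by
  rcases eq_or_ne x 0 with rfl | hx
  · rw [enorm_zero, ENNReal.zero_rpow_of_neg (by norm_num), ENNReal.mul_top (by norm_num)]
    exact le_top
  · have h := norm_integral_airyKernel_le hx t hn
    rw [integral_of_le (by linarith)] at h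
    rw [← ofReal_norm, ← ofReal_norm, Real.norm_eq_abs,
      ENNReal.ofReal_rpow_of_pos (abs_pos.2 hx), show (48 : ℝ≥0∞) = ENNReal.ofReal 48 by simp,
      ← ENNReal.ofReal_mul (by norm_num)]
    exact ENNReal.ofReal_le_ofReal h

end AiryKernel

section Dual

open Set Complex
open scoped ENNReal

/-- The plane wave `e^{i(p·ζ + τ(ξ³+η³))}` at the point `p` and time `τ`. -/
noncomputable def planeWave (τ : ℝ) (p ζ : ℝ × ℝ) : ℂ :=
  exp (I * ((p.1 * ζ.1 + p.2 * ζ.2 + τ * (ζ.1 ^ 3 + ζ.2 ^ 3) : ℝ) : ℂ))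

theorem norm_planeWave (τ : ℝ) (p ζ : ℝ × ℝ) : ‖planeWave τ p ζ‖ = 1 := by
  rw [planeWave, mul_comm I, norm_exp_ofReal_mul_I]

theorem continuous_planeWave (τ : ℝ) (p : ℝ × ℝ) : Continuous (planeWave τ p) := by
  unfold planeWave
  fun_prop

theorem measurable_planeWave {t : ℝ × ℝ → ℝ} (ht : Measurable t) :
    Measurable fun z : (ℝ × ℝ) × (ℝ × ℝ) => planeWave (t z.1) z.1 z.2 := by
  unfold planeWave
  fun_prop

/-- The adjoint of the evolution evaluated along the time selection `t`. -/
noncomputable def dualEvolution (t : ℝ × ℝ → ℝ) (h : ℝ × ℝ → ℂ) (ζ : ℝ × ℝ) : ℂ :=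
  ∫ p : ℝ × ℝ, h p * planeWave (t p) p ζ

theorem aestronglyMeasurable_mul_planeWave {t : ℝ × ℝ → ℝ} (ht : Measurable t)
    {h : ℝ × ℝ → ℂ} (hh : Measurable h) (ζ : ℝ × ℝ) :
    AEStronglyMeasurable (fun p => h p * planeWave (t p) p ζ) := by
  refine (hh.mul ?_).aestronglyMeasurable
  exact (measurable_planeWave ht).comp (measurable_id.prodMk measurable_const)

theorem continuous_dualEvolution {t : ℝ × ℝ → ℝ} (ht : Measurable t) {h : ℝ × ℝ → ℂ}
    (hh : Measurable h) (hi : Integrable h) : Continuous (dualEvolution t h) := by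
  refine continuous_of_dominated (bound := fun p => ‖h p‖)
    (fun ζ => aestronglyMeasurable_mul_planeWave ht hh ζ)
    (fun ζ => Filter.Eventually.of_forall fun p => ?_) hi.norm
    (Filter.Eventually.of_forall fun p => continuous_const.mul (continuous_planeWave _ _))
  rw [norm_mul, norm_planeWave, mul_one]

theorem norm_dualEvolution_le (t : ℝ × ℝ → ℝ) (h : ℝ × ℝ → ℂ) (ζ : ℝ × ℝ) :
    ‖dualEvolution t h ζ‖ ≤ ∫ p, ‖h p‖ := by
  refine (norm_integral_le_integral_norm _).trans (le_of_eq ?_)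
  simp only [norm_mul, norm_planeWave, mul_one]

theorem airyKernel_mul_airyKernel (s s' : ℝ) (p q ζ : ℝ × ℝ) :
    airyKernel (p.1 - q.1) (s - s') ζ.1 * airyKernel (p.2 - q.2) (s - s') ζ.2 =
      ((|ζ.1| ^ (-(1 / 2) : ℝ) * |ζ.2| ^ (-(1 / 2) : ℝ) : ℝ) : ℂ) *
        (planeWave s p ζ * (starRingEnd ℂ) (planeWave s' q ζ)) := by
  simp only [airyKernel, planeWave, ← exp_conj, map_mul, conj_I, conj_ofReal]
  rw [← exp_add, mul_mul_mul_comm, ← exp_add, ← ofReal_mul]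
  congr 2
  push_cast
  ring

theorem integrable_airyWeight (n : ℝ) :
    Integrable (fun ζ : ℝ × ℝ => |ζ.1| ^ (-(1 / 2) : ℝ) * |ζ.2| ^ (-(1 / 2) : ℝ))
      ((volume.restrict (Ioc (-n) n)).prod (volume.restrict (Ioc (-n) n))) := by
  have h : Integrable (fun ξ : ℝ => |ξ| ^ (-(1 / 2) : ℝ)) (volume.restrict (Ioc (-n) n)) :=
    (intervalIntegrable_abs_rpow_neg_half (-n) n).1
  exact h.mul_prod h

theorem lintegral_airyWeight_mul_enorm_dualEvolution_sq_le {t : ℝ × ℝ → ℝ} (ht : Measurable t)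
    {h : ℝ × ℝ → ℂ} (hh : Measurable h) (hi : Integrable h) {n : ℝ} (hn : 0 ≤ n) :
    ∫⁻ ζ in Ioc (-n) n ×ˢ Ioc (-n) n,
        ENNReal.ofReal (|ζ.1| ^ (-(1 / 2) : ℝ) * |ζ.2| ^ (-(1 / 2) : ℝ)) *
          ‖dualEvolution t h ζ‖ₑ ^ 2 ≤
      48 ^ 2 * ∫⁻ p, ∫⁻ q, ‖h p‖ₑ * ‖h q‖ₑ *
        (‖p.1 - q.1‖ₑ ^ (-(1 / 2) : ℝ) * ‖p.2 - q.2‖ₑ ^ (-(1 / 2) : ℝ)) := by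
  set μ : Measure ℝ := volume.restrict (Ioc (-n) n) with hμ
  rw [Measure.volume_eq_prod ℝ ℝ, ← Measure.prod_restrict, ← hμ]
  have hw := integrable_airyWeight n
  rw [← hμ] at hw
  set w : ℝ × ℝ → ℝ := fun ζ => |ζ.1| ^ (-(1 / 2) : ℝ) * |ζ.2| ^ (-(1 / 2) : ℝ) with hwdef
  have hw0 : ∀ ζ, 0 ≤ w ζ := fun ζ => by simp only [hwdef]; positivity
  have hG := continuous_dualEvolution ht hh hi
  have hint : Integrable (fun ζ => w ζ * ‖dualEvolution t h ζ‖ ^ 2) (μ.prod μ) := by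
    refine hw.mul_bdd (c := (∫ p, ‖h p‖) ^ 2) (by fun_prop)
      (Filter.Eventually.of_forall fun ζ => ?_)
    rw [norm_pow, norm_norm]
    exact pow_le_pow_left₀ (norm_nonneg _) (norm_dualEvolution_le t h ζ) 2
  set F : ℝ × ℝ → (ℝ × ℝ) × (ℝ × ℝ) → ℂ := fun ζ z =>
    h z.1 * (starRingEnd ℂ) (h z.2) * (airyKernel (z.1.1 - z.2.1) (t z.1 - t z.2) ζ.1 *
      airyKernel (z.1.2 - z.2.2) (t z.1 - t z.2) ζ.2) with hF
  have hFG : ∀ ζ, ∫ z, F ζ z = ((w ζ * ‖dualEvolution t h ζ‖ ^ 2 : ℝ) : ℂ) := by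
    intro ζ
    have e : ∀ z, F ζ z = (w ζ : ℂ) * ((h z.1 * planeWave (t z.1) z.1 ζ) *
        (starRingEnd ℂ) (h z.2 * planeWave (t z.2) z.2 ζ)) := by
      intro z
      simp only [hF, airyKernel_mul_airyKernel, map_mul]
      ring
    simp only [e]
    rw [integral_const_mul, Measure.volume_eq_prod (ℝ × ℝ) (ℝ × ℝ),
      integral_prod_mul (fun p => h p * planeWave (t p) p ζ)
      (fun p => (starRingEnd ℂ) (h p * planeWave (t p) p ζ)), integral_conj]
    change (w ζ : ℂ) * (dualEvolution t h ζ * (starRingEnd ℂ) (dualEvolution t h ζ)) = _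
    rw [mul_conj, normSq_eq_norm_sq]
    push_cast
    ring
  have hFi : Integrable (Function.uncurry F) ((μ.prod μ).prod volume) := by
    have h1 : Integrable (fun z : (ℝ × ℝ) × (ℝ × ℝ) => h z.1 * (starRingEnd ℂ) (h z.2)) :=
      hi.mul_prod (f := h) (g := fun q => (starRingEnd ℂ) (h q)) ((Complex.conjLIE.integrable_comp_iff).2 hi)
    have h2 := hw.ofReal (𝕜 := ℂ) |>.mul_prod h1
    refine h2.mono ?_ (Filter.Eventually.of_forall fun z => le_of_eq ?_)
    · refine Measurable.aestronglyMeasurable ?_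
      simp only [hF, airyKernel, Function.uncurry_def]
      fun_prop
    · simp only [hF, Function.uncurry, norm_mul, norm_airyKernel, RCLike.norm_conj, hwdef]
      have hz := hw0 z.1
      simp only [hwdef] at hz
      rw [RCLike.norm_ofReal, abs_of_nonneg hz]
      ring
  have key : ∫⁻ ζ, ENNReal.ofReal (w ζ) * ‖dualEvolution t h ζ‖ₑ ^ 2 ∂(μ.prod μ) =
      ‖∫ ζ, ∫ z, F ζ z ∂volume ∂(μ.prod μ)‖ₑ := by
    simp only [hFG]
    rw [integral_complex_ofReal, ← ofReal_norm, norm_real, Real.norm_of_nonneg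
      (integral_nonneg fun ζ => mul_nonneg (hw0 ζ) (by positivity)),
      ofReal_integral_eq_lintegral_ofReal hint
        (Filter.Eventually.of_forall fun ζ => mul_nonneg (hw0 ζ) (by positivity))]
    refine lintegral_congr fun ζ => ?_
    rw [ENNReal.ofReal_mul (hw0 ζ), ENNReal.ofReal_pow (norm_nonneg _), ofReal_norm]
  rw [key, integral_integral_swap hFi]
  have inner : ∀ z : (ℝ × ℝ) × (ℝ × ℝ), ‖∫ ζ, F ζ z ∂(μ.prod μ)‖ₑ ≤
      48 ^ 2 * (‖h z.1‖ₑ * ‖h z.2‖ₑ * (‖z.1.1 - z.2.1‖ₑ ^ (-(1 / 2) : ℝ) *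
        ‖z.1.2 - z.2.2‖ₑ ^ (-(1 / 2) : ℝ))) := by
    intro z
    simp only [hF]
    rw [integral_const_mul, integral_prod_mul (airyKernel (z.1.1 - z.2.1) (t z.1 - t z.2))
      (airyKernel (z.1.2 - z.2.2) (t z.1 - t z.2)), enorm_mul, enorm_mul, enorm_mul,
      RCLike.enorm_conj]
    calc _ ≤ ‖h z.1‖ₑ * ‖h z.2‖ₑ * ((48 * ‖z.1.1 - z.2.1‖ₑ ^ (-(1 / 2) : ℝ)) *
        (48 * ‖z.1.2 - z.2.2‖ₑ ^ (-(1 / 2) : ℝ))) := by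
          gcongr <;> exact enorm_setIntegral_airyKernel_le _ _ hn
      _ = _ := by ring
  refine (enorm_integral_le_lintegral_enorm _).trans ((lintegral_mono inner).trans ?_)
  rw [lintegral_const_mul' _ _ (by norm_num), Measure.volume_eq_prod (ℝ × ℝ) (ℝ × ℝ),
    lintegral_prod _ (by fun_prop)]
  exact le_rfl

theorem lintegral_airyWeight_mul_enorm_dualEvolution_sq_le_lintegral {t : ℝ × ℝ → ℝ}
    (ht : Measurable t) {h : ℝ × ℝ → ℂ} (hh : Measurable h) (hi : Integrable h) {n : ℝ}
    (hn : 0 ≤ n) :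
    ∫⁻ ζ in Ioc (-n) n ×ˢ Ioc (-n) n,
        ENNReal.ofReal (|ζ.1| ^ (-(1 / 2) : ℝ) * |ζ.2| ^ (-(1 / 2) : ℝ)) *
          ‖dualEvolution t h ζ‖ₑ ^ 2 ≤
      576 ^ 2 * (∫⁻ p, ‖h p‖ₑ ^ (4 / 3 : ℝ)) ^ (3 / 2 : ℝ) := by
  refine (lintegral_airyWeight_mul_enorm_dualEvolution_sq_le ht hh hi hn).trans ?_
  refine (mul_le_mul_right (hardyLittlewoodSobolev_prod hh.enorm) _).trans ?_
  rw [← mul_assoc]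
  norm_num

end Dual

section Maximal

open Set Complex
open scoped ENNReal

/-- The evolution, at the point `p` and time `τ`, of the datum with Fourier transform `Φ`,
without the normalizing factor `(2π)⁻²`. -/
noncomputable def evolution (Φ : ℝ × ℝ → ℂ) (τ : ℝ) (p : ℝ × ℝ) : ℂ :=
  ∫ ζ : ℝ × ℝ, planeWave τ p ζ * Φ ζ

theorem norm_evolution_le (Φ : ℝ × ℝ → ℂ) (τ : ℝ) (p : ℝ × ℝ) :
    ‖evolution Φ τ p‖ ≤ ∫ ζ, ‖Φ ζ‖ := by
  refine (norm_integral_le_integral_norm _).trans (le_of_eq ?_)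
  simp only [norm_mul, norm_planeWave, one_mul]

theorem continuous_evolution {Φ : ℝ × ℝ → ℂ} (hc : Continuous Φ) (hΦ : Integrable Φ) :
    Continuous fun z : ℝ × (ℝ × ℝ) => evolution Φ z.1 z.2 := by
  refine continuous_of_dominated (bound := fun p => ‖Φ p‖)
    (fun z => ((continuous_planeWave _ _).mul hc).aestronglyMeasurable)
    (fun z => Filter.Eventually.of_forall fun ζ => ?_) hΦ.norm
    (Filter.Eventually.of_forall fun ζ => ?_)
  · rw [norm_mul, norm_planeWave, one_mul]
  · unfold planeWave
    fun_prop

theorem integral_mul_evolution {t : ℝ × ℝ → ℝ} (ht : Measurable t) {h Φ : ℝ × ℝ → ℂ}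
    (hh : Measurable h) (hi : Integrable h) (hc : Continuous Φ) (hΦ : Integrable Φ) :
    ∫ p, h p * evolution Φ (t p) p = ∫ ζ, Φ ζ * dualEvolution t h ζ := by
  simp only [evolution, dualEvolution, ← integral_const_mul]
  rw [integral_integral_swap]
  · refine integral_congr_ae (Filter.Eventually.of_forall fun ζ => ?_)
    refine integral_congr_ae (Filter.Eventually.of_forall fun p => ?_)
    ring
  · refine (hi.mul_prod hΦ).mono ?_ (Filter.Eventually.of_forall fun z => le_of_eq ?_)
    · have := measurable_planeWave ht
      have := hc.measurable
      exact ((hh.comp measurable_fst).mul (Measurable.mul (by assumption)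
        (this.comp measurable_snd))).aestronglyMeasurable
    · simp only [Function.uncurry, norm_mul, norm_planeWave, one_mul]

theorem ae_one_le_norm_mul_airyWeight : ∀ᵐ ζ : ℝ × ℝ,
    1 ≤ ‖ζ‖ * (|ζ.1| ^ (-(1 / 2) : ℝ) * |ζ.2| ^ (-(1 / 2) : ℝ)) := by
  have h1 : ∀ᵐ ζ : ℝ × ℝ, ζ.1 ≠ 0 :=
    Measure.quasiMeasurePreserving_fst.ae (p := fun x : ℝ => x ≠ 0) (Measure.ae_ne volume 0)
  have h2 : ∀ᵐ ζ : ℝ × ℝ, ζ.2 ≠ 0 :=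
    Measure.quasiMeasurePreserving_snd.ae (p := fun x : ℝ => x ≠ 0) (Measure.ae_ne volume 0)
  filter_upwards [h1, h2] with ζ hζ1 hζ2
  have hn : 0 < ‖ζ‖ := norm_pos_iff.2 fun h => hζ1 (by rw [h]; rfl)
  have b1 : ‖ζ‖ ^ (-(1 / 2) : ℝ) ≤ |ζ.1| ^ (-(1 / 2) : ℝ) :=
    Real.rpow_le_rpow_of_nonpos (abs_pos.2 hζ1) (norm_fst_le ζ) (by norm_num)
  have b2 : ‖ζ‖ ^ (-(1 / 2) : ℝ) ≤ |ζ.2| ^ (-(1 / 2) : ℝ) :=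
    Real.rpow_le_rpow_of_nonpos (abs_pos.2 hζ2) (norm_snd_le ζ) (by norm_num)
  calc (1 : ℝ) = ‖ζ‖ * (‖ζ‖ ^ (-(1 / 2) : ℝ) * ‖ζ‖ ^ (-(1 / 2) : ℝ)) := by
        rw [← Real.rpow_add hn]
        norm_num
        rw [Real.rpow_neg_one, mul_inv_cancel₀ hn.ne']
    _ ≤ _ := by gcongr

theorem lintegral_mul_le_sqrt_mul_sqrt_of_weight {α : Type*} [MeasurableSpace α] {μ : Measure α}
    {f g : α → ℝ≥0∞} {v w : α → ℝ} (hf : Measurable f) (hg : Measurable g) (hv : Measurable v)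
    (hw : Measurable w) (hv0 : ∀ x, 0 ≤ v x) (hw0 : ∀ x, 0 ≤ w x)
    (hvw : ∀ᵐ x ∂μ, 1 ≤ v x * w x) :
    ∫⁻ x, f x * g x ∂μ ≤ (∫⁻ x, ENNReal.ofReal (v x) * f x ^ 2 ∂μ) ^ (1 / 2 : ℝ) *
      (∫⁻ x, ENNReal.ofReal (w x) * g x ^ 2 ∂μ) ^ (1 / 2 : ℝ) := by
  have hsq : ∀ a : ℝ, 0 ≤ a → ∀ b : ℝ≥0∞,
      (ENNReal.ofReal √a * b) ^ (2 : ℝ) = ENNReal.ofReal a * b ^ 2 := by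
    intro a ha b
    rw [ENNReal.rpow_two, mul_pow, ← ENNReal.ofReal_pow (Real.sqrt_nonneg _), Real.sq_sqrt ha]
  have := ENNReal.lintegral_mul_le_Lp_mul_Lq μ (p := 2) (q := 2) Real.HolderConjugate.two_two
    (f := fun x => ENNReal.ofReal √(v x) * f x) (g := fun x => ENNReal.ofReal √(w x) * g x)
    (by fun_prop) (by fun_prop)
  simp only [hsq _ (hv0 _), hsq _ (hw0 _)] at this
  refine le_trans (lintegral_mono_ae ?_) this
  filter_upwards [hvw] with x hx
  have h1 : (1 : ℝ≥0∞) ≤ ENNReal.ofReal √(v x) * ENNReal.ofReal √(w x) := by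
    rw [← ENNReal.ofReal_mul (Real.sqrt_nonneg _), ← Real.sqrt_mul (hv0 x)]
    simpa using hx
  simp only [Pi.mul_apply]
  rw [mul_mul_mul_comm]
  exact le_mul_of_one_le_left' h1

theorem lintegral_enorm_mul_enorm_dualEvolution_le {t : ℝ × ℝ → ℝ} (ht : Measurable t)
    {h Φ : ℝ × ℝ → ℂ} (hh : Measurable h) (hi : Integrable h) (hc : Continuous Φ) :
    ∫⁻ ζ, ‖Φ ζ‖ₑ * ‖dualEvolution t h ζ‖ₑ ≤
      (∫⁻ ζ : ℝ × ℝ, ENNReal.ofReal ‖ζ‖ * ‖Φ ζ‖ₑ ^ 2) ^ (1 / 2 : ℝ) *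
        (576 * (∫⁻ p, ‖h p‖ₑ ^ (4 / 3 : ℝ)) ^ (3 / 4 : ℝ)) := by
  have hG := continuous_dualEvolution ht hh hi
  set Q : ℕ → Set (ℝ × ℝ) := fun n => Ioc (-n : ℝ) n ×ˢ Ioc (-n : ℝ) n with hQ
  have hmono : Monotone Q := fun m n hmn => by
    have : (m : ℝ) ≤ n := by exact_mod_cast hmn
    exact prod_mono (Ioc_subset_Ioc (by linarith) this) (Ioc_subset_Ioc (by linarith) this)
  have hun : ⋃ n, Q n = univ := by
    refine eq_univ_of_forall fun ζ => mem_iUnion.2 ?_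
    obtain ⟨n, hn⟩ := exists_nat_gt (max |ζ.1| |ζ.2|)
    have h1 := abs_lt.1 ((le_max_left _ _).trans_lt hn)
    have h2 := abs_lt.1 ((le_max_right _ _).trans_lt hn)
    exact ⟨n, ⟨h1.1, h1.2.le⟩, ⟨h2.1, h2.2.le⟩⟩
  rw [← setLIntegral_univ, ← hun, setLIntegral_iUnion_of_directed _ hmono.directed_le]
  refine iSup_le fun n => ?_
  have hw0 : ∀ ζ : ℝ × ℝ, 0 ≤ |ζ.1| ^ (-(1 / 2) : ℝ) * |ζ.2| ^ (-(1 / 2) : ℝ) :=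
    fun ζ => by positivity
  refine (lintegral_mul_le_sqrt_mul_sqrt_of_weight (by fun_prop) (by fun_prop) (by fun_prop)
    (by fun_prop) (fun ζ => norm_nonneg ζ) hw0
    (ae_restrict_of_ae ae_one_le_norm_mul_airyWeight)).trans ?_
  gcongr
  · exact Measure.restrict_le_self
  · refine (ENNReal.rpow_le_rpow (lintegral_airyWeight_mul_enorm_dualEvolution_sq_le_lintegral
      ht hh hi n.cast_nonneg) (by norm_num)).trans (le_of_eq ?_)
    rw [ENNReal.mul_rpow_of_nonneg _ _ (by norm_num), ← ENNReal.rpow_mul, ← ENNReal.rpow_natCast,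
      ← ENNReal.rpow_mul]
    norm_num

theorem ENNReal.le_pow_four_of_le_mul_rpow {M C : ℝ≥0∞} (hM : M ≠ ∞)
    (h : M ≤ C * M ^ (3 / 4 : ℝ)) : M ≤ C ^ 4 := by
  rcases eq_or_ne M 0 with rfl | h0
  · exact zero_le
  have h1 : M = M ^ (1 / 4 : ℝ) * M ^ (3 / 4 : ℝ) := by
    rw [← ENNReal.rpow_add _ _ h0 hM]
    norm_num
  have h2 : M ^ (1 / 4 : ℝ) ≤ C := by
    have h3 : M ^ (1 / 4 : ℝ) * M ^ (3 / 4 : ℝ) ≤ C * M ^ (3 / 4 : ℝ) := h1 ▸ h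
    refine (ENNReal.mul_le_mul_iff_left ?_ ?_).1 h3
    · simp [h0, hM]
    · exact ENNReal.rpow_ne_top_of_nonneg (by norm_num) hM
  calc M = (M ^ (1 / 4 : ℝ)) ^ 4 := by
        rw [← ENNReal.rpow_natCast, ← ENNReal.rpow_mul]
        norm_num
    _ ≤ C ^ 4 := by gcongr

theorem measurable_evolution_comp {t : ℝ × ℝ → ℝ} (ht : Measurable t) {Φ : ℝ × ℝ → ℂ}
    (hc : Continuous Φ) (hΦ : Integrable Φ) : Measurable fun p => evolution Φ (t p) p := by
  have h : Measurable fun z : ℝ × (ℝ × ℝ) => evolution Φ z.1 z.2 :=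
    (continuous_evolution hc hΦ).measurable
  have htp : Measurable fun p : ℝ × ℝ => (t p, p) := by fun_prop
  have := Measurable.comp h htp
  exact this

theorem lintegral_enorm_evolution_pow_four_le {t : ℝ × ℝ → ℝ} (ht : Measurable t)
    {Φ : ℝ × ℝ → ℂ} (hc : Continuous Φ) (hΦ : Integrable Φ) :
    ∫⁻ p, ‖evolution Φ (t p) p‖ₑ ^ 4 ≤
      (576 * (∫⁻ ζ : ℝ × ℝ, ENNReal.ofReal ‖ζ‖ * ‖Φ ζ‖ₑ ^ 2) ^ (1 / 2 : ℝ)) ^ 4 := by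
  set v : ℝ × ℝ → ℂ := fun p => evolution Φ (t p) p with hv
  have hvm : Measurable v := measurable_evolution_comp ht hc hΦ
  set A := ∫ ζ, ‖Φ ζ‖ with hA
  have hvb : ∀ p, ‖v p‖ ≤ A := fun p => norm_evolution_le Φ (t p) p
  set B : ℕ → Set (ℝ × ℝ) := fun n => Metric.closedBall 0 n with hB
  have hmono : Monotone B := fun m n hmn =>
    Metric.closedBall_subset_closedBall (by exact_mod_cast hmn)
  have hun : ⋃ n, B n = univ := Metric.iUnion_closedBall_nat 0
  rw [← setLIntegral_univ, ← hun, setLIntegral_iUnion_of_directed _ hmono.directed_le]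
  refine iSup_le fun n => ?_
  have hBm : MeasurableSet (B n) := Metric.isClosed_closedBall.measurableSet
  have hBf : volume (B n) ≠ ∞ := measure_closedBall_lt_top.ne
  set h : ℝ × ℝ → ℂ := (B n).indicator fun p => (starRingEnd ℂ) (v p) * ((‖v p‖ ^ 2 : ℝ) : ℂ)
    with hh
  have hhm : Measurable h := by
    refine Measurable.indicator ?_ hBm
    exact (continuous_conj.measurable.comp hvm).mul (measurable_ofReal.comp (hvm.norm.pow_const 2))
  have hnorm : ∀ p, ‖(starRingEnd ℂ) (v p) * ((‖v p‖ ^ 2 : ℝ) : ℂ)‖ = ‖v p‖ ^ 3 := by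
    intro p
    rw [norm_mul, RCLike.norm_conj, norm_real, Real.norm_of_nonneg (by positivity)]
    ring
  have hhi : Integrable h := by
    rw [hh, integrable_indicator_iff hBm]
    refine Measure.integrableOn_of_bounded (M := A ^ 3) hBf ?_
      (Filter.Eventually.of_forall fun p => ?_)
    · exact ((continuous_conj.measurable.comp hvm).mul
        (measurable_ofReal.comp (hvm.norm.pow_const 2))).aestronglyMeasurable
    · rw [hnorm]
      exact pow_le_pow_left₀ (norm_nonneg _) (hvb p) 3
  have hi4 : IntegrableOn (fun p => ‖v p‖ ^ 4) (B n) := by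
    refine Measure.integrableOn_of_bounded (M := A ^ 4) hBf
      (hvm.norm.pow_const 4).aestronglyMeasurable (Filter.Eventually.of_forall fun p => ?_)
    rw [norm_pow, norm_norm]
    exact pow_le_pow_left₀ (norm_nonneg _) (hvb p) 4
  have hM : ∫⁻ p in B n, ‖v p‖ₑ ^ 4 = ENNReal.ofReal (∫ p in B n, ‖v p‖ ^ 4) := by
    rw [ofReal_integral_eq_lintegral_ofReal hi4
      (Filter.Eventually.of_forall fun p => by positivity)]
    refine lintegral_congr fun p => ?_
    rw [ENNReal.ofReal_pow (norm_nonneg _), ofReal_norm]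
  have hpair : ∫ p, h p * v p = ((∫ p in B n, ‖v p‖ ^ 4 : ℝ) : ℂ) := by
    rw [← integral_complex_ofReal, ← integral_indicator hBm]
    refine integral_congr_ae (Filter.Eventually.of_forall fun p => ?_)
    by_cases hp : p ∈ B n
    · simp only [hh, indicator_of_mem hp]
      rw [mul_right_comm, conj_mul']
      push_cast
      ring
    · simp only [hh, indicator_of_notMem hp, zero_mul]
  have h43 : ∫⁻ p, ‖h p‖ₑ ^ (4 / 3 : ℝ) = ∫⁻ p in B n, ‖v p‖ₑ ^ 4 := by
    rw [← lintegral_indicator hBm]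
    refine lintegral_congr fun p => ?_
    by_cases hp : p ∈ B n
    · simp only [hh, indicator_of_mem hp]
      rw [← ofReal_norm, hnorm, ENNReal.ofReal_pow (norm_nonneg _), ofReal_norm,
        ← ENNReal.rpow_natCast, ← ENNReal.rpow_mul, ← ENNReal.rpow_natCast]
      norm_num
    · simp [hh, indicator_of_notMem hp]
  refine ENNReal.le_pow_four_of_le_mul_rpow (by rw [hM]; exact ENNReal.ofReal_ne_top) ?_
  calc ∫⁻ p in B n, ‖v p‖ₑ ^ 4 = ‖∫ p, h p * v p‖ₑ := by
        rw [hM, hpair, ← ofReal_norm, norm_real,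
          Real.norm_of_nonneg (integral_nonneg fun p => by positivity)]
    _ ≤ ∫⁻ ζ, ‖Φ ζ‖ₑ * ‖dualEvolution t h ζ‖ₑ := by
        rw [integral_mul_evolution ht hhm hhi hc hΦ]
        refine (enorm_integral_le_lintegral_enorm _).trans (le_of_eq ?_)
        simp only [enorm_mul]
    _ ≤ _ := by
        refine (lintegral_enorm_mul_enorm_dualEvolution_le ht hhm hhi hc).trans (le_of_eq ?_)
        rw [h43]
        ring

end Maximal

section MaximalFunction

open Set Complex
open scoped ENNReal

theorem bddAbove_range_norm_evolution (Φ : ℝ × ℝ → ℂ) (p : ℝ × ℝ) :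
    BddAbove (range fun τ : ℝ => ‖evolution Φ τ p‖) :=
  ⟨∫ ζ, ‖Φ ζ‖, by rintro _ ⟨τ, rfl⟩; exact norm_evolution_le Φ τ p⟩

theorem measurable_iSup_norm_evolution {Φ : ℝ × ℝ → ℂ} (hc : Continuous Φ)
    (hΦ : Integrable Φ) : Measurable fun p => ⨆ τ : ℝ, ‖evolution Φ τ p‖ := by
  refine LowerSemicontinuous.measurable
    (lowerSemicontinuous_ciSup (bddAbove_range_norm_evolution Φ) fun τ => ?_)
  have h := (continuous_evolution hc hΦ).norm.comp
    (show Continuous fun p : ℝ × ℝ => (τ, p) by fun_prop)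
  exact Continuous.lowerSemicontinuous h

theorem exists_measurable_iSup_norm_evolution_le {Φ : ℝ × ℝ → ℂ} (hc : Continuous Φ)
    (hΦ : Integrable Φ) : ∃ t : ℝ × ℝ → ℝ, Measurable t ∧
      ∀ p, ⨆ τ : ℝ, ‖evolution Φ τ p‖ ≤ 2 * ‖evolution Φ (t p) p‖ := by
  classical
  have hS := measurable_iSup_norm_evolution hc hΦ
  set S : ℝ × ℝ → ℝ := fun p => ⨆ τ : ℝ, ‖evolution Φ τ p‖ with hSdef
  obtain ⟨q, hq⟩ := TopologicalSpace.exists_dense_seq ℝ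
  have hex : ∀ p, ∃ k, S p ≤ 2 * ‖evolution Φ (q k) p‖ := by
    intro p
    rcases le_or_gt (S p) 0 with h0 | h0
    · exact ⟨0, h0.trans (by positivity)⟩
    obtain ⟨τ, hτ⟩ := exists_lt_of_lt_ciSup (show S p / 2 < ⨆ τ : ℝ, ‖evolution Φ τ p‖ by
      change S p / 2 < S p
      linarith)
    have hcont := (continuous_evolution hc hΦ).norm.comp
      (show Continuous fun τ : ℝ => (τ, p) by fun_prop)
    obtain ⟨k, hk⟩ := hq.exists_mem_open
      (isOpen_lt (continuous_const (y := S p / 2)) hcont) ⟨τ, hτ⟩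
    refine ⟨k, ?_⟩
    have hk' : S p / 2 < ‖evolution Φ (q k) p‖ := hk
    linarith
  refine ⟨fun p => q (Nat.find (hex p)), ?_, fun p => Nat.find_spec (hex p)⟩
  refine (measurable_from_nat (f := q)).comp (measurable_find hex fun k => ?_)
  have hm := measurable_evolution_comp (t := fun _ => q k) measurable_const hc hΦ
  exact measurableSet_le hS (hm.norm.const_mul 2)

theorem integral_iSup_norm_evolution_pow_four_le (Φ : SchwartzMap (ℝ × ℝ) ℂ) :
    ∫ p, (⨆ τ : ℝ, ‖evolution Φ τ p‖) ^ 4 ≤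
      (1152 * √(∫ ζ : ℝ × ℝ, ‖ζ‖ * ‖Φ ζ‖ ^ 2)) ^ 4 := by
  have hc := Φ.continuous
  have hΦ := Φ.integrable (μ := volume)
  have hS := measurable_iSup_norm_evolution hc hΦ
  obtain ⟨t, ht, hle⟩ := exists_measurable_iSup_norm_evolution_le hc hΦ
  have hS0 : ∀ p, 0 ≤ ⨆ τ : ℝ, ‖evolution Φ τ p‖ := fun p =>
    Real.iSup_nonneg fun _ => norm_nonneg _
  have hK : ∫⁻ ζ : ℝ × ℝ, ENNReal.ofReal ‖ζ‖ * ‖Φ ζ‖ₑ ^ 2 =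
      ENNReal.ofReal (∫ ζ : ℝ × ℝ, ‖ζ‖ * ‖Φ ζ‖ ^ 2) := by
    rw [ofReal_integral_eq_lintegral_ofReal (integrable_norm_mul_norm_sq Φ)
      (Filter.Eventually.of_forall fun ζ => by positivity)]
    refine lintegral_congr fun ζ => ?_
    rw [ENNReal.ofReal_mul (norm_nonneg _), ENNReal.ofReal_pow (norm_nonneg _), ofReal_norm (Φ ζ)]
  have hmain := lintegral_enorm_evolution_pow_four_le ht hc hΦ
  rw [hK, ENNReal.ofReal_rpow_of_nonneg (integral_nonneg fun _ => by positivity) (by norm_num),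
    ← Real.sqrt_eq_rpow] at hmain
  rw [integral_eq_lintegral_of_nonneg_ae
    (Filter.Eventually.of_forall fun p => pow_nonneg (hS0 p) 4)
    (hS.pow_const 4).aestronglyMeasurable]
  refine ENNReal.toReal_le_of_le_ofReal (by positivity) ?_
  calc ∫⁻ p, ENNReal.ofReal ((⨆ τ : ℝ, ‖evolution Φ τ p‖) ^ 4)
      ≤ ∫⁻ p, 2 ^ 4 * ‖evolution Φ (t p) p‖ₑ ^ 4 := by
        refine lintegral_mono fun p => ?_
        rw [ENNReal.ofReal_pow (hS0 p), ← mul_pow]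
        refine pow_le_pow_left₀ zero_le ?_ 4
        calc _ ≤ ENNReal.ofReal (2 * ‖evolution Φ (t p) p‖) := ENNReal.ofReal_le_ofReal (hle p)
          _ = _ := by rw [ENNReal.ofReal_mul zero_le_two, ofReal_norm, ENNReal.ofReal_ofNat]
    _ = 2 ^ 4 * ∫⁻ p, ‖evolution Φ (t p) p‖ₑ ^ 4 := lintegral_const_mul' _ _ (by norm_num)
    _ ≤ 2 ^ 4 * (576 * ENNReal.ofReal √(∫ ζ : ℝ × ℝ, ‖ζ‖ * ‖Φ ζ‖ ^ 2)) ^ 4 := by gcongr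
    _ = _ := by
        rw [← mul_pow, ← mul_assoc, ENNReal.ofReal_pow (by positivity),
          ENNReal.ofReal_mul (by norm_num), ENNReal.ofReal_ofNat]
        norm_num

theorem UD_zero_eq {f : ℝ × ℝ → ℂ} {Φ : ℝ × ℝ → ℂ} (hΦ : FT f = Φ) (x y t : ℝ) :
    UD 0 f x y t = ((((2 * Real.pi) ^ 2)⁻¹ : ℝ) : ℂ) * evolution Φ t (x, y) := by
  simp only [UD, evolution, planeWave, hΦ, Real.rpow_zero, ofReal_one, one_mul]

end MaximalFunction

/-- the `L⁴_{x,y}L^∞_t` maximal-in-time estimate for the free evolution of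
the linear symmetrized mZK equation: `‖U(t)f‖_{L⁴_{x,y}L^∞_t} ≤ C ‖D^{1/2} f‖_{L²(ℝ²)}`.
Here `U(t)f = UD 0 f` and `D^{1/2} f = UD (1/2) f (·,·) 0`. -/
theorem maximal_in_time_L4xy :
    ∃ C : ℝ, 0 < C ∧
      ∀ f : SchwartzMap (ℝ × ℝ) ℂ,
        (∫ p : ℝ × ℝ, (⨆ t : ℝ, ‖UD 0 ⇑f p.1 p.2 t‖) ^ 4) ^ ((1 : ℝ)/4)
          ≤ C * Real.sqrt (∫ p : ℝ × ℝ, ‖UD ((1 : ℝ)/2) ⇑f p.1 p.2 0‖ ^ 2) := by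
  have hpi := Real.pi_pos
  refine ⟨1152 / (2 * Real.pi), by positivity, fun f => ?_⟩
  obtain ⟨Φ, hΦ⟩ := exists_schwartz_eq_FT f
  rw [sqrt_integral_UD_half hΦ]
  set c : ℝ := ((2 * Real.pi) ^ 2)⁻¹ with hc
  have hc0 : 0 ≤ c := by positivity
  have hS : ∀ p : ℝ × ℝ, ⨆ t : ℝ, ‖UD 0 ⇑f p.1 p.2 t‖ = c * ⨆ t : ℝ, ‖evolution Φ t p‖ := by
    intro p
    rw [Real.mul_iSup_of_nonneg hc0]
    refine iSup_congr fun t => ?_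
    rw [UD_zero_eq hΦ, norm_mul, Complex.norm_real, Real.norm_of_nonneg hc0]
  simp only [hS, mul_pow]
  rw [integral_const_mul]
  set K := √(∫ ζ : ℝ × ℝ, ‖ζ‖ * ‖Φ ζ‖ ^ 2) with hK
  calc (c ^ 4 * ∫ p, (⨆ t : ℝ, ‖evolution Φ t p‖) ^ 4) ^ ((1 : ℝ) / 4)
      ≤ (c ^ 4 * (1152 * K) ^ 4) ^ ((1 : ℝ) / 4) := by
        have := integral_iSup_norm_evolution_pow_four_le Φ
        have h0 : 0 ≤ ∫ p, (⨆ t : ℝ, ‖evolution Φ t p‖) ^ 4 :=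
          integral_nonneg fun p => by positivity
        gcongr
    _ = c * (1152 * K) := by
        rw [← mul_pow, ← Real.rpow_natCast, ← Real.rpow_mul (by positivity)]
        norm_num
    _ = _ := by
        rw [hc]
        field_simp
end
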